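/- Assume GRH(q), and let ℓ⁽¹⁾ and ℓ⁽²⁾ be tuples of nonnegative integers indexed by the Dirichlet characters modulo q with |ℓ⁽¹⁾| = |ℓ⁽²⁾| = k, such that ℓ⁽¹⁾ ≠ ℓ⁽²⁾ and at least one of ℓ⁽¹⁾, ℓ⁽²⁾ is not of the form k·δ^χ for any Dirichlet character χ modulo q (where δ^χ is the tuple with entry 1 at χ and 0 elsewhere). Then for every ε > 0, |∫_T^{2T} 𝓛^{ℓ⁽¹⁾}(1/2+it) · conj(𝓛^{ℓ⁽²⁾}(1/2+it)) dt| ≪_{q,k,ε} T(log T)^{k²−1/2+ε} for all sufficiently large T. -/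

import Mathlib

open Complex Filter MeasureTheory Finset HurwitzZeta
open scoped ArithmeticFunction Real Classical

noncomputable section

/-- The finite set of primes `p ≤ X`. -/
def primesUpTo (X : ℝ) : Finset ℕ :=
  (Finset.range (Nat.floor X + 1)).filter (fun p => p.Prime ∧ (p : ℝ) ≤ X)

/-- The finite set of naturals `n ≤ X`. -/
def natsUpTo (X : ℝ) : Finset ℕ :=
  (Finset.range (Nat.floor X + 1)).filter (fun n => (n : ℝ) ≤ X)

/-- Truncated Euler product `P_X(s,χ)`, defined via the primitive character `χ*` inducing `χ`:
`P_X(s,χ) = ∏_{p ∣ q} (1 - χ*(p) p^{-s}) · exp(∑_{n ≤ X} χ*(n) Λ(n) / (n^s log n))`. -/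
def PX {q : ℕ} (X : ℝ) (χ : DirichletCharacter ℂ q) (s : ℂ) : ℂ :=
  (∏ p ∈ q.primeFactors, (1 - χ.primitiveCharacter ((p : ℕ) : ZMod χ.conductor) * (p : ℂ) ^ (-s))) *
    Complex.exp (∑ n ∈ natsUpTo X,
      χ.primitiveCharacter ((n : ℕ) : ZMod χ.conductor) * (Λ n : ℂ) / ((n : ℂ) ^ s * (Real.log n : ℂ)))

/-- `𝓟_X^ℓ(s) = ∏_χ P_X(s,χ)^{ℓ_χ}`. -/
def PXl {q : ℕ} (X : ℝ) (ℓ : DirichletCharacter ℂ q → ℕ) (s : ℂ) : ℂ :=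
  ∏ χ : DirichletCharacter ℂ q, (PX X χ s) ^ (ℓ χ)

/-- A Dirichlet character as an arithmetic function. -/
def chiArith {q : ℕ} (χ : DirichletCharacter ℂ q) : ArithmeticFunction ℂ :=
  ⟨fun n => if n = 0 then 0 else χ ((n : ℕ) : ZMod q), by simp⟩

/-- `d_ℓ`, the coefficients of the Dirichlet series of `𝓛^ℓ(s) = ∏_χ L(s,χ)^{ℓ_χ}`,
i.e. the Dirichlet convolution product `∏_χ χ^{*ℓ_χ}`. -/
def dcoef {q : ℕ} (ℓ : DirichletCharacter ℂ q → ℕ) : ArithmeticFunction ℂ :=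
  ∏ χ : DirichletCharacter ℂ q, (chiArith χ) ^ (ℓ χ)

/-- `P*_X(s,χ) = ∏_{p ≤ X}(1 − χ(p)p^{−s})^{−1} · ∏_{√X < p ≤ X}(1 + χ(p)²/(2p^{2s}))^{−1}`. -/
def PstarX {q : ℕ} (X : ℝ) (χ : DirichletCharacter ℂ q) (s : ℂ) : ℂ :=
  ((primesUpTo X).prod (fun p : ℕ => (1 - χ ((p : ℕ) : ZMod q) * (p : ℂ) ^ (-s))⁻¹)) *
    ((primesUpTo X).filter (fun p : ℕ => Real.sqrt X < (p : ℝ))).prod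
      (fun p : ℕ => (1 + χ ((p : ℕ) : ZMod q) ^ 2 / (2 * (p : ℂ) ^ (2 * s)))⁻¹)

/-- `𝓟*_X^ℓ(s) = ∏_χ P*_X(s,χ)^{ℓ_χ}`. -/
def PstarXl {q : ℕ} (X : ℝ) (ℓ : DirichletCharacter ℂ q → ℕ) (s : ℂ) : ℂ :=
  ∏ χ : DirichletCharacter ℂ q, (PstarX X χ s) ^ (ℓ χ)

/-- `Q_X(s,χ) = ∏_{p ≤ √X}(1 − χ(p)p^{−s}) · ∏_{√X < p ≤ X}(1 − χ(p)p^{−s} + χ(p)²/(2p^{2s}))`. -/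
def QX {q : ℕ} (X : ℝ) (χ : DirichletCharacter ℂ q) (s : ℂ) : ℂ :=
  (((primesUpTo X).filter (fun p : ℕ => (p : ℝ) ≤ Real.sqrt X)).prod
      (fun p : ℕ => 1 - χ ((p : ℕ) : ZMod q) * (p : ℂ) ^ (-s))) *
    ((primesUpTo X).filter (fun p : ℕ => Real.sqrt X < (p : ℝ))).prod
      (fun p : ℕ => 1 - χ ((p : ℕ) : ZMod q) * (p : ℂ) ^ (-s)
        + χ ((p : ℕ) : ZMod q) ^ 2 / (2 * (p : ℂ) ^ (2 * s)))

/-- `𝓠_X^ℓ(s) = ∏_χ Q_X(s,χ)^{ℓ_χ}`. -/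
def QXl {q : ℕ} (X : ℝ) (ℓ : DirichletCharacter ℂ q → ℕ) (s : ℂ) : ℂ :=
  ∏ χ : DirichletCharacter ℂ q, (QX X χ s) ^ (ℓ χ)

/-- `𝓛^ℓ(s) = ∏_χ L(s,χ)^{ℓ_χ}`. -/
def Ll {q : ℕ} [NeZero q] (ℓ : DirichletCharacter ℂ q → ℕ) (s : ℂ) : ℂ :=
  ∏ χ : DirichletCharacter ℂ q, (DirichletCharacter.LFunction χ s) ^ (ℓ χ)

/-- GRH for the Dirichlet L-functions modulo `q`: every zero `ρ` of `L(s,χ)` with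
`0 < Re ρ < 1` satisfies `Re ρ = 1/2`. -/
def GRHmod (q : ℕ) [NeZero q] : Prop :=
  ∀ χ : DirichletCharacter ℂ q, ∀ ρ : ℂ,
    DirichletCharacter.LFunction χ ρ = 0 → 0 < ρ.re → ρ.re < 1 → ρ.re = 1 / 2

end

namespace DirichletMoment

/-- The mean value of a Dirichlet character over one period. -/
noncomputable def charMean {q : ℕ} (χ : DirichletCharacter ℂ q) : ℂ :=
  (∑ k ∈ Finset.Icc 1 q, χ (k : ZMod q)) / q

theorem exists_norm_sum_sub_charMean_le {q : ℕ} [NeZero q] (χ : DirichletCharacter ℂ q) :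
    ∃ B : ℝ, 0 < B ∧ ∀ t : ℝ, 0 ≤ t →
      ‖∑ k ∈ Finset.Icc 1 ⌊t⌋₊, χ (k : ZMod q) - charMean χ * t‖ ≤ B := by
  set E : ℕ → ℂ := fun n => ∑ k ∈ Finset.Icc 1 n, χ (k : ZMod q) - charMean χ * n with hE
  have hq : (q : ℂ) ≠ 0 := by exact_mod_cast NeZero.ne q
  have hstep : ∀ n : ℕ, ∑ k ∈ Finset.Icc 1 (n + 1), χ (k : ZMod q)
      = ∑ k ∈ Finset.Icc 1 n, χ (k : ZMod q) + χ ((n + 1 : ℕ) : ZMod q) := fun n => by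
    rw [Finset.sum_Icc_succ_top (by omega)]
  have hadd : ∀ n, ∑ k ∈ Finset.Icc 1 (n + q), χ (k : ZMod q)
      = ∑ k ∈ Finset.Icc 1 n, χ (k : ZMod q) + charMean χ * q := by
    intro n
    induction n with
    | zero => simp [charMean, hq]
    | succ n ih =>
      rw [show n + 1 + q = (n + q) + 1 by ring, hstep, hstep, ih]
      have : ((n + q + 1 : ℕ) : ZMod q) = ((n + 1 : ℕ) : ZMod q) := by push_cast; simp
      rw [this]; ring
  have hper : Function.Periodic E q := by
    intro n
    simp only [hE, hadd]
    push_cast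
    ring
  have hbd : ∀ n, ‖E n‖ ≤ ∑ j ∈ Finset.range q, ‖E j‖ := by
    intro n
    rw [← hper.map_mod_nat n]
    exact Finset.single_le_sum (f := fun j => ‖E j‖) (fun _ _ => norm_nonneg _)
      (Finset.mem_range.2 (Nat.mod_lt _ (NeZero.pos q)))
  refine ⟨∑ j ∈ Finset.range q, ‖E j‖ + ‖charMean χ‖ + 1, by positivity, fun t ht => ?_⟩
  have h1 : ∑ k ∈ Finset.Icc 1 ⌊t⌋₊, χ (k : ZMod q) - charMean χ * t
      = E ⌊t⌋₊ - charMean χ * ((t - ⌊t⌋₊ : ℝ) : ℂ) := by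
    simp only [hE]; push_cast; ring
  rw [h1]
  refine (norm_sub_le _ _).trans ?_
  have h2 : ‖((t - ⌊t⌋₊ : ℝ) : ℂ)‖ ≤ 1 := by
    rw [Complex.norm_real, Real.norm_eq_abs, abs_le]
    have := Nat.floor_le ht
    have := Nat.lt_floor_add_one t
    constructor <;> linarith
  rw [norm_mul]
  have := mul_le_mul_of_nonneg_left h2 (norm_nonneg (charMean χ))
  linarith [hbd ⌊t⌋₊]

theorem measurable_sum_floor (f : ℕ → ℂ) :
    Measurable fun t : ℝ => ∑ k ∈ Finset.Icc 1 ⌊t⌋₊, f k :=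
  (measurable_from_top (f := fun n : ℕ => ∑ k ∈ Finset.Icc 1 n, f k)).comp Nat.measurable_floor

/-- The regular part of `L(s, χ) / s`, as an integral converging for `0 < re s`. -/
noncomputable def regularPart {q : ℕ} (χ : DirichletCharacter ℂ q) (s : ℂ) : ℂ :=
  ∫ t in Set.Ioi (1 : ℝ), (∑ k ∈ Finset.Icc 1 ⌊t⌋₊, χ (k : ZMod q) - charMean χ * t)
    * (t : ℂ) ^ (-(s + 1))

theorem norm_regularPart_le {q : ℕ} (χ : DirichletCharacter ℂ q) {B : ℝ}
    (hB : ∀ t : ℝ, 0 ≤ t → ‖∑ k ∈ Finset.Icc 1 ⌊t⌋₊, χ (k : ZMod q) - charMean χ * t‖ ≤ B)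
    {s : ℂ} (hs : 0 < s.re) : ‖regularPart χ s‖ ≤ B / s.re := by
  have hintg : IntegrableOn (fun t : ℝ => B * t ^ (-(s.re + 1))) (Set.Ioi 1) :=
    (integrableOn_Ioi_rpow_of_lt (by linarith) one_pos).const_mul B
  have h1 : ‖regularPart χ s‖ ≤ ∫ t in Set.Ioi (1 : ℝ), B * t ^ (-(s.re + 1)) := by
    refine norm_integral_le_of_norm_le hintg ?_
    refine (ae_restrict_iff' measurableSet_Ioi).2 (Eventually.of_forall fun t ht => ?_)
    have ht0 : (0 : ℝ) < t := lt_trans one_pos ht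
    rw [norm_mul, Complex.norm_cpow_eq_rpow_re_of_pos ht0]
    have : (-(s + 1)).re = -(s.re + 1) := by simp
    rw [this]
    exact mul_le_mul_of_nonneg_right (hB t ht0.le) (by positivity)
  rw [integral_const_mul, integral_Ioi_rpow_of_lt (by linarith) one_pos] at h1
  refine h1.trans (le_of_eq ?_)
  rw [Real.one_rpow]
  field_simp
  ring_nf
  field_simp

theorem differentiableAt_regularPart {q : ℕ} [NeZero q] (χ : DirichletCharacter ℂ q)
    {s : ℂ} (hs : 0 < s.re) : DifferentiableAt ℂ (regularPart χ) s := by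
  obtain ⟨B, hB0, hB⟩ := exists_norm_sum_sub_charMean_le χ
  set g : ℝ → ℂ := fun t => ∑ k ∈ Finset.Icc 1 ⌊t⌋₊, χ (k : ZMod q) - charMean χ * t with hg
  set f : ℝ → ℂ := (Set.Ioi 1).indicator g with hf
  have hgm : Measurable g :=
    (measurable_sum_floor _).sub ((Complex.measurable_ofReal).const_mul _)
  have hfm : Measurable f := hgm.indicator measurableSet_Ioi
  have hfB : ∀ t, ‖f t‖ ≤ B := by
    intro t
    by_cases h : t ∈ Set.Ioi (1 : ℝ)
    · simp only [hf, Set.indicator_of_mem h]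
      exact hB t (by linarith [Set.mem_Ioi.1 h])
    · simp only [hf, Set.indicator_of_notMem h, norm_zero]; exact hB0.le
  have heq : regularPart χ = fun s => mellin f (-s) := by
    funext s
    unfold regularPart mellin
    rw [← integral_indicator measurableSet_Ioi, ← integral_indicator measurableSet_Ioi]
    congr 1
    funext t
    by_cases h : t ∈ Set.Ioi (1 : ℝ)
    · have h0 : t ∈ Set.Ioi (0 : ℝ) := lt_trans (one_pos : (0 : ℝ) < 1) h
      rw [Set.indicator_of_mem h, Set.indicator_of_mem h0]
      simp only [hf, Set.indicator_of_mem h, hg, smul_eq_mul]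
      rw [mul_comm]
      congr 2
      ring
    · rw [Set.indicator_of_notMem h]
      by_cases h0 : t ∈ Set.Ioi (0 : ℝ)
      · rw [Set.indicator_of_mem h0]
        simp [hf, Set.indicator_of_notMem h]
      · rw [Set.indicator_of_notMem h0]
  have hloc : LocallyIntegrableOn f (Set.Ioi 0) := by
    apply LocallyIntegrable.locallyIntegrableOn
    refine (locallyIntegrable_const B).mono hfm.aestronglyMeasurable ?_
    exact Eventually.of_forall fun t => by
      rw [Real.norm_of_nonneg hB0.le]; exact hfB t
  have h1 : f =O[atTop] fun x => x ^ (-(0 : ℝ)) := by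
    refine Asymptotics.IsBigO.of_bound B (Eventually.of_forall fun t => ?_)
    simpa using hfB t
  have h2 : f =O[nhdsWithin 0 (Set.Ioi 0)] fun x => x ^ (-(-s.re - 1)) := by
    refine Asymptotics.IsBigO.of_bound 1 ?_
    have : ∀ᶠ t : ℝ in nhdsWithin 0 (Set.Ioi 0), t < 1 :=
      eventually_nhdsWithin_of_eventually_nhds (gt_mem_nhds one_pos)
    filter_upwards [this] with t ht
    rw [hf, Set.indicator_of_notMem (by simpa using ht.le)]
    simp
  have := mellin_differentiableAt_of_isBigO_rpow (s := -s) hloc h1 (by simpa using hs) h2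
    (by simp)
  rw [heq]
  exact this.comp s differentiableAt_id.neg

theorem LFunction_eq_of_one_lt_re {q : ℕ} [NeZero q] (χ : DirichletCharacter ℂ q)
    {s : ℂ} (hs : 1 < s.re) :
    DirichletCharacter.LFunction χ s = s * charMean χ / (s - 1) + s * regularPart χ s := by
  obtain ⟨B, hB0, hB⟩ := exists_norm_sum_sub_charMean_le χ
  have hs1 : s - 1 ≠ 0 := by
    intro h
    have : s = 1 := by linear_combination h
    rw [this] at hs; simp at hs
  have hO : (fun n : ℕ => ∑ k ∈ Finset.Icc 1 n, χ (k : ZMod q)) =O[atTop]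
      fun n => (n : ℝ) ^ (1 : ℝ) := by
    refine Asymptotics.IsBigO.of_bound 1 (Eventually.of_forall fun n => ?_)
    rw [Real.rpow_one, Real.norm_of_nonneg (Nat.cast_nonneg n), one_mul]
    refine (norm_sum_le _ _).trans ?_
    refine (Finset.sum_le_sum fun (k : ℕ) _ =>
      DirichletCharacter.norm_le_one χ (k : ZMod q)).trans ?_
    simp
  rw [DirichletCharacter.LFunction_eq_LSeries χ hs,
    LSeries_eq_mul_integral _ zero_le_one hs
      (DirichletCharacter.LSeriesSummable_of_one_lt_re χ hs) hO, mul_div_assoc, ← mul_add]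
  congr 1
  have hI1 : IntegrableOn (fun t : ℝ => charMean χ * (t : ℂ) ^ (-s)) (Set.Ioi 1) :=
    (integrableOn_Ioi_cpow_of_lt (by simpa using hs) one_pos).const_mul _
  have hI2 : IntegrableOn (fun t : ℝ => (∑ k ∈ Finset.Icc 1 ⌊t⌋₊, χ (k : ZMod q)
      - charMean χ * t) * (t : ℂ) ^ (-(s + 1))) (Set.Ioi 1) := by
    have hintg : IntegrableOn (fun t : ℝ => B * t ^ (-(s.re + 1))) (Set.Ioi 1) :=
      (integrableOn_Ioi_rpow_of_lt (by linarith) one_pos).const_mul B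
    refine Integrable.mono' hintg ?_ ?_
    · have h1 : Measurable fun t : ℝ => ∑ k ∈ Finset.Icc 1 ⌊t⌋₊, χ (k : ZMod q) - charMean χ * t :=
        (measurable_sum_floor _).sub ((Complex.measurable_ofReal).const_mul _)
      exact (h1.mul (Complex.measurable_ofReal.pow_const _)).aestronglyMeasurable
    · refine (ae_restrict_iff' measurableSet_Ioi).2 (Eventually.of_forall fun t ht => ?_)
      have ht0 : (0 : ℝ) < t := lt_trans one_pos ht
      rw [norm_mul, Complex.norm_cpow_eq_rpow_re_of_pos ht0]
      have : (-(s + 1)).re = -(s.re + 1) := by simp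
      rw [this]
      exact mul_le_mul_of_nonneg_right (hB t ht0.le) (by positivity)
  have h3 : charMean χ / (s - 1) = ∫ t in Set.Ioi (1 : ℝ), charMean χ * (t : ℂ) ^ (-s) := by
    rw [integral_const_mul, integral_Ioi_cpow_of_lt (by simpa using hs) one_pos]
    simp only [Complex.ofReal_one, Complex.one_cpow]
    rw [div_eq_mul_inv, ← neg_div_neg_eq, neg_neg, neg_add, neg_neg, one_div,
      show s + -1 = s - 1 by ring]
  rw [h3, regularPart, ← integral_add hI1 hI2]
  refine setIntegral_congr_fun measurableSet_Ioi fun t ht => ?_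
  have ht0 : (t : ℂ) ≠ 0 := by
    exact_mod_cast (lt_trans one_pos (Set.mem_Ioi.1 ht)).ne'
  have : (t : ℂ) ^ (-s) = t * (t : ℂ) ^ (-(s + 1)) := by
    rw [show -s = 1 + -(s + 1) by ring, Complex.cpow_add _ _ ht0, Complex.cpow_one]
  rw [this]
  ring

theorem LFunction_eq_of_im_pos {q : ℕ} [NeZero q] (χ : DirichletCharacter ℂ q)
    {s : ℂ} (hs : 0 < s.re) (hs' : 0 < s.im) :
    DirichletCharacter.LFunction χ s = s * charMean χ / (s - 1) + s * regularPart χ s := by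
  set U : Set ℂ := {z | 0 < z.re} ∩ {z | 0 < z.im} with hU
  have hUo : IsOpen U :=
    (isOpen_lt continuous_const Complex.continuous_re).inter
      (isOpen_lt continuous_const Complex.continuous_im)
  have hUc : IsPreconnected U :=
    ((convex_halfSpace_re_gt 0).inter (convex_halfSpace_im_gt 0)).isPreconnected
  have hne : ∀ z ∈ U, z - 1 ≠ 0 := fun z hz h => by
    have h1 : z = 1 := by linear_combination h
    have := hz.2
    simp [h1] at this
  have h1 : AnalyticOnNhd ℂ (DirichletCharacter.LFunction χ) U :=
    DifferentiableOn.analyticOnNhd (fun z hz =>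
      (DirichletCharacter.differentiableAt_LFunction χ z
        (Or.inl (sub_ne_zero.1 (hne z hz)))).differentiableWithinAt) hUo
  have h2 : AnalyticOnNhd ℂ (fun s => s * charMean χ / (s - 1) + s * regularPart χ s) U := by
    refine DifferentiableOn.analyticOnNhd (fun z hz => ?_) hUo
    have := differentiableAt_regularPart χ (s := z) hz.1
    have h4 : DifferentiableAt ℂ (fun s : ℂ => s) z := differentiableAt_id
    exact (((h4.mul_const _).div (h4.sub_const 1) (hne z hz)).add
      (h4.mul this)).differentiableWithinAt
  have h3 : (2 + I : ℂ) ∈ U := by simp [hU]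
  refine h1.eqOn_of_preconnected_of_eventuallyEq h2 hUc h3 ?_ ⟨hs, hs'⟩
  have : ∀ᶠ z : ℂ in nhds (2 + I), 1 < z.re :=
    (isOpen_lt continuous_const Complex.continuous_re).mem_nhds (by simp)
  filter_upwards [this] with z hz
  exact LFunction_eq_of_one_lt_re χ hz

theorem exists_norm_LFunction_le {q : ℕ} [NeZero q] (χ : DirichletCharacter ℂ q) :
    ∃ A : ℝ, 0 < A ∧ ∀ s : ℂ, 1 / 20 ≤ s.re → s.re ≤ 4 → 1 ≤ s.im →
      ‖DirichletCharacter.LFunction χ s‖ ≤ A * s.im := by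
  obtain ⟨B, hB0, hB⟩ := exists_norm_sum_sub_charMean_le χ
  refine ⟨5 * ‖charMean χ‖ + 100 * B, by positivity, fun s h1 h2 h3 => ?_⟩
  rw [LFunction_eq_of_im_pos χ (by linarith) (by linarith)]
  have hs : ‖s‖ ≤ 5 * s.im := by
    refine (Complex.norm_le_abs_re_add_abs_im s).trans ?_
    rw [abs_of_nonneg (by linarith), abs_of_nonneg (by linarith)]
    linarith
  have hs1 : 1 ≤ ‖s - 1‖ := by
    refine le_trans ?_ (Complex.abs_im_le_norm _)
    simp only [Complex.sub_im, Complex.one_im, sub_zero]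
    exact h3.trans (le_abs_self _)
  have hM : ‖regularPart χ s‖ ≤ 20 * B := by
    refine (norm_regularPart_le χ hB (by linarith)).trans ?_
    rw [div_le_iff₀ (by linarith)]
    nlinarith
  refine (norm_add_le _ _).trans ?_
  rw [norm_div, norm_mul, norm_mul]
  have e1 : ‖s‖ * ‖charMean χ‖ / ‖s - 1‖ ≤ 5 * s.im * ‖charMean χ‖ := by
    rw [div_le_iff₀ (by linarith)]
    have := mul_le_mul_of_nonneg_right hs (norm_nonneg (charMean χ))
    have h4 : 0 ≤ 5 * s.im * ‖charMean χ‖ := by positivity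
    nlinarith
  have e2 : ‖s‖ * ‖regularPart χ s‖ ≤ 5 * s.im * (20 * B) := by gcongr
  linarith

theorem norm_sub_eq_of_norm_eq {R : ℝ} (hR : 0 < R) {z : ℂ} (hz : ‖z‖ = R) (ρ : ℂ) :
    ‖((R : ℂ) ^ 2 - starRingEnd ℂ ρ * z) / R‖ = ‖z - ρ‖ := by
  have h1 : (R : ℂ) ^ 2 = z * starRingEnd ℂ z := by
    rw [Complex.mul_conj, Complex.normSq_eq_norm_sq, hz]; push_cast; ring
  have h2 : (R : ℂ) ^ 2 - starRingEnd ℂ ρ * z = z * starRingEnd ℂ (z - ρ) := by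
    rw [h1, map_sub]; ring
  rw [h2, norm_div, norm_mul, RCLike.norm_conj, hz, Complex.norm_real, Real.norm_eq_abs,
    abs_of_pos hR]
  field_simp

theorem norm_multiset_prod_eq {R : ℝ} (hR : 0 < R) {z : ℂ} (hz : ‖z‖ = R) (Z : Multiset ℂ) :
    ‖(Z.map fun ρ => ((R : ℂ) ^ 2 - starRingEnd ℂ ρ * z) / R).prod‖
      = ‖(Z.map fun ρ => z - ρ).prod‖ := by
  induction Z using Multiset.induction with
  | empty => simp
  | cons a s ih =>
    simp only [Multiset.map_cons, Multiset.prod_cons, norm_mul, ih,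
      norm_sub_eq_of_norm_eq hR hz]

theorem le_norm_multiset_prod {R R₁ : ℝ} (h1 : R₁ < R) (hR : 0 < R) {z : ℂ}
    (hz : ‖z‖ ≤ R) (Z : Multiset ℂ) (hZ : ∀ ρ ∈ Z, ‖ρ‖ ≤ R₁) :
    (R - R₁) ^ Z.card ≤
      ‖(Z.map fun ρ => ((R : ℂ) ^ 2 - starRingEnd ℂ ρ * z) / R).prod‖ := by
  induction Z using Multiset.induction with
  | empty => simp
  | cons a s ih =>
    simp only [Multiset.map_cons, Multiset.prod_cons, norm_mul, Multiset.card_cons,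
      pow_succ' (R - R₁)]
    have h2 := ih fun ρ hρ => hZ ρ (Multiset.mem_cons_of_mem hρ)
    have h3 : R - R₁ ≤ ‖((R : ℂ) ^ 2 - starRingEnd ℂ a * z) / R‖ := by
      rw [norm_div, Complex.norm_real, Real.norm_eq_abs, abs_of_pos hR, le_div_iff₀ hR]
      have h4 := norm_sub_norm_le ((R : ℂ) ^ 2) (starRingEnd ℂ a * z)
      rw [norm_mul, RCLike.norm_conj, norm_pow, Complex.norm_real, Real.norm_eq_abs,
        abs_of_pos hR] at h4
      have h5 : ‖a‖ * ‖z‖ ≤ R₁ * R := by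
        have := hZ a (Multiset.mem_cons_self a s)
        have := norm_nonneg a
        have := norm_nonneg z
        gcongr
        linarith
      nlinarith
    exact mul_le_mul h3 h2 (by apply pow_nonneg; linarith) (norm_nonneg _)

theorem norm_multiset_prod_le {R₁ : ℝ} (Z : Multiset ℂ) (hZ : ∀ ρ ∈ Z, ‖ρ‖ ≤ R₁) :
    ‖(Z.map fun ρ => (0 : ℂ) - ρ).prod‖ ≤ R₁ ^ Z.card := by
  induction Z using Multiset.induction with
  | empty => simp
  | cons a s ih =>
    simp only [Multiset.map_cons, Multiset.prod_cons, norm_mul, Multiset.card_cons, pow_succ']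
    have h1 := hZ a (Multiset.mem_cons_self a s)
    have h2 := ih fun ρ hρ => hZ ρ (Multiset.mem_cons_of_mem hρ)
    have h3 : ‖(0 : ℂ) - a‖ ≤ R₁ := by simpa using h1
    exact mul_le_mul h3 h2 (norm_nonneg _) ((norm_nonneg _).trans h3)

/-- `f` factors on the ball of radius `R'` as a product over the points of `Z` times `g`. -/
structure IsFactorization (f : ℂ → ℂ) (R' R₁ : ℝ) (Z : Multiset ℂ) (g : ℂ → ℂ) : Prop where
  norm_le : ∀ ρ ∈ Z, ‖ρ‖ ≤ R₁
  diff : DifferentiableOn ℂ g (Metric.ball 0 R')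
  eq : ∀ z ∈ Metric.ball (0 : ℂ) R', f z = (Z.map fun ρ => z - ρ).prod * g z

namespace IsFactorization

variable {f g : ℂ → ℂ} {R' R R₁ M : ℝ} {Z : Multiset ℂ}

theorem norm_mul_le (h : IsFactorization f R' R₁ Z g) (hR : 0 < R) (hR' : R < R')
    (hM : ∀ z, ‖z‖ ≤ R → ‖f z‖ ≤ M * ‖f 0‖) {z : ℂ} (hz : ‖z‖ ≤ R) :
    ‖g z‖ * ‖(Z.map fun ρ => ((R : ℂ) ^ 2 - starRingEnd ℂ ρ * z) / R).prod‖ ≤ M * ‖f 0‖ := by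
  set G : ℂ → ℂ := fun z =>
    g z * (Z.map fun ρ => ((R : ℂ) ^ 2 - starRingEnd ℂ ρ * z) / R).prod with hG
  have hP : Differentiable ℂ fun z : ℂ =>
      (Z.map fun ρ => ((R : ℂ) ^ 2 - starRingEnd ℂ ρ * z) / R).prod := by
    clear hG G h
    induction Z using Multiset.induction with
    | empty => simp
    | cons a s ih =>
      simp only [Multiset.map_cons, Multiset.prod_cons]
      exact (((differentiable_const _).sub (differentiable_id.const_mul _)).div_const _).mul ih
  have hGd : DiffContOnCl ℂ G (Metric.ball 0 R) := by
    apply DifferentiableOn.diffContOnCl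
    rw [closure_ball _ hR.ne']
    refine DifferentiableOn.mul (h.diff.mono fun w hw => ?_) hP.differentiableOn
    exact Metric.closedBall_subset_ball hR' hw
  have := Complex.norm_le_of_forall_mem_frontier_norm_le (C := M * ‖f 0‖) (z := z)
    Metric.isBounded_ball hGd ?_ ?_
  · simpa [hG] using this
  · intro w hw
    rw [frontier_ball _ hR.ne', mem_sphere_zero_iff_norm] at hw
    refine le_trans (le_of_eq ?_) (hM w hw.le)
    rw [h.eq w (by simpa [hw] using hR'), hG]
    simp only [norm_mul]
    rw [norm_multiset_prod_eq hR hw, mul_comm]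
  · rw [closure_ball _ hR.ne']; simpa using hz

theorem norm_le_pow_mul (h : IsFactorization f R' R₁ Z g) (hR' : 0 < R') :
    ‖f 0‖ ≤ R₁ ^ Z.card * ‖g 0‖ := by
  rw [h.eq 0 (by simpa using hR'), norm_mul]
  gcongr
  exact norm_multiset_prod_le Z h.norm_le

theorem pow_card_le (h : IsFactorization f R' R₁ Z g) (hR₁ : 0 < R₁) (hR : R₁ < R) (hR' : R < R')
    (hf : f 0 ≠ 0) (hM0 : 0 ≤ M) (hM : ∀ z, ‖z‖ ≤ R → ‖f z‖ ≤ M * ‖f 0‖) :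
    (R / R₁) ^ Z.card ≤ M := by
  have hR0 : 0 < R := hR₁.trans hR
  have h1 := h.norm_mul_le hR0 hR' hM (z := 0) (by simpa using hR0.le)
  have h2 := h.norm_le_pow_mul (by linarith)
  have h3 : ‖(Z.map fun ρ => ((R : ℂ) ^ 2 - starRingEnd ℂ ρ * 0) / R).prod‖ = R ^ Z.card := by
    have : ((R : ℂ) ^ 2) / R = R := by
      have : (R : ℂ) ≠ 0 := by exact_mod_cast hR0.ne'
      field_simp
    simp [this, abs_of_pos hR0]
  rw [h3] at h1
  have hg : 0 < ‖g 0‖ := by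
    rw [norm_pos_iff]; intro h0
    rw [h0] at h2; simp at h2; exact hf h2
  have h4 : ‖g 0‖ * R ^ Z.card ≤ ‖g 0‖ * (M * R₁ ^ Z.card) := by
    calc _ ≤ M * ‖f 0‖ := h1
      _ ≤ M * (R₁ ^ Z.card * ‖g 0‖) := by gcongr
      _ = _ := by ring
  rw [div_pow, div_le_iff₀ (by positivity)]
  exact le_of_mul_le_mul_left h4 hg

theorem norm_le_mul (h : IsFactorization f R' R₁ Z g) (hR₁ : 0 < R₁) (hR : R₁ < R) (hR' : R < R')
    (hM0 : 0 ≤ M) (hM : ∀ z, ‖z‖ ≤ R → ‖f z‖ ≤ M * ‖f 0‖) {z : ℂ} (hz : ‖z‖ ≤ R) :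
    ‖g z‖ ≤ M * (R₁ / (R - R₁)) ^ Z.card * ‖g 0‖ := by
  have hR0 : 0 < R := hR₁.trans hR
  have h1 := h.norm_mul_le hR0 hR' hM hz
  have h2 := h.norm_le_pow_mul (by linarith)
  have h3 := le_norm_multiset_prod hR hR0 hz Z h.norm_le
  have h4 : 0 < (R - R₁) ^ Z.card := pow_pos (by linarith) _
  have h5 : ‖g z‖ * (R - R₁) ^ Z.card ≤ M * (R₁ ^ Z.card * ‖g 0‖) := by
    calc _ ≤ ‖g z‖ * _ := mul_le_mul_of_nonneg_left h3 (norm_nonneg _)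
      _ ≤ M * ‖f 0‖ := h1
      _ ≤ _ := by gcongr
  rw [div_pow]
  have : ‖g z‖ ≤ M * (R₁ ^ Z.card * ‖g 0‖) / (R - R₁) ^ Z.card := by
    rwa [le_div_iff₀ h4]
  refine this.trans (le_of_eq ?_)
  ring

theorem exists_cons (h : IsFactorization f R' R₁ Z g) (hR : R₁ < R') {ρ : ℂ} (hρ : ‖ρ‖ ≤ R₁)
    (h0 : g ρ = 0) : ∃ g', IsFactorization f R' R₁ (ρ ::ₘ Z) g' := by
  refine ⟨dslope g ρ, ⟨fun w hw => ?_, ?_, fun z hz => ?_⟩⟩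
  · rcases Multiset.mem_cons.1 hw with rfl | hw
    · exact hρ
    · exact h.norm_le w hw
  · refine (Complex.differentiableOn_dslope ?_).2 h.diff
    exact Metric.isOpen_ball.mem_nhds (by simpa using hρ.trans_lt hR)
  · rw [h.eq z hz]
    have h1 := sub_smul_dslope g ρ z
    rw [h0, sub_zero, smul_eq_mul] at h1
    simp only [Multiset.map_cons, Multiset.prod_cons]
    rw [← h1]; ring

end IsFactorization

theorem exists_isFactorization_ne_zero {f : ℂ → ℂ} {R' R R₁ M : ℝ} (hR₁ : 0 < R₁) (hR : R₁ < R)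
    (hR' : R < R') (hfd : DifferentiableOn ℂ f (Metric.ball 0 R')) (hf : f 0 ≠ 0)
    (hM0 : 0 ≤ M) (hM : ∀ z, ‖z‖ ≤ R → ‖f z‖ ≤ M * ‖f 0‖) :
    ∃ Z g, IsFactorization f R' R₁ Z g ∧ ∀ z, ‖z‖ ≤ R₁ → g z ≠ 0 := by
  have h1 : 1 < R / R₁ := (one_lt_div hR₁).2 hR
  obtain ⟨N, hN⟩ := pow_unbounded_of_one_lt M h1
  set P : ℕ → Prop := fun n => ∃ Z g, IsFactorization f R' R₁ Z g ∧ Z.card = n with hP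
  have hbd : ∀ n, P n → n ≤ N := by
    rintro n ⟨Z, g, h, rfl⟩
    by_contra hlt
    push Not at hlt
    have h2 := h.pow_card_le hR₁ hR hR' hf hM0 hM
    have h3 : (R / R₁) ^ N ≤ (R / R₁) ^ Z.card := pow_le_pow_right₀ h1.le hlt.le
    linarith
  have h0 : P 0 := ⟨0, f, ⟨by simp, hfd, by simp⟩, rfl⟩
  obtain ⟨Z, g, h, hcard⟩ := Nat.findGreatest_spec (P := P) (Nat.zero_le N) h0
  refine ⟨Z, g, h, fun z hz hgz => ?_⟩
  obtain ⟨g', h'⟩ := h.exists_cons (by linarith) hz hgz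
  have h4 : P (Z.card + 1) := ⟨z ::ₘ Z, g', h', by simp⟩
  have := Nat.le_findGreatest (hbd _ h4) h4
  omega

theorem exists_exp_eq_of_ne_zero {g : ℂ → ℂ} {c : ℂ} {r : ℝ} (hr : 0 < r)
    (hg : DifferentiableOn ℂ g (Metric.ball c r)) (h0 : ∀ z ∈ Metric.ball c r, g z ≠ 0) :
    ∃ h : ℂ → ℂ, DifferentiableOn ℂ h (Metric.ball c r) ∧
      ∀ z ∈ Metric.ball c r, g z = Complex.exp (h z) := by
  have hd : DifferentiableOn ℂ (fun z => deriv g z / g z) (Metric.ball c r) :=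
    (hg.deriv Metric.isOpen_ball).div hg h0
  have hc : c ∈ Metric.ball c r := Metric.mem_ball_self hr
  obtain ⟨h, hh0, hh⟩ := hd.isExactOn_ball.with_val_at c (Complex.log (g c))
  refine ⟨h, fun z hz => (hh z hz).differentiableAt.differentiableWithinAt, fun z hz => ?_⟩
  have hderiv : ∀ w ∈ Metric.ball c r,
      HasDerivAt (fun w => g w * Complex.exp (-h w)) 0 w := fun w hw => by
    have h1 : HasDerivAt g (deriv g w) w :=
      (hg.differentiableAt (Metric.isOpen_ball.mem_nhds hw)).hasDerivAt
    have h2 := h1.mul ((hh w hw).neg.cexp)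
    have h3 : deriv g w = g w * (deriv g w / g w) := by
      have := h0 w hw
      field_simp
    refine h2.congr_deriv ?_
    linear_combination Complex.exp (-h w) * h3
  have hconst := Metric.isOpen_ball.is_const_of_deriv_eq_zero
    (convex_ball c r).isPreconnected
    (fun w hw => (hderiv w hw).differentiableAt.differentiableWithinAt)
    (fun w hw => (hderiv w hw).deriv) hz hc
  simp only [hh0, Complex.exp_neg, Complex.exp_log (h0 c hc)] at hconst
  rw [mul_inv_cancel₀ (h0 c hc)] at hconst
  have := Complex.exp_ne_zero (h z)
  field_simp at hconst
  exact hconst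

theorem exists_local_factorization {R' R R₁ R₂ R₃ : ℝ} (hR₃ : 0 < R₃) (hR₂ : R₃ < R₂)
    (hR₁ : R₂ < R₁) (hR : R₁ < R) (hR' : R < R') :
    ∃ C : ℝ, 0 < C ∧ ∀ (f : ℂ → ℂ) (M : ℝ), Real.exp 1 ≤ M →
      DifferentiableOn ℂ f (Metric.ball 0 R') → f 0 ≠ 0 →
      (∀ z, ‖z‖ ≤ R → ‖f z‖ ≤ M * ‖f 0‖) →
      ∃ (Z : Multiset ℂ) (h : ℂ → ℂ), (∀ ρ ∈ Z, ‖ρ‖ ≤ R₁ ∧ f ρ = 0) ∧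
        (Z.card : ℝ) ≤ C * Real.log M ∧ DifferentiableOn ℂ h (Metric.ball 0 R₁) ∧
        (∀ z, ‖z‖ < R₁ → f z = (Z.map fun ρ => z - ρ).prod * Complex.exp (h z)) ∧
        (∀ z, ‖z‖ ≤ R₂ → ‖deriv h z‖ ≤ C * Real.log M) ∧
        (∀ z w, ‖z‖ ≤ R₃ → ‖w‖ ≤ R₃ →
          ‖deriv h z - deriv h w‖ ≤ C * Real.log M * ‖z - w‖) := by
  have hR₁0 : 0 < R₁ := by linarith
  have hlog : 0 < Real.log (R / R₁) := Real.log_pos ((one_lt_div hR₁0).2 hR)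
  set c₁ : ℝ := 1 / Real.log (R / R₁) with hc₁
  set B : ℝ := 1 + c₁ * |Real.log (R₁ / (R - R₁))| with hB
  have hc₁0 : 0 < c₁ := by positivity
  have hB0 : 0 < B := by positivity
  set S : ℝ := (R₁ + R₂) / 2 with hS
  set D : ℝ := 2 * B * S / (R₁ - S) with hD
  have hS1 : S < R₁ := by rw [hS]; linarith
  have hS2 : R₂ < S := by rw [hS]; linarith
  have hD0 : 0 < D := by
    have : 0 < R₁ - S := by linarith
    have : 0 < S := by linarith
    positivity
  set D₁ : ℝ := D / (S - R₂) with hD₁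
  have hD₁0 : 0 < D₁ := div_pos hD0 (by linarith)
  set D₂ : ℝ := D₁ / (R₂ - R₃) with hD₂
  have hD₂0 : 0 < D₂ := div_pos hD₁0 (by linarith)
  refine ⟨c₁ + D₁ + D₂, by positivity, fun f M hM1 hfd hf hM => ?_⟩
  have hM0 : 0 < M := (Real.exp_pos 1).trans_le hM1
  have hlM : 1 ≤ Real.log M := by
    rw [Real.le_log_iff_exp_le hM0]; exact hM1
  obtain ⟨Z, g, hfac, hg⟩ := exists_isFactorization_ne_zero hR₁0 hR hR' hfd hf hM0.le hM
  have hcard : (Z.card : ℝ) ≤ c₁ * Real.log M := by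
    have h1 := hfac.pow_card_le hR₁0 hR hR' hf hM0.le hM
    have hpos : 0 < R / R₁ := div_pos (by linarith) hR₁0
    have h2 := Real.log_le_log (pow_pos hpos _) h1
    rw [Real.log_pow] at h2
    rw [hc₁, one_div, inv_mul_eq_div, le_div_iff₀ hlog]
    exact h2
  have hsub : Metric.ball (0 : ℂ) R₁ ⊆ Metric.ball 0 R' :=
    Metric.ball_subset_ball (by linarith)
  obtain ⟨h, hhd, hh⟩ := exists_exp_eq_of_ne_zero hR₁0 (hfac.diff.mono hsub)
    (fun z hz => hg z (by simpa using (mem_ball_zero_iff.1 hz).le))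
  have hre : ∀ z ∈ Metric.ball (0 : ℂ) R₁, (h z - h 0).re ≤ B * Real.log M := by
    intro z hz
    have h1 := hfac.norm_le_mul hR₁0 hR hR' hM0.le hM (z := z)
      ((mem_ball_zero_iff.1 hz).le.trans hR.le)
    rw [hh z hz, hh 0 (Metric.mem_ball_self hR₁0), Complex.norm_exp, Complex.norm_exp] at h1
    have hpos : 0 < R₁ / (R - R₁) := div_pos hR₁0 (by linarith)
    have h2 := Real.log_le_log (Real.exp_pos _) h1
    rw [Real.log_exp, Real.log_mul (by positivity) (by positivity),
      Real.log_mul (by positivity) (by positivity), Real.log_exp, Real.log_pow] at h2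
    have h3 : (Z.card : ℝ) * Real.log (R₁ / (R - R₁))
        ≤ c₁ * Real.log M * |Real.log (R₁ / (R - R₁))| :=
      (mul_le_mul_of_nonneg_left (le_abs_self _) (Nat.cast_nonneg _)).trans
        (mul_le_mul_of_nonneg_right hcard (abs_nonneg _))
    rw [Complex.sub_re, hB]
    nlinarith
  have hbc : ∀ z, ‖z‖ ≤ S → ‖h z - h 0‖ ≤ D * Real.log M := by
    intro z hz
    have h1 := Complex.borelCaratheodory_zero (f := fun z => h z - h 0) (R := R₁)
      (M := B * Real.log M) (z := z) (by positivity) (hhd.sub_const _) hre hR₁0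
      (by simpa using hz.trans_lt hS1) (by simp)
    refine h1.trans ?_
    have : D * Real.log M = 2 * (B * Real.log M) * S / (R₁ - S) := by rw [hD]; ring
    rw [this]
    have : 0 < R₁ - S := by linarith
    have : 0 < S := by linarith
    gcongr
  have hd1 : ∀ z, ‖z‖ ≤ R₂ → ‖deriv h z‖ ≤ D₁ * Real.log M := by
    intro z hz
    have hball : Metric.closedBall z (S - R₂) ⊆ Metric.closedBall 0 S := by
      refine Metric.closedBall_subset_closedBall' ?_
      rw [dist_zero_right]; linarith
    have h1 := Complex.norm_deriv_le_of_forall_mem_sphere_norm_le (f := fun z => h z - h 0)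
      (c := z) (R := S - R₂) (C := D * Real.log M) (by linarith) ?_ ?_
    · rw [deriv_sub_const] at h1
      refine h1.trans (le_of_eq ?_)
      rw [hD₁]; ring
    · apply DifferentiableOn.diffContOnCl
      rw [closure_ball _ (by linarith)]
      refine (hhd.sub_const _).mono (hball.trans (Metric.closedBall_subset_ball hS1))
    · intro w hw
      exact hbc w (by simpa using hball (Metric.sphere_subset_closedBall hw))
  have hd2 : ∀ z, ‖z‖ ≤ R₃ → ‖deriv (deriv h) z‖ ≤ D₂ * Real.log M := by
    intro z hz
    have hball : Metric.closedBall z (R₂ - R₃) ⊆ Metric.closedBall 0 R₂ := by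
      refine Metric.closedBall_subset_closedBall' ?_
      rw [dist_zero_right]; linarith
    have h1 := Complex.norm_deriv_le_of_forall_mem_sphere_norm_le (f := deriv h)
      (c := z) (R := R₂ - R₃) (C := D₁ * Real.log M) (by linarith) ?_ ?_
    · refine h1.trans (le_of_eq ?_)
      rw [hD₂]; ring
    · apply DifferentiableOn.diffContOnCl
      rw [closure_ball _ (by linarith)]
      exact (hhd.deriv Metric.isOpen_ball).mono
        (hball.trans (Metric.closedBall_subset_ball hR₁))
    · intro w hw
      exact hd1 w (by simpa using hball (Metric.sphere_subset_closedBall hw))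
  refine ⟨Z, h, fun ρ hρ => ⟨hfac.norm_le ρ hρ, ?_⟩, ?_, hhd, fun z hz => ?_, fun z hz => ?_,
    fun z w hz hw => ?_⟩
  · have hρ1 := hfac.norm_le ρ hρ
    rw [hfac.eq ρ (by simpa using hρ1.trans_lt (hR.trans hR'))]
    have : (Z.map fun r => ρ - r).prod = 0 :=
      Multiset.prod_eq_zero (Multiset.mem_map.2 ⟨ρ, hρ, sub_self ρ⟩)
    rw [this, zero_mul]
  · refine hcard.trans ?_
    gcongr; linarith
  · rw [hfac.eq z (hsub (by simpa using hz)), hh z (by simpa using hz)]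
  · refine (hd1 z hz).trans ?_
    gcongr; linarith
  · have h1 := (convex_closedBall (0 : ℂ) R₃).norm_image_sub_le_of_norm_deriv_le
      (f := deriv h) (C := D₂ * Real.log M) (x := w) (y := z)
      (fun x hx => ((hhd.deriv Metric.isOpen_ball).differentiableAt
        (Metric.isOpen_ball.mem_nhds (by
          simpa using (mem_closedBall_zero_iff.1 hx).trans_lt (by linarith)))))
      (fun x hx => hd2 x (by simpa using hx)) (by simpa using hw) (by simpa using hz)
    refine h1.trans ?_
    gcongr; linarith

variable {q : ℕ} [NeZero q]

theorem one_third_le_norm_LFunction (χ : DirichletCharacter ℂ q) {s : ℂ} (hs : s.re = 2) :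
    1 / 3 ≤ ‖DirichletCharacter.LFunction χ s‖ := by
  have hs1 : 1 < s.re := by rw [hs]; norm_num
  rw [DirichletCharacter.LFunction_eq_LSeries χ hs1]
  have hsum := DirichletCharacter.LSeriesSummable_of_one_lt_re χ hs1
  have hz := hasSum_zeta_two
  have hle : ∀ n : ℕ, ‖LSeries.term (fun n => χ (n : ZMod q)) s n‖ ≤ 1 / (n : ℝ) ^ 2 := by
    intro n
    rw [LSeries.norm_term_eq, hs]
    split_ifs with h
    · positivity
    · rw [show (2 : ℝ) = ((2 : ℕ) : ℝ) by norm_num, Real.rpow_natCast]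
      gcongr
      exact DirichletCharacter.norm_le_one χ _
  have hz1 : HasSum (fun n : ℕ => 1 / (((n + 2 : ℕ) : ℝ)) ^ 2) (π ^ 2 / 6 - 1) := by
    have := (hasSum_nat_add_iff' 2).2 hz
    simpa [Finset.sum_range_succ] using this
  have h2 : LSeries (fun n => χ (n : ZMod q)) s
      = 1 + ∑' n : ℕ, LSeries.term (fun n => χ (n : ZMod q)) s (n + 2) := by
    rw [LSeries, ← Summable.sum_add_tsum_nat_add 2 hsum]
    congr 1
    simp [Finset.sum_range_succ, LSeries.term]
  have h3 : ‖∑' n : ℕ, LSeries.term (fun n => χ (n : ZMod q)) s (n + 2)‖ ≤ π ^ 2 / 6 - 1 :=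
    tsum_of_norm_bounded hz1 fun n => hle (n + 2)
  have h4 : π ^ 2 / 6 - 1 ≤ 2 / 3 := by
    have := Real.pi_lt_d2
    have := Real.pi_pos
    nlinarith
  rw [h2]
  have := norm_sub_le_norm_add (1 : ℂ) (∑' n : ℕ, LSeries.term (fun n => χ (n : ZMod q)) s (n + 2))
  rw [norm_one] at this
  linarith

theorem exists_LFunction_local_factorization (hGRH : GRHmod q) (χ : DirichletCharacter ℂ q) :
    ∃ C : ℝ, 0 < C ∧ ∀ t : ℝ, 3 ≤ t → ∃ (Z : Multiset ℂ) (h : ℂ → ℂ),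
      (∀ ρ ∈ Z, ρ.re = 1 / 2) ∧ (Z.card : ℝ) ≤ C * Real.log t ∧
      DifferentiableOn ℂ h (Metric.ball (2 + t * I) 1.8) ∧
      (∀ s ∈ Metric.ball (2 + t * I : ℂ) 1.8, DirichletCharacter.LFunction χ s
        = (Z.map fun ρ => s - ρ).prod * Complex.exp (h s)) ∧
      (∀ s ∈ Metric.closedBall (2 + t * I : ℂ) 1.7, ‖deriv h s‖ ≤ C * Real.log t) ∧
      (∀ s ∈ Metric.closedBall (2 + t * I : ℂ) 1.6, ∀ w ∈ Metric.closedBall (2 + t * I : ℂ) 1.6,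
          ‖deriv h s - deriv h w‖ ≤ C * Real.log t * ‖s - w‖) := by
  obtain ⟨C, hC0, hC⟩ := exists_local_factorization (R' := 1.95) (R := 1.9) (R₁ := 1.8)
    (R₂ := 1.7) (R₃ := 1.6) (by norm_num) (by norm_num) (by norm_num) (by norm_num) (by norm_num)
  obtain ⟨A, hA0, hA⟩ := exists_norm_LFunction_le χ
  set K : ℝ := max (6 * A) (Real.exp 1) with hK
  have hK1 : Real.exp 1 ≤ K := le_max_right _ _
  have hK0 : 0 < K := (Real.exp_pos 1).trans_le hK1
  have hlK : 1 ≤ Real.log K := by rw [Real.le_log_iff_exp_le hK0]; exact hK1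
  set C' : ℝ := C * (Real.log K + 1) with hC'
  have hC'0 : 0 < C' := by positivity
  refine ⟨C', hC'0, fun t ht => ?_⟩
  set c : ℂ := 2 + t * I with hc
  have hcre : c.re = 2 := by simp [hc]
  have hcim : c.im = t := by simp [hc]
  have hlt : 1 ≤ Real.log t := by
    rw [Real.le_log_iff_exp_le (by linarith)]
    have := Real.exp_one_lt_d9
    linarith
  have hlog : C * Real.log (K * t) ≤ C' * Real.log t := by
    rw [Real.log_mul hK0.ne' (by linarith), hC', mul_assoc]
    gcongr
    nlinarith
  have hreim : ∀ z : ℂ, ∀ r : ℝ, ‖z‖ ≤ r →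
      2 - r ≤ (c + z).re ∧ (c + z).re ≤ 2 + r ∧ t - r ≤ (c + z).im ∧ (c + z).im ≤ t + r := by
    intro z r hz
    have h1 := abs_le.1 ((Complex.abs_re_le_norm z).trans hz)
    have h2 := abs_le.1 ((Complex.abs_im_le_norm z).trans hz)
    rw [Complex.add_re, Complex.add_im, hcre, hcim]
    refine ⟨by linarith, by linarith, by linarith, by linarith⟩
  have hmain := hC (fun z => DirichletCharacter.LFunction χ (c + z)) (K * t) ?_ ?_ ?_ ?_
  · obtain ⟨Z, h, hZ, hcard, hhd, hh, hd1, hd2⟩ := hmain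
    have hderiv : ∀ s, deriv (fun s => h (s - c)) s = deriv h (s - c) := fun s =>
      deriv_comp_sub_const (f := h) (a := c) (x := s)
    refine ⟨Z.map fun z => c + z, fun s => h (s - c), ?_, ?_, ?_, ?_, ?_, ?_⟩
    · intro ρ hρ
      obtain ⟨z, hz, rfl⟩ := Multiset.mem_map.1 hρ
      obtain ⟨hz1, hz2⟩ := hZ z hz
      obtain ⟨h1, h2, h3, h4⟩ := hreim z _ hz1
      refine hGRH χ _ hz2 (by norm_num at h1 ⊢; linarith) ?_
      by_contra hge
      push Not at hge
      refine DirichletCharacter.LFunction_ne_zero_of_one_le_re χ (Or.inr ?_) hge hz2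
      intro h5
      rw [h5] at h3
      norm_num at h3
      linarith
    · rw [Multiset.card_map]; exact hcard.trans hlog
    · refine hhd.comp ((differentiable_id.sub_const c).differentiableOn) fun s hs => ?_
      simpa [dist_eq_norm] using hs
    · intro s hs
      have := hh (s - c) (by simpa [dist_eq_norm] using hs)
      simp only [add_sub_cancel, Multiset.map_map, Function.comp_def] at this ⊢
      rw [this]
      congr 3
      funext z
      ring
    · intro s hs
      rw [hderiv]
      exact (hd1 _ (by simpa [dist_eq_norm] using hs)).trans hlog
    · intro s hs w hw
      rw [hderiv, hderiv]
      refine (hd2 _ _ (by simpa [dist_eq_norm] using hs)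
        (by simpa [dist_eq_norm] using hw)).trans ?_
      rw [sub_sub_sub_cancel_right]
      gcongr
  · exact hK1.trans (le_mul_of_one_le_right hK0.le (by linarith))
  · intro z hz
    obtain ⟨h1, h2, h3, h4⟩ := hreim z _ (mem_ball_zero_iff.1 hz).le
    refine DifferentiableAt.differentiableWithinAt ?_
    have h6 : DifferentiableAt ℂ (DirichletCharacter.LFunction χ) (c + z) := by
      refine DirichletCharacter.differentiableAt_LFunction χ _ (Or.inl ?_)
      intro h5
      rw [h5] at h3
      norm_num at h3
      linarith
    exact h6.comp z (differentiableAt_id.const_add c)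
  · simp only [add_zero]
    intro h0
    have := one_third_le_norm_LFunction χ hcre
    rw [h0, norm_zero] at this
    norm_num at this
  · intro z hz
    obtain ⟨h1, h2, h3, h4⟩ := hreim z _ hz
    have h5 := hA (c + z) (by norm_num at h1 ⊢; linarith) (by norm_num at h2 ⊢; linarith)
      (by norm_num at h3 ⊢; linarith)
    have h6 := one_third_le_norm_LFunction χ hcre
    simp only [add_zero]
    have h7 : (c + z).im ≤ 2 * t := by refine h4.trans ?_; linarith
    have h8 : 6 * A ≤ K := le_max_left _ _
    calc _ ≤ A * (c + z).im := h5
      _ ≤ A * (2 * t) := by gcongr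
      _ = 6 * A * t * (1 / 3) := by ring
      _ ≤ K * t * ‖DirichletCharacter.LFunction χ c‖ := by gcongr

theorem hasDerivAt_multiset_prod_sub (Z : Multiset ℂ) {s : ℂ} (hs : ∀ ρ ∈ Z, s ≠ ρ) :
    HasDerivAt (fun s => (Z.map fun ρ => s - ρ).prod)
      ((Z.map fun ρ => s - ρ).prod * (Z.map fun ρ => 1 / (s - ρ)).sum) s := by
  induction Z using Multiset.induction with
  | empty => simpa using hasDerivAt_const s (1 : ℂ)
  | cons a Z ih =>
    have h1 := ih fun ρ hρ => hs ρ (Multiset.mem_cons_of_mem hρ)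
    have h2 : s - a ≠ 0 := sub_ne_zero.2 (hs a (Multiset.mem_cons_self a Z))
    simp only [Multiset.map_cons, Multiset.prod_cons, Multiset.sum_cons]
    refine (((hasDerivAt_id s).sub_const a).mul h1).congr_deriv ?_
    simp only [id_eq]
    field_simp

theorem logDeriv_eq_of_factorization {f h : ℂ → ℂ} {c : ℂ} {r : ℝ} {Z : Multiset ℂ}
    (hh : DifferentiableOn ℂ h (Metric.ball c r))
    (hf : ∀ s ∈ Metric.ball c r, f s = (Z.map fun ρ => s - ρ).prod * Complex.exp (h s))
    {s : ℂ} (hs : s ∈ Metric.ball c r) (hZ : ∀ ρ ∈ Z, s ≠ ρ) :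
    f s ≠ 0 ∧ logDeriv f s = (Z.map fun ρ => 1 / (s - ρ)).sum + deriv h s := by
  have hP : (Z.map fun ρ => s - ρ).prod ≠ 0 := by
    intro h0
    obtain ⟨ρ, hρ, h1⟩ := Multiset.mem_map.1 (Multiset.prod_eq_zero_iff.1 h0)
    exact hZ ρ hρ (sub_eq_zero.1 h1)
  have hne : f s ≠ 0 := by rw [hf s hs]; exact mul_ne_zero hP (Complex.exp_ne_zero _)
  have hnhds : Metric.ball c r ∈ nhds s := Metric.isOpen_ball.mem_nhds hs
  have h1 := (hasDerivAt_multiset_prod_sub Z hZ).mul (hh.differentiableAt hnhds).hasDerivAt.cexp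
  have h2 : f =ᶠ[nhds s] fun s => (Z.map fun ρ => s - ρ).prod * Complex.exp (h s) :=
    Filter.eventually_of_mem hnhds hf
  refine ⟨hne, ?_⟩
  rw [logDeriv_apply, (h1.congr_of_eventuallyEq h2).deriv, hf s hs]
  have := Complex.exp_ne_zero (h s)
  field_simp

theorem norm_one_div_sub_sub_le {s w ρ : ℂ} {r : ℝ} (hr : 0 < r) (hs : r = (s - ρ).re)
    (hw : 0 ≤ w.re) :
    ‖1 / (s + w - ρ) - 1 / (s - ρ)‖ ≤ r / ‖s - ρ‖ ^ 2 * (‖w‖ / r * (1 + ‖w‖ / r)) := by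
  have h1 : r ≤ ‖s - ρ‖ := hs ▸ (Complex.re_le_norm _)
  have h2 : r ≤ ‖s + w - ρ‖ := by
    refine le_trans ?_ (Complex.re_le_norm _)
    rw [hs]; simp; linarith
  have h3 : 0 < ‖s - ρ‖ := hr.trans_le h1
  have h4 : 0 < ‖s + w - ρ‖ := hr.trans_le h2
  have h5 : ‖s - ρ‖ ≤ ‖s + w - ρ‖ * (1 + ‖w‖ / r) := by
    have h6 : ‖s - ρ‖ ≤ ‖s + w - ρ‖ + ‖w‖ := by
      have := norm_sub_le (s + w - ρ) w
      rwa [show s + w - ρ - w = s - ρ by ring] at this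
    have h7 : ‖w‖ ≤ ‖s + w - ρ‖ * (‖w‖ / r) := by
      rw [mul_div_assoc', le_div_iff₀ hr, mul_comm]
      exact mul_le_mul_of_nonneg_right h2 (norm_nonneg w)
    linarith
  have h8 : 1 / (s + w - ρ) - 1 / (s - ρ) = -w / ((s + w - ρ) * (s - ρ)) := by
    have := norm_pos_iff.1 h3
    have := norm_pos_iff.1 h4
    field_simp
    ring
  rw [h8, norm_div, norm_neg, norm_mul, div_le_iff₀ (by positivity)]
  have h9 : r / ‖s - ρ‖ ^ 2 * (‖w‖ / r * (1 + ‖w‖ / r)) * (‖s + w - ρ‖ * ‖s - ρ‖)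
      = ‖w‖ * (‖s + w - ρ‖ * (1 + ‖w‖ / r) / ‖s - ρ‖) := by
    field_simp
  rw [h9]
  refine le_mul_of_one_le_right (norm_nonneg w) ?_
  rwa [one_le_div h3]

theorem norm_multiset_sum_sub_le {s w : ℂ} {r : ℝ} (hr : 0 < r) (Z : Multiset ℂ)
    (hZ : ∀ ρ ∈ Z, r = (s - ρ).re) (hw : 0 ≤ w.re) :
    ‖(Z.map fun ρ => 1 / (s + w - ρ)).sum - (Z.map fun ρ => 1 / (s - ρ)).sum‖
      ≤ (Z.map fun ρ => r / ‖s - ρ‖ ^ 2).sum * (‖w‖ / r * (1 + ‖w‖ / r)) := by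
  induction Z using Multiset.induction with
  | empty => simp
  | cons a Z ih =>
    have h1 := ih fun ρ hρ => hZ ρ (Multiset.mem_cons_of_mem hρ)
    have h2 := norm_one_div_sub_sub_le hr (hZ a (Multiset.mem_cons_self a Z)) hw
    simp only [Multiset.map_cons, Multiset.sum_cons]
    rw [add_sub_add_comm, add_mul]
    exact (norm_add_le _ _).trans (add_le_add h2 h1)

theorem norm_multiset_prod_le_exp {s : ℂ} {r : ℝ} (hr : 0 < r) (Z : Multiset ℂ)
    (hZ : ∀ ρ ∈ Z, r = (s - ρ).re) :
    ‖(Z.map fun ρ => s - r - ρ).prod‖ ≤ ‖(Z.map fun ρ => s - ρ).prod‖ *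
      Real.exp (-(r / 2 * (Z.map fun ρ => r / ‖s - ρ‖ ^ 2).sum)) := by
  induction Z using Multiset.induction with
  | empty => simp
  | cons a Z ih =>
    have h1 := ih fun ρ hρ => hZ ρ (Multiset.mem_cons_of_mem hρ)
    have ha := hZ a (Multiset.mem_cons_self a Z)
    simp only [Multiset.map_cons, Multiset.prod_cons, Multiset.sum_cons, norm_mul]
    rw [mul_add, neg_add, Real.exp_add, mul_mul_mul_comm]
    refine mul_le_mul ?_ h1 (norm_nonneg _) (by positivity)
    have h3 : 0 < ‖s - a‖ := hr.trans_le (ha ▸ Complex.re_le_norm _)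
    refine abs_le_of_sq_le_sq' ?_ (by positivity) |>.2
    have h4 : ‖s - r - a‖ ^ 2 = ‖s - a‖ ^ 2 - r ^ 2 := by
      rw [← Complex.normSq_eq_norm_sq, ← Complex.normSq_eq_norm_sq, Complex.normSq_apply,
        Complex.normSq_apply]
      simp only [Complex.sub_re, Complex.sub_im, Complex.ofReal_re, Complex.ofReal_im] at ha ⊢
      rw [ha]; ring
    rw [h4, mul_pow, ← Real.exp_nat_mul]
    have h5 := Real.add_one_le_exp (((2 : ℕ) : ℝ) * -(r / 2 * (r / ‖s - a‖ ^ 2)))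
    have h6 : ‖s - a‖ ^ 2 * (((2 : ℕ) : ℝ) * -(r / 2 * (r / ‖s - a‖ ^ 2)) + 1)
        = ‖s - a‖ ^ 2 - r ^ 2 := by
      push_cast
      field_simp
      ring
    rw [← h6]
    gcongr

theorem norm_multiset_sum_one_div_le {s : ℂ} {d : ℝ} (hd : 0 < d) (Z : Multiset ℂ)
    (hZ : ∀ ρ ∈ Z, d = (s - ρ).re) :
    ‖(Z.map fun ρ => 1 / (s - ρ)).sum‖ ≤ Z.card * (1 / d) := by
  induction Z using Multiset.induction with
  | empty => simp
  | cons a Z ih =>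
    have h1 := ih fun ρ hρ => hZ ρ (Multiset.mem_cons_of_mem hρ)
    have ha := hZ a (Multiset.mem_cons_self a Z)
    simp only [Multiset.map_cons, Multiset.sum_cons, Multiset.card_cons]
    push_cast
    rw [add_mul, one_mul, add_comm]
    refine (norm_add_le _ _).trans (add_le_add h1 ?_) |>.trans' (le_of_eq (by rw [add_comm]))
    rw [norm_div, norm_one]
    exact one_div_le_one_div_of_le hd (ha ▸ Complex.re_le_norm _)

theorem re_multiset_sum_one_div_nonneg {s : ℂ} (Z : Multiset ℂ)
    (hZ : ∀ ρ ∈ Z, 0 ≤ (s - ρ).re) :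
    0 ≤ ((Z.map fun ρ => 1 / (s - ρ)).sum).re := by
  induction Z using Multiset.induction with
  | empty => simp
  | cons a Z ih =>
    have h1 := ih fun ρ hρ => hZ ρ (Multiset.mem_cons_of_mem hρ)
    have ha := hZ a (Multiset.mem_cons_self a Z)
    simp only [Multiset.map_cons, Multiset.sum_cons, Complex.add_re]
    refine add_nonneg ?_ h1
    rw [one_div, Complex.inv_re]
    exact div_nonneg ha (Complex.normSq_nonneg _)

theorem exists_logDeriv_bounds {q : ℕ} [NeZero q] (hGRH : GRHmod q)
    (χ : DirichletCharacter ℂ q) :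
    ∃ C : ℝ, 0 < C ∧
      (∀ t r : ℝ, 3 ≤ t → 0 < r → r ≤ 1 / 4 → ∃ H : ℝ, 0 ≤ H ∧
        ‖DirichletCharacter.LFunction χ (1 / 2 + t * I)‖
          ≤ ‖DirichletCharacter.LFunction χ (1 / 2 + t * I + r)‖ *
            Real.exp (C * r * Real.log t - r / 2 * H) ∧
        -(C * Real.log t) ≤
          (logDeriv (DirichletCharacter.LFunction χ) (1 / 2 + t * I + r)).re ∧
        ∀ w : ℂ, 0 ≤ w.re → ‖w‖ ≤ 1 / 4 →
          ‖logDeriv (DirichletCharacter.LFunction χ) (1 / 2 + t * I + r + w)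
            - logDeriv (DirichletCharacter.LFunction χ) (1 / 2 + t * I + r)‖
          ≤ H * (‖w‖ / r * (1 + ‖w‖ / r)) + C * Real.log t * ‖w‖) ∧
      ∀ s : ℂ, 1 / 2 < s.re → s.re ≤ 2 → 3 ≤ s.im → DirichletCharacter.LFunction χ s ≠ 0 ∧
        ‖logDeriv (DirichletCharacter.LFunction χ) s‖
          ≤ C * Real.log s.im * (1 + 1 / (s.re - 1 / 2)) := by
  obtain ⟨C, hC0, hC⟩ := exists_LFunction_local_factorization hGRH χ
  refine ⟨C, hC0, fun t r ht hr0 hr => ?_, fun s hs1 hs2 hs3 => ?_⟩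
  · obtain ⟨Z, h, hZ, hcard, hhd, hh, hd1, hd2⟩ := hC t ht
    set s₁ : ℂ := 1 / 2 + t * I + r with hs₁
    have hlog : 0 ≤ Real.log t := Real.log_nonneg (by linarith)
    have hball : ∀ w : ℂ, w.re = 0 ∨ 0 ≤ w.re → ‖w‖ ≤ 1 / 2 →
        |w.im| ≤ 1 / 4 → w.re ≤ 1 / 2 →
        1 / 2 + t * I + w ∈ Metric.closedBall (2 + t * I : ℂ) 1.6 := by
      intro w hw hw1 hw2 hw3
      have hw0 : 0 ≤ w.re := hw.elim (fun h => h.ge) id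
      rw [mem_closedBall_iff_norm]
      have : ‖1 / 2 + t * I + w - (2 + t * I)‖ ^ 2 ≤ 1.6 ^ 2 := by
        rw [← Complex.normSq_eq_norm_sq, Complex.normSq_apply]
        simp
        have := abs_le.1 hw2
        norm_num
        nlinarith
      exact abs_le_of_sq_le_sq' this (by norm_num) |>.2
    have hrim : |((r : ℂ)).im| ≤ 1 / 4 := by simp
    have hZre : ∀ ρ ∈ Z, r = (s₁ - ρ).re := by
      intro ρ hρ
      simp [hs₁, hZ ρ hρ]
    have hsub17 : Metric.closedBall (2 + t * I : ℂ) 1.6 ⊆ Metric.closedBall (2 + t * I : ℂ) 1.7 :=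
      Metric.closedBall_subset_closedBall (by norm_num)
    have hsub18 : Metric.closedBall (2 + t * I : ℂ) 1.6 ⊆ Metric.ball (2 + t * I : ℂ) 1.8 :=
      Metric.closedBall_subset_ball (by norm_num)
    have hs0mem : (1 / 2 + t * I : ℂ) ∈ Metric.closedBall (2 + t * I : ℂ) 1.6 := by
      simpa using hball 0 (by simp) (by simp) (by simp) (by simp)
    have hsrmem : ∀ w : ℂ, 0 ≤ w.re → ‖w‖ ≤ 1 / 4 →
        s₁ + w ∈ Metric.closedBall (2 + t * I : ℂ) 1.6 := by
      intro w hw hw1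
      have h1 := hball (r + w) (Or.inr (by simp; linarith)) ?_ ?_ ?_
      · rwa [← add_assoc] at h1
      · refine (norm_add_le _ _).trans ?_
        rw [Complex.norm_real, Real.norm_eq_abs, abs_of_pos hr0]; linarith
      · simpa using (Complex.abs_im_le_norm w).trans hw1
      · have := (Complex.re_le_norm w).trans hw1
        simp; linarith
    have hs1mem : s₁ ∈ Metric.closedBall (2 + t * I : ℂ) 1.6 := by
      simpa using hsrmem 0 (by simp) (by simp)
    have hlogD : ∀ w : ℂ, 0 ≤ w.re → ‖w‖ ≤ 1 / 4 →
        logDeriv (DirichletCharacter.LFunction χ) (s₁ + w)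
          = (Z.map fun ρ => 1 / (s₁ + w - ρ)).sum + deriv h (s₁ + w) := by
      intro w hw hw1
      refine (logDeriv_eq_of_factorization hhd hh (hsub18 (hsrmem w hw hw1)) ?_).2
      intro ρ hρ h1
      have h2 := hZ ρ hρ
      have h3 := hZre ρ hρ
      rw [← h1] at h2 h3
      simp at h3
      linarith
    have hlogD0 := hlogD 0 (by simp) (by simp)
    rw [add_zero] at hlogD0
    have hHnn : 0 ≤ (Z.map fun ρ => r / ‖s₁ - ρ‖ ^ 2).sum :=
      Multiset.sum_nonneg fun x hx => by
        obtain ⟨ρ, -, rfl⟩ := Multiset.mem_map.1 hx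
        positivity
    refine ⟨(Z.map fun ρ => r / ‖s₁ - ρ‖ ^ 2).sum, hHnn, ?_, ?_, ?_⟩
    · rw [hh _ (hsub18 hs0mem), hh _ (hsub18 hs1mem), norm_mul, norm_mul, sub_eq_add_neg,
        Real.exp_add]
      have h1 := norm_multiset_prod_le_exp hr0 Z hZre
      have h2 : s₁ - r = 1 / 2 + t * I := by rw [hs₁]; ring
      rw [h2] at h1
      have h3 : ‖Complex.exp (h (1 / 2 + t * I))‖ ≤
          ‖Complex.exp (h s₁)‖ * Real.exp (C * r * Real.log t) := by
        rw [Complex.norm_exp, Complex.norm_exp, ← Real.exp_add, Real.exp_le_exp]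
        have h4 := (convex_closedBall (2 + t * I : ℂ) 1.6).norm_image_sub_le_of_norm_deriv_le
          (f := h) (C := C * Real.log t) (x := s₁) (y := 1 / 2 + t * I)
          (fun x hx => hhd.differentiableAt (Metric.isOpen_ball.mem_nhds (hsub18 hx)))
          (fun x hx => hd1 x (hsub17 hx)) hs1mem hs0mem
        have h5 : (1 / 2 + t * I : ℂ) - s₁ = -(r : ℂ) := by rw [hs₁]; ring
        rw [h5, norm_neg, Complex.norm_real, Real.norm_eq_abs, abs_of_pos hr0] at h4
        have h6 := (Complex.re_le_norm _).trans h4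
        rw [Complex.sub_re] at h6
        linarith
      calc _ ≤ (‖(Z.map fun ρ => s₁ - ρ).prod‖ * _) *
            (‖Complex.exp (h s₁)‖ * Real.exp (C * r * Real.log t)) :=
          mul_le_mul h1 h3 (norm_nonneg _) (by positivity)
        _ = _ := by ring
    · rw [hlogD0, Complex.add_re]
      have h1 := re_multiset_sum_one_div_nonneg (s := s₁) Z fun ρ hρ => by
        rw [← hZre ρ hρ]; exact hr0.le
      have h2 := (abs_le.1 ((Complex.abs_re_le_norm _).trans (hd1 s₁ (hsub17 hs1mem)))).1
      linarith
    · intro w hw hw1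
      rw [hlogD0, hlogD w hw hw1, add_sub_add_comm]
      refine (norm_add_le _ _).trans (add_le_add (norm_multiset_sum_sub_le hr0 Z hZre hw) ?_)
      have := hd2 _ (hsrmem w hw hw1) _ hs1mem
      rwa [add_sub_cancel_left] at this
  · obtain ⟨Z, h, hZ, hcard, hhd, hh, hd1, hd2⟩ := hC s.im hs3
    have hlog : 0 ≤ Real.log s.im := Real.log_nonneg (by linarith)
    have hmem : s ∈ Metric.closedBall (2 + s.im * I : ℂ) 1.7 := by
      rw [mem_closedBall_iff_norm]
      have : s - (2 + s.im * I) = ((s.re - 2 : ℝ) : ℂ) := by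
        apply Complex.ext <;> simp
      rw [this, Complex.norm_real, Real.norm_eq_abs, abs_le]
      constructor <;> norm_num <;> linarith
    have hd : 0 < s.re - 1 / 2 := by linarith
    have hZre : ∀ ρ ∈ Z, s.re - 1 / 2 = (s - ρ).re := fun ρ hρ => by
      rw [Complex.sub_re, hZ ρ hρ]
    obtain ⟨h1, h2⟩ := logDeriv_eq_of_factorization hhd hh
      (Metric.closedBall_subset_ball (by norm_num) hmem) (fun ρ hρ h1 => by
        have := hZ ρ hρ
        rw [← h1] at this; linarith)
    refine ⟨h1, ?_⟩
    rw [h2]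
    refine (norm_add_le _ _).trans ?_
    have h3 := norm_multiset_sum_one_div_le hd Z hZre
    have h4 := hd1 s hmem
    have h5 : (Z.card : ℝ) * (1 / (s.re - 1 / 2)) ≤ C * Real.log s.im * (1 / (s.re - 1 / 2)) := by
      gcongr
    linarith

/-- The coefficients of `log L(s,χ)`. -/
noncomputable def logCoeff {q : ℕ} (χ : DirichletCharacter ℂ q) (n : ℕ) : ℂ :=
  (Λ n : ℂ) * χ n / (Real.log n : ℂ)

lemma norm_logCoeff_le {q : ℕ} (χ : DirichletCharacter ℂ q) (n : ℕ) : ‖logCoeff χ n‖ ≤ 1 := by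
  have h1 : ‖(Λ n : ℂ)‖ = Λ n := by
    rw [Complex.norm_real, Real.norm_of_nonneg ArithmeticFunction.vonMangoldt_nonneg]
  have h2 : ‖(Real.log n : ℂ)‖ = Real.log n := by
    rw [Complex.norm_real, Real.norm_of_nonneg (Real.log_natCast_nonneg n)]
  rw [logCoeff, norm_div, norm_mul, h1, h2]
  refine div_le_one_of_le₀ ?_ (Real.log_natCast_nonneg n)
  calc Λ n * ‖χ n‖ ≤ Λ n * 1 := by
        gcongr
        exact χ.norm_le_one _
    _ ≤ Real.log n := by simpa using ArithmeticFunction.vonMangoldt_le_log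

lemma lseriesSummable_logCoeff {q : ℕ} (χ : DirichletCharacter ℂ q) {s : ℂ} (hs : 1 < s.re) :
    LSeriesSummable (logCoeff χ) s :=
  LSeriesSummable_of_bounded_of_one_lt_re (fun n _ => norm_logCoeff_le χ n) hs

lemma hasDerivAt_lseries_logCoeff {q : ℕ} [NeZero q] (χ : DirichletCharacter ℂ q) {s : ℂ}
    (hs : 1 < s.re) :
    HasDerivAt (LSeries (logCoeff χ)) (logDeriv (DirichletCharacter.LFunction χ) s) s := by
  have hab : LSeries.abscissaOfAbsConv (logCoeff χ) ≤ 1 :=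
    LSeries.abscissaOfAbsConv_le_of_forall_lt_LSeriesSummable fun y hy =>
      lseriesSummable_logCoeff χ (by simpa using hy)
  refine (LSeries_hasDerivAt (hab.trans_lt (by exact_mod_cast hs))).congr_deriv ?_
  have heq : LSeries.logMul (logCoeff χ) = (fun n : ℕ => χ n) * fun n : ℕ => (Λ n : ℂ) := by
    funext n
    simp only [LSeries.logMul, logCoeff, Pi.mul_apply, ← Complex.natCast_log]
    rcases Nat.lt_or_ge n 2 with hn | hn
    · interval_cases n <;> simp
    · have : (Real.log n : ℂ) ≠ 0 := by
        exact_mod_cast (Real.log_pos (by exact_mod_cast hn)).ne'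
      field_simp
  rw [heq]
  have h1 := DirichletCharacter.LSeries_twist_vonMangoldt_eq χ hs
  rw [h1, logDeriv_apply, DirichletCharacter.deriv_LFunction_eq_deriv_LSeries χ hs,
    DirichletCharacter.LFunction_eq_LSeries χ hs]
  ring

lemma exists_norm_lseries_le :
    ∃ K : ℝ, 0 < K ∧ ∀ f : ℕ → ℂ, (∀ n, ‖f n‖ ≤ 1) → ∀ s : ℂ, 3 / 2 ≤ s.re →
      ‖LSeries f s‖ ≤ K := by
  have hsum : Summable fun n : ℕ => ((n : ℝ) ^ (3 / 2 : ℝ))⁻¹ :=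
    Real.summable_nat_rpow_inv.2 (by norm_num)
  refine ⟨1 + ∑' n : ℕ, ((n : ℝ) ^ (3 / 2 : ℝ))⁻¹, ?_, fun f hf s hs => ?_⟩
  · have : 0 ≤ ∑' n : ℕ, ((n : ℝ) ^ (3 / 2 : ℝ))⁻¹ := tsum_nonneg fun n => by positivity
    linarith
  · refine (tsum_of_norm_bounded hsum.hasSum fun n => ?_).trans (by linarith)
    rcases eq_or_ne n 0 with rfl | hn
    · simp
    · rw [LSeries.norm_term_eq, if_neg hn, div_eq_mul_inv]
      have hn1 : (1 : ℝ) ≤ n := by exact_mod_cast Nat.one_le_iff_ne_zero.2 hn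
      calc ‖f n‖ * ((n : ℝ) ^ s.re)⁻¹ ≤ 1 * ((n : ℝ) ^ (3 / 2 : ℝ))⁻¹ := by
            gcongr
            exact hf n
        _ = _ := one_mul _

lemma norm_pow_mul_cexp_neg (m : ℕ) (z : ℂ) {u : ℝ} (hu : 0 ≤ u) :
    ‖(u : ℂ) ^ m * cexp (-(z * u))‖ = u ^ m * Real.exp (-(z.re * u)) := by
  rw [norm_mul, norm_pow, Complex.norm_real, Real.norm_of_nonneg hu, Complex.norm_exp]
  simp

lemma integrableOn_pow_mul_cexp_neg (m : ℕ) {z : ℂ} (hz : 0 < z.re) :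
    IntegrableOn (fun u : ℝ => (u : ℂ) ^ m * cexp (-(z * u))) (Set.Ioi 0) := by
  have h := integrableOn_rpow_mul_exp_neg_mul_rpow (p := 1) (s := m) (b := z.re)
    (by linarith [Nat.cast_nonneg (α := ℝ) m]) (by norm_num) hz
  refine h.mono' (by fun_prop) ?_
  filter_upwards [ae_restrict_mem measurableSet_Ioi] with u hu
  rw [norm_pow_mul_cexp_neg m z (le_of_lt hu)]
  simp

lemma integral_pow_mul_cexp_neg (m : ℕ) {z : ℂ} (hz : 0 < z.re) :
    ∫ u : ℝ in Set.Ioi 0, (u : ℂ) ^ m * cexp (-(z * u)) = m.factorial / z ^ (m + 1) := by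
  have hz0 : z ≠ 0 := fun h => by simp [h] at hz
  induction m with
  | zero =>
    have h := integral_exp_mul_complex_Ioi (a := -z) (by simpa using hz) 0
    simp only [neg_mul, ofReal_zero, mul_zero, Complex.exp_zero] at h
    simp only [pow_zero, one_mul, h]
    simp
  | succ m ih =>
    have hder : ∀ u ∈ Set.Ici (0 : ℝ), HasDerivAt
        (fun u : ℝ => (u : ℂ) ^ (m + 1) * cexp (-(z * u)))
        (((m + 1 : ℕ) : ℂ) * ((u : ℂ) ^ m * cexp (-(z * u))) -
          z * ((u : ℂ) ^ (m + 1) * cexp (-(z * u)))) u := by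
      intro u _
      have h1 : HasDerivAt (fun w : ℂ => w ^ (m + 1) * cexp (-(z * w)))
          (((m + 1 : ℕ) : ℂ) * ((u : ℂ) ^ m * cexp (-(z * u))) -
          z * ((u : ℂ) ^ (m + 1) * cexp (-(z * u)))) (u : ℂ) := by
        have h2 : HasDerivAt (fun w : ℂ => -(z * w)) (-z) (u : ℂ) := by
          exact (((hasDerivAt_id (u : ℂ)).const_mul z).neg).congr_deriv (by simp)
        refine ((hasDerivAt_pow (m + 1) (u : ℂ)).mul h2.cexp).congr_deriv ?_
        simp only [Nat.add_sub_cancel]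
        ring
      exact h1.comp_ofReal
    have hlim : Tendsto (fun u : ℝ => (u : ℂ) ^ (m + 1) * cexp (-(z * u))) atTop (nhds 0) := by
      rw [tendsto_zero_iff_norm_tendsto_zero]
      have h := tendsto_rpow_mul_exp_neg_mul_atTop_nhds_zero ((m + 1 : ℕ) : ℝ) z.re hz
      refine h.congr' ?_
      filter_upwards [eventually_ge_atTop 0] with u hu
      rw [norm_pow_mul_cexp_neg (m + 1) z hu, Real.rpow_natCast, neg_mul]
    have hi1 := integrableOn_pow_mul_cexp_neg m hz
    have hi2 := integrableOn_pow_mul_cexp_neg (m + 1) hz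
    have h := integral_Ioi_of_hasDerivAt_of_tendsto' hder
      ((hi1.const_mul _).sub (hi2.const_mul _)) hlim
    rw [integral_sub (hi1.const_mul _) (hi2.const_mul _), integral_const_mul,
      integral_const_mul, ih] at h
    simp only [ofReal_zero, ne_eq, Nat.add_eq_zero_iff, one_ne_zero, and_false, not_false_eq_true,
      zero_pow, zero_mul, sub_zero] at h
    rw [sub_eq_zero] at h
    rw [← mul_right_inj' hz0, ← h, Nat.factorial_succ]
    push_cast
    field_simp
    ring

lemma ofReal_add_ofReal_mul_I_ne_zero {c : ℝ} (hc : 0 < c) (v : ℝ) : (c : ℂ) + v * I ≠ 0 := by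
  intro h
  have := congrArg Complex.re h
  simp at this
  exact hc.ne' this

lemma norm_ofReal_add_ofReal_mul_I_sq (c v : ℝ) : ‖(c : ℂ) + v * I‖ ^ 2 = c ^ 2 + v ^ 2 := by
  rw [← Complex.normSq_eq_norm_sq, Complex.normSq_add_mul_I]

lemma integrable_inv_sq_add_sq {c : ℝ} (hc : 0 < c) :
    Integrable fun v : ℝ => (c ^ 2 + v ^ 2)⁻¹ := by
  have h := (integrable_inv_one_add_sq.comp_mul_right' (inv_ne_zero hc.ne')).const_mul (c ^ 2)⁻¹
  refine h.congr (Eventually.of_forall fun v => ?_)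
  have : c ^ 2 + v ^ 2 ≠ 0 := by positivity
  have : 1 + (v * c⁻¹) ^ 2 ≠ 0 := by positivity
  simp only
  field_simp

lemma integral_inv_sq_add_sq {c : ℝ} (hc : 0 < c) :
    ∫ v : ℝ, (c ^ 2 + v ^ 2)⁻¹ = π / c := by
  have h : ∀ v : ℝ, (c ^ 2 + v ^ 2)⁻¹ = (c ^ 2)⁻¹ * (1 + (v * c⁻¹) ^ 2)⁻¹ := by
    intro v
    have : c ^ 2 + v ^ 2 ≠ 0 := by positivity
    have : 1 + (v * c⁻¹) ^ 2 ≠ 0 := by positivity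
    field_simp
  simp_rw [h]
  rw [integral_const_mul, Measure.integral_comp_mul_right (fun v => (1 + v ^ 2)⁻¹),
    integral_univ_inv_one_add_sq]
  simp only [inv_inv, abs_of_pos hc, smul_eq_mul]
  field_simp

lemma integrable_inv_ofReal_add_mul_I_pow {c : ℝ} (hc : 0 < c) {m : ℕ} (hm : 1 ≤ m) :
    Integrable fun v : ℝ => (((c : ℂ) + v * I) ^ (m + 1))⁻¹ := by
  have h := (integrable_inv_sq_add_sq hc).const_mul ((c ^ (m - 1))⁻¹)
  refine h.mono' (Continuous.aestronglyMeasurable ?_) (Eventually.of_forall fun v => ?_)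
  · refine Continuous.inv₀ (by fun_prop) fun v => pow_ne_zero _ ?_
    exact ofReal_add_ofReal_mul_I_ne_zero hc v
  · obtain ⟨j, rfl⟩ : ∃ j, m = j + 1 := ⟨m - 1, by omega⟩
    rw [norm_inv, norm_pow, ← mul_inv]
    gcongr
    rw [show j + 1 + 1 = j + 2 by ring, pow_add, norm_ofReal_add_ofReal_mul_I_sq]
    have h1 : c ≤ ‖(c : ℂ) + v * I‖ := by
      have := Complex.abs_re_le_norm ((c : ℂ) + v * I)
      simp at this
      exact (le_abs_self c).trans this
    simp only [Nat.add_sub_cancel]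
    gcongr

lemma integrable_perron {c : ℝ} (hc : 0 < c) {m : ℕ} (hm : 1 ≤ m) (ξ : ℝ) :
    Integrable fun v : ℝ => cexp (((c : ℂ) + v * I) * ξ) / ((c : ℂ) + v * I) ^ (m + 1) := by
  refine ((integrable_inv_ofReal_add_mul_I_pow hc hm).norm.const_mul (Real.exp (c * ξ))).mono'
    (Continuous.aestronglyMeasurable ?_) (Eventually.of_forall fun v => ?_)
  · refine Continuous.div (by fun_prop) (by fun_prop) fun v => pow_ne_zero _ ?_
    exact ofReal_add_ofReal_mul_I_ne_zero hc v
  · rw [norm_div, Complex.norm_exp, norm_inv, div_eq_mul_inv]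
    simp

/-- Smoothed Perron formula. -/
lemma integral_perron {c : ℝ} (hc : 0 < c) {m : ℕ} (hm : 1 ≤ m) (ξ : ℝ) :
    ∫ v : ℝ, cexp (((c : ℂ) + v * I) * ξ) / ((c : ℂ) + v * I) ^ (m + 1) =
      2 * π * ((max ξ 0 ^ m / m.factorial : ℝ) : ℂ) := by
  set g : ℝ → ℂ := fun u => ((max u 0 : ℝ) : ℂ) ^ m * cexp (-(c * u)) / m.factorial with hg
  have hgc : Continuous g := by fun_prop
  have hm0 : m ≠ 0 := by omega
  have hgI : ∀ w : ℝ, (fun u : ℝ => cexp (↑(-2 * π * u * w) * I) • g u) =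
      Set.indicator (Set.Ioi 0) fun u : ℝ =>
        (u : ℂ) ^ m * cexp (-(((c : ℂ) + (2 * π * w : ℝ) * I) * u)) / m.factorial := by
    intro w
    funext u
    by_cases hu : u ∈ Set.Ioi (0 : ℝ)
    · rw [Set.indicator_of_mem hu, hg]
      simp only [max_eq_left (le_of_lt (Set.mem_Ioi.1 hu)), smul_eq_mul]
      rw [← mul_div_assoc, mul_left_comm, ← Complex.exp_add]
      congr 3
      push_cast
      ring
    · rw [Set.indicator_of_notMem hu, hg]
      have hu' : u ≤ 0 := not_lt.1 fun h => hu h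
      simp [hm0, hu']
  have hre : ∀ w : ℝ, 0 < ((c : ℂ) + (2 * π * w : ℝ) * I).re := by
    intro w
    simpa using hc
  have hgint : Integrable g := by
    have h := hgI 0
    have h2 : g = fun u : ℝ => cexp (↑(-2 * π * u * (0 : ℝ)) * I) • g u := by
      funext u
      simp
    rw [h2, h]
    exact IntegrableOn.integrable_indicator
      ((integrableOn_pow_mul_cexp_neg m (hre 0)).integrable.div_const _) measurableSet_Ioi
  have hF : FourierTransform.fourier g =
      fun w : ℝ => (((c : ℂ) + (2 * π * w : ℝ) * I) ^ (m + 1))⁻¹ := by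
    funext w
    rw [Real.fourier_real_eq_integral_exp_smul, hgI w, integral_indicator measurableSet_Ioi,
      integral_div, integral_pow_mul_cexp_neg m (hre w)]
    have : (m.factorial : ℂ) ≠ 0 := by exact_mod_cast m.factorial_ne_zero
    rw [div_div_cancel_left' this]
  have h2pi : (2 * π : ℝ) ≠ 0 := by positivity
  have hFI : Integrable (FourierTransform.fourier g) := by
    rw [hF]
    exact (integrable_inv_ofReal_add_mul_I_pow hc hm).comp_mul_left' h2pi
  have hinv := congrFun (hgc.fourierInv_fourier_eq hgint hFI) ξ
  rw [Real.fourierInv_eq', hF] at hinv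
  have hsub := Measure.integral_comp_mul_left
    (fun v : ℝ => cexp (((c : ℂ) + v * I) * ξ) / ((c : ℂ) + v * I) ^ (m + 1)) (2 * π)
  have hpt : ∀ w : ℝ, cexp (((c : ℂ) + (2 * π * w : ℝ) * I) * ξ) /
      ((c : ℂ) + (2 * π * w : ℝ) * I) ^ (m + 1) =
      cexp (c * ξ) * (cexp (↑(2 * π * inner ℝ w ξ) * I) •
        (((c : ℂ) + (2 * π * w : ℝ) * I) ^ (m + 1))⁻¹) := by
    intro w
    rw [smul_eq_mul, ← mul_assoc, ← Complex.exp_add, div_eq_mul_inv]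
    congr 2
    simp
    ring
  simp_rw [hpt] at hsub
  rw [integral_const_mul, hinv, abs_of_pos (by positivity), Complex.real_smul] at hsub
  have hpi : (π : ℂ) ≠ 0 := by exact_mod_cast Real.pi_ne_zero
  have h3 : cexp (c * ξ) * g ξ = ((max ξ 0 ^ m / m.factorial : ℝ) : ℂ) := by
    simp only [hg]
    rw [Complex.exp_neg]
    have := Complex.exp_ne_zero ((c : ℂ) * ξ)
    push_cast
    field_simp
  rw [h3] at hsub
  rw [hsub, ← mul_assoc]
  have h4 : (2 * π : ℂ) * ((2 * π : ℝ)⁻¹ : ℝ) = 1 := by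
    push_cast
    field_simp
  rw [h4, one_mul]

lemma abs_le_norm_ofReal_add_mul_I (c v : ℝ) : |v| ≤ ‖(c : ℂ) + v * I‖ := by
  simpa using Complex.abs_im_le_norm ((c : ℂ) + v * I)

lemma le_norm_ofReal_add_mul_I (c v : ℝ) : c ≤ ‖(c : ℂ) + v * I‖ := by
  simpa using (le_abs_self _).trans (Complex.abs_re_le_norm ((c : ℂ) + v * I))

lemma norm_integral_vertical_le {c M Y : ℝ} (hc : 0 < c) (hM : 0 ≤ M) (hY : 0 ≤ Y) {G : ℝ → ℂ}
    (hG : ∀ v, |v| ≤ Y → ‖G v‖ ≤ M * (c ^ 2 + v ^ 2)⁻¹) :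
    ‖∫ v in (-Y)..Y, G v‖ ≤ M * (π / c) := by
  have hYY : -Y ≤ Y := by linarith
  have h1 := intervalIntegral.norm_integral_le_of_norm_le (μ := volume)
    (f := G) (g := fun v => M * (c ^ 2 + v ^ 2)⁻¹) hYY
    (Eventually.of_forall fun v hv => hG v (abs_le.2 ⟨hv.1.le, hv.2⟩))
    ((integrable_inv_sq_add_sq hc).const_mul M).intervalIntegrable
  refine h1.trans ?_
  rw [intervalIntegral.integral_of_le hYY, ← integral_inv_sq_add_sq hc, ← integral_const_mul]
  exact setIntegral_le_integral ((integrable_inv_sq_add_sq hc).const_mul M)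
    (Eventually.of_forall fun v => by positivity)

/-- Shifting a smoothed Perron integral to the left. -/
lemma norm_integral_perron_shift_le {R : ℂ → ℂ} {Q : ℝ → ℂ} {κ L Y M B B' : ℝ} (hκ : 0 < κ) (hκ1 : κ ≤ 1)
    (hY : 1 ≤ Y) (hM : 0 ≤ M) (hB : 0 ≤ B) (hB' : 0 ≤ B') (hL : 0 ≤ L)
    (hR : ∀ w : ℂ, κ ≤ w.re → w.re ≤ 1 → |w.im| ≤ Y → DifferentiableAt ℂ R w)
    (hleft : ∀ v : ℝ, |v| ≤ Y → ‖R (κ + v * I)‖ ≤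
      M * ‖(κ + v * I : ℂ)‖ ^ 3)
    (hrect : ∀ w : ℂ, κ ≤ w.re → w.re ≤ 1 → |w.im| ≤ Y → ‖R w‖ ≤ B * ‖w‖)
    (hQ : ∀ v : ℝ, |v| ≤ Y → Q v = R (1 + v * I))
    (htail : ∀ v : ℝ, ‖Q v‖ ≤ B' * ‖(1 + v * I : ℂ)‖)
    (hintg : Integrable fun v : ℝ => Q v * (cexp ((1 + v * I) * L) / (1 + v * I) ^ 5)) :
    ‖∫ v : ℝ, Q v * (cexp ((1 + v * I) * L) / (1 + v * I) ^ 5)‖ ≤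
      M * Real.exp (κ * L) * (π / κ) + 2 * B * Real.exp L / Y ^ 4 +
        B' * Real.exp L * π / Y ^ 2 := by
  set G : ℂ → ℂ := fun w => R w * (cexp (w * L) / w ^ 5) with hG
  have hY0 : 0 < Y := by linarith
  have hexp : ∀ w : ℂ, ‖cexp (w * L)‖ = Real.exp (w.re * L) := by
    intro w
    rw [Complex.norm_exp]
    simp
  have hrectG := Complex.integral_boundary_rect_eq_zero_of_differentiableOn G
    (κ + (-Y : ℝ) * I) (1 + (Y : ℝ) * I) (by
      intro w hw
      simp only [add_re, ofReal_re, mul_re, I_re, mul_zero, ofReal_im, I_im, mul_one, sub_self,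
        add_zero, one_re, add_im, ofReal_im, mul_im, zero_add, one_im] at hw
      rw [Complex.mem_reProdIm, Set.uIcc_of_le hκ1, Set.uIcc_of_le (by linarith)] at hw
      have hw0 : w ≠ 0 := by
        rintro rfl
        have := hw.1.1
        simp at this
        linarith
      have h1 := hR w hw.1.1 hw.1.2 (abs_le.2 hw.2)
      have h2 : DifferentiableAt ℂ (fun w : ℂ => cexp (w * L) / w ^ 5) w :=
        DifferentiableAt.div (by fun_prop) (by fun_prop) (pow_ne_zero _ hw0)
      exact (h1.mul h2).differentiableWithinAt)
  simp only [add_re, ofReal_re, mul_re, I_re, mul_zero, ofReal_im, I_im, mul_one, sub_self,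
    add_zero, one_re, add_im, ofReal_im, mul_im, zero_add, one_im, ofReal_one] at hrectG
  have hhor : ∀ y : ℝ, |y| = Y → ‖∫ x in κ..1, G (x + y * I)‖ ≤ B * Real.exp L / Y ^ 4 := by
    intro y hy
    have h := intervalIntegral.norm_integral_le_of_norm_le_const
      (f := fun x : ℝ => G (x + y * I)) (a := κ) (b := 1) (C := B * Real.exp L / Y ^ 4) (by
        intro x hx
        rw [Set.uIoc_of_le hκ1] at hx
        set w : ℂ := x + y * I with hw
        have hre : w.re = x := by simp [hw]
        have him : w.im = y := by simp [hw]
        have hYw : Y ≤ ‖w‖ := hy ▸ abs_le_norm_ofReal_add_mul_I x y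
        have hw0 : 0 < ‖w‖ := by linarith
        have h1 := hrect w (by rw [hre]; exact hx.1.le) (by rw [hre]; exact hx.2)
          (by rw [him, hy])
        simp only [hG]
        rw [norm_mul, norm_div, norm_pow, hexp, hre]
        calc ‖R w‖ * (Real.exp (x * L) / ‖w‖ ^ 5)
            ≤ (B * ‖w‖) * (Real.exp L / ‖w‖ ^ 5) := by
              gcongr
              nlinarith [hx.2]
          _ = B * Real.exp L / ‖w‖ ^ 4 := by field_simp
          _ ≤ _ := by gcongr)
    refine h.trans (mul_le_of_le_one_right (by positivity) ?_)
    rw [abs_le]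
    constructor <;> linarith
  have hleft' : ‖∫ v in (-Y)..Y, G (κ + v * I)‖ ≤ M * Real.exp (κ * L) * (π / κ) := by
    refine norm_integral_vertical_le hκ (by positivity) hY0.le fun v hv => ?_
    have hw0 : 0 < ‖(κ + v * I : ℂ)‖ := lt_of_lt_of_le hκ (le_norm_ofReal_add_mul_I κ v)
    simp only [hG]
    rw [norm_mul, norm_div, norm_pow, hexp, ← norm_ofReal_add_ofReal_mul_I_sq]
    calc _ ≤ (M * ‖(κ + v * I : ℂ)‖ ^ 3) *
          (Real.exp ((κ + v * I : ℂ).re * L) / ‖(κ + v * I : ℂ)‖ ^ 5) := by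
            gcongr
            exact hleft v hv
      _ = _ := by
            simp only [add_re, ofReal_re, mul_re, I_re, mul_zero, ofReal_im, I_im, mul_one,
              sub_self, add_zero]
            field_simp
  set G₁ : ℝ → ℂ := fun v => Q v * (cexp ((1 + v * I) * L) / (1 + v * I) ^ 5) with hG₁
  have htail' : ‖∫ v in (Set.Ioc (-Y) Y)ᶜ, G₁ v‖ ≤ B' * Real.exp L * π / Y ^ 2 := by
    have hint1 := integrable_inv_sq_add_sq (c := 1) one_pos
    have hbd : ∀ v ∈ (Set.Ioc (-Y) Y)ᶜ, ‖G₁ v‖ ≤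
        B' * Real.exp L / Y ^ 2 * (1 ^ 2 + v ^ 2)⁻¹ := by
      intro v hv
      have hv' : Y ≤ |v| := by
        by_contra hlt
        push Not at hlt
        exact hv ⟨(abs_lt.1 hlt).1, (abs_lt.1 hlt).2.le⟩
      have h1 := abs_le_norm_ofReal_add_mul_I 1 v
      have h2 := norm_ofReal_add_ofReal_mul_I_sq 1 v
      simp only [ofReal_one] at h1 h2
      have hw0 : 0 < ‖(1 + v * I : ℂ)‖ := by linarith
      have h3 := htail v
      simp only [hG₁]
      rw [norm_mul, norm_div, norm_pow, hexp, ← h2]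
      calc _ ≤ (B' * ‖(1 + v * I : ℂ)‖) *
            (Real.exp ((1 + v * I : ℂ).re * L) / ‖(1 + v * I : ℂ)‖ ^ 5) := by gcongr
        _ = B' * Real.exp L / ‖(1 + v * I : ℂ)‖ ^ 2 * (‖(1 + v * I : ℂ)‖ ^ 2)⁻¹ := by
            simp only [add_re, ofReal_re, mul_re, I_re, mul_zero, ofReal_im, I_im, mul_one,
              sub_self, add_zero, one_re, one_mul]
            field_simp
        _ ≤ _ := by
            gcongr
            linarith
    refine (norm_integral_le_of_norm_le ((hint1.const_mul _).integrableOn)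
      (ae_restrict_of_forall_mem measurableSet_Ioc.compl hbd)).trans ?_
    calc _ ≤ ∫ v : ℝ, B' * Real.exp L / Y ^ 2 * (1 ^ 2 + v ^ 2)⁻¹ :=
          setIntegral_le_integral (hint1.const_mul _) (Eventually.of_forall fun v => by positivity)
      _ = _ := by
          rw [integral_const_mul, integral_inv_sq_add_sq one_pos]
          ring
  have hsplit : ∫ v : ℝ, G₁ v =
      (∫ v in (-Y)..Y, G (1 + v * I)) + ∫ v in (Set.Ioc (-Y) Y)ᶜ, G₁ v := by
    rw [intervalIntegral.integral_of_le (by linarith),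
      ← integral_add_compl measurableSet_Ioc hintg]
    congr 1
    refine setIntegral_congr_fun measurableSet_Ioc fun v hv => ?_
    simp only [hG₁, hG]
    rw [hQ v (abs_le.2 ⟨hv.1.le, hv.2⟩)]
  have hkey : ∫ v in (-Y)..Y, G (1 + v * I) = (∫ v in (-Y)..Y, G (κ + v * I)) +
      I * ((∫ x in κ..1, G (x + (-Y : ℝ) * I)) - ∫ x in κ..1, G (x + (Y : ℝ) * I)) := by
    have hI := Complex.I_mul_I
    simp only [smul_eq_mul] at hrectG
    linear_combination (-I) * hrectG + ((∫ v in (-Y)..Y, G (1 + v * I)) -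
      ∫ v in (-Y)..Y, G (κ + v * I)) * hI
  change ‖∫ v : ℝ, G₁ v‖ ≤ _
  rw [hsplit, hkey]
  have ht := hhor (-Y) (by rw [abs_neg, abs_of_pos hY0])
  have hb := hhor Y (abs_of_pos hY0)
  have hI : ‖I * ((∫ x in κ..1, G (x + (-Y : ℝ) * I)) - ∫ x in κ..1, G (x + (Y : ℝ) * I))‖ ≤
      2 * B * Real.exp L / Y ^ 4 := by
    rw [norm_mul, Complex.norm_I, one_mul]
    refine (norm_sub_le _ _).trans ((add_le_add ht hb).trans (le_of_eq ?_))
    ring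
  exact norm_add₃_le.trans (add_le_add (add_le_add hleft' hI) htail')

/-- The smoothed truncation, at height `exp L`, of the Dirichlet series of `log L(s,χ)`. -/
noncomputable def logPoly {q : ℕ} (χ : DirichletCharacter ℂ q) (L : ℝ) (s : ℂ) : ℂ :=
  ∑ n ∈ Icc 1 ⌊Real.exp L⌋₊, logCoeff χ n / (n : ℂ) ^ s * ((1 - Real.log n / L) ^ 4 : ℝ)

lemma logCoeff_zero {q : ℕ} (χ : DirichletCharacter ℂ q) : logCoeff χ 0 = 0 := by
  simp [logCoeff]

lemma term_mul_perron (f : ℕ → ℂ) (hf : f 0 = 0) (s z : ℂ) (L : ℝ) (n : ℕ) :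
    LSeries.term f (s + z) n * (cexp (z * L) / z ^ 5) =
      f n / (n : ℂ) ^ s * (cexp (z * (L - Real.log n : ℝ)) / z ^ 5) := by
  rcases eq_or_ne n 0 with rfl | hn
  · simp [hf]
  · have hn0 : (n : ℂ) ≠ 0 := by exact_mod_cast hn
    rw [LSeries.term_of_ne_zero hn, Complex.cpow_add _ _ hn0, Complex.cpow_def_of_ne_zero hn0 z,
      ofReal_sub, mul_sub, Complex.exp_sub, ← Complex.natCast_log, mul_comm (Real.log n : ℂ) z]
    have := Complex.exp_ne_zero (z * (Real.log n : ℂ))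
    field_simp

lemma integrable_lseries_perron {q : ℕ} [NeZero q] (χ : DirichletCharacter ℂ q) {s : ℂ}
    (hs : 1 / 2 ≤ s.re) (L : ℝ) :
    Integrable fun v : ℝ => LSeries (logCoeff χ) (s + (1 + v * I)) *
      (cexp ((1 + v * I) * L) / (1 + v * I) ^ 5) := by
  obtain ⟨K, hK, hKb⟩ := exists_norm_lseries_le
  have h1 := (integrable_perron one_pos (m := 4) (by norm_num) L)
  simp only [ofReal_one] at h1
  refine h1.bdd_mul (c := K) (Continuous.aestronglyMeasurable ?_) (Eventually.of_forall fun v => ?_)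
  · rw [continuous_iff_continuousAt]
    intro v
    have h2 := (hasDerivAt_lseries_logCoeff χ (s := s + (1 + v * I))
      (by simp; linarith)).continuousAt
    exact ContinuousAt.comp (f := fun v : ℝ => s + (1 + v * I)) h2 (by fun_prop)
  · exact hKb _ (norm_logCoeff_le χ) _ (by simp; linarith)

lemma integral_lseries_perron {q : ℕ} [NeZero q] (χ : DirichletCharacter ℂ q) {s : ℂ}
    (hs : 1 / 2 ≤ s.re) {L : ℝ} (hL : 0 < L) :
    ∫ v : ℝ, LSeries (logCoeff χ) (s + (1 + v * I)) *
      (cexp ((1 + v * I) * L) / (1 + v * I) ^ 5) = 2 * π * (L ^ 4 / 24) * logPoly χ L s := by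
  set F : ℕ → ℝ → ℂ := fun n v => logCoeff χ n / (n : ℂ) ^ s *
    (cexp ((1 + v * I) * (L - Real.log n : ℝ)) / (1 + v * I) ^ 5) with hF
  have hper : ∀ ξ : ℝ, Integrable fun v : ℝ => cexp ((1 + v * I) * ξ) / (1 + v * I) ^ 5 := by
    intro ξ
    simpa only [ofReal_one] using integrable_perron one_pos (m := 4) (by norm_num) ξ
  have hFint : ∀ n, Integrable (F n) := fun n => (hper _).const_mul _
  set A := ∫ v : ℝ, ‖(((1 : ℂ) + v * I) ^ 5)⁻¹‖ with hA
  have hFn : ∀ n, ∫ v, ‖F n v‖ ≤ Real.exp L * A * ((n : ℝ) ^ (3 / 2 : ℝ))⁻¹ := by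
    intro n
    rcases eq_or_ne n 0 with rfl | hn
    · simp [hF, logCoeff_zero]
    have hn1 : (1 : ℝ) ≤ n := by exact_mod_cast Nat.one_le_iff_ne_zero.2 hn
    have hpt : ∀ v, ‖F n v‖ = ‖logCoeff χ n‖ / (n : ℝ) ^ s.re * (Real.exp L / n) *
        ‖(((1 : ℂ) + v * I) ^ 5)⁻¹‖ := by
      intro v
      simp only [hF]
      rw [norm_mul, norm_div, norm_div, Complex.norm_natCast_cpow_of_pos (by omega), Complex.norm_exp,
        norm_inv, mul_assoc, div_eq_mul_inv (Real.exp _)]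
      congr 2
      rw [re_mul_ofReal]
      simp only [add_re, one_re, mul_re, ofReal_re, I_re, mul_zero, ofReal_im, I_im,
        mul_one, sub_self, add_zero, one_mul]
      rw [Real.exp_sub, Real.exp_log (zero_lt_one.trans_le hn1)]
    simp_rw [hpt]
    rw [integral_const_mul]
    calc _ ≤ 1 / (n : ℝ) ^ (1 / 2 : ℝ) * (Real.exp L / n) * A := by
          gcongr
          exact norm_logCoeff_le χ n
      _ = _ := by
          rw [show (3 / 2 : ℝ) = 1 / 2 + 1 by norm_num, Real.rpow_add (by linarith), Real.rpow_one]
          field_simp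
  have hsum : Summable fun n => ∫ v, ‖F n v‖ :=
    Summable.of_nonneg_of_le (fun n => integral_nonneg fun v => norm_nonneg _) hFn
      ((Real.summable_nat_rpow_inv.2 (by norm_num)).mul_left _)
  have hH := hasSum_integral_of_summable_integral_norm hFint hsum
  have hval : ∀ n, ∫ v, F n v = logCoeff χ n / (n : ℂ) ^ s *
      (2 * π * ((max (L - Real.log n) 0 ^ 4 / (Nat.factorial 4) : ℝ) : ℂ)) := by
    intro n
    simp only [hF]
    rw [integral_const_mul]
    have h := integral_perron one_pos (m := 4) (by norm_num) (L - Real.log n)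
    simp only [ofReal_one] at h
    rw [← h]
  have htsum : ∀ v : ℝ, ∑' n, F n v = LSeries (logCoeff χ) (s + (1 + v * I)) *
      (cexp ((1 + v * I) * L) / (1 + v * I) ^ 5) := by
    intro v
    rw [LSeries, ← tsum_mul_right]
    exact tsum_congr fun n => (term_mul_perron _ (logCoeff_zero χ) _ _ _ _).symm
  simp_rw [htsum] at hH
  rw [← hH.tsum_eq, tsum_eq_sum (s := Icc 1 ⌊Real.exp L⌋₊), logPoly, Finset.mul_sum]
  · refine Finset.sum_congr rfl fun n hn => ?_
    rw [Finset.mem_Icc] at hn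
    have hn1 : (1 : ℝ) ≤ n := by exact_mod_cast hn.1
    have hlog : Real.log n ≤ L := by
      rw [Real.log_le_iff_le_exp (by linarith)]
      exact (Nat.le_floor_iff (Real.exp_pos _).le).1 hn.2
    rw [hval, max_eq_left (by linarith)]
    have hL0 : (L : ℂ) ≠ 0 := by exact_mod_cast hL.ne'
    have : Nat.factorial 4 = 24 := rfl
    rw [this]
    push_cast
    field_simp
  · intro n hn
    rw [hval]
    rcases eq_or_ne n 0 with rfl | hn0
    · simp [logCoeff_zero]
    · have hn1 : (1 : ℝ) ≤ n := by exact_mod_cast Nat.one_le_iff_ne_zero.2 hn0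
      have hlog : L - Real.log n ≤ 0 := by
        rw [sub_nonpos, Real.le_log_iff_exp_le (by linarith)]
        refine (Nat.lt_of_floor_lt ?_).le
        by_contra hle
        exact hn (Finset.mem_Icc.2 ⟨Nat.one_le_iff_ne_zero.2 hn0, not_lt.1 hle⟩)
      rw [max_eq_right hlog]
      simp

/-- Under GRH, a branch of `log L(s,χ)` on a large disc to the right of the critical line. -/
lemma exists_log_branch {q : ℕ} [NeZero q] (hGRH : GRHmod q) (χ : DirichletCharacter ℂ q) :
    ∃ K : ℝ, 0 < K ∧ ∀ t : ℝ, 12 ≤ t → ∃ F : ℂ → ℂ,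
      (∀ s ∈ Metric.ball ((1 / 2 + t / 2 : ℝ) + t * I : ℂ) (t / 2),
        HasDerivAt F (logDeriv (DirichletCharacter.LFunction χ) s) s ∧
        ‖DirichletCharacter.LFunction χ s‖ ≤ Real.exp ((F s).re + K)) ∧
      ∀ s ∈ Metric.ball ((1 / 2 + t / 2 : ℝ) + t * I : ℂ) (t / 2), 1 < s.re →
        F s = LSeries (logCoeff χ) s := by
  obtain ⟨K, hK, hKb⟩ := exists_norm_lseries_le
  refine ⟨K + K, by positivity, fun t ht => ?_⟩
  set c : ℂ := (1 / 2 + t / 2 : ℝ) + t * I with hc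
  set U := Metric.ball c (t / 2) with hU
  have hUo : IsOpen U := Metric.isOpen_ball
  have hmem : ∀ s ∈ U, 1 / 2 < s.re ∧ 3 < s.im := by
    intro s hs
    rw [hU, Metric.mem_ball, dist_eq_norm] at hs
    have h1 := (Complex.abs_re_le_norm (s - c)).trans_lt hs
    have h2 := (Complex.abs_im_le_norm (s - c)).trans_lt hs
    simp only [hc, sub_re, add_re, ofReal_re, mul_re, I_re, mul_zero, ofReal_im, I_im, mul_one,
      sub_self, add_zero, sub_im, add_im, mul_im, zero_add] at h1 h2
    rw [abs_lt] at h1 h2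
    constructor <;> linarith [h1.1, h2.1]
  have hne1 : ∀ s ∈ U, s ≠ 1 := by
    rintro s hs rfl
    have := (hmem _ hs).2
    simp at this
    linarith
  have hdiff : ∀ s ∈ U, DifferentiableAt ℂ (DirichletCharacter.LFunction χ) s := fun s hs =>
    DirichletCharacter.differentiableAt_LFunction χ s (Or.inl (hne1 s hs))
  have hL0 : ∀ s ∈ U, DirichletCharacter.LFunction χ s ≠ 0 := by
    intro s hs h0
    rcases lt_or_ge s.re 1 with h | h
    · have := hGRH χ s h0 (by linarith [(hmem s hs).1]) h
      linarith [(hmem s hs).1]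
    · exact DirichletCharacter.LFunction_ne_zero_of_one_le_re χ (Or.inr (hne1 s hs)) h h0
  obtain ⟨h, hhd, hh⟩ := exists_exp_eq_of_ne_zero (by linarith : 0 < t / 2)
    (fun s hs => (hdiff s hs).differentiableWithinAt) hL0
  have hder : ∀ s ∈ U, HasDerivAt h (logDeriv (DirichletCharacter.LFunction χ) s) s := by
    intro s hs
    have h1 : DifferentiableAt ℂ h s := hhd.differentiableAt (hUo.mem_nhds hs)
    have h2 : HasDerivAt (DirichletCharacter.LFunction χ) (cexp (h s) * deriv h s) s :=
      h1.hasDerivAt.cexp.congr_of_eventuallyEq (Filter.eventuallyEq_of_mem (hUo.mem_nhds hs) hh)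
    refine h1.hasDerivAt.congr_deriv ?_
    rw [logDeriv_apply, h2.deriv, hh s hs]
    have := Complex.exp_ne_zero (h s)
    field_simp
  set V := U ∩ {s : ℂ | 1 < s.re} with hV
  have hVo : IsOpen V := hUo.inter (isOpen_lt continuous_const continuous_re)
  have hVc : Convex ℝ V := (convex_ball _ _).inter (convex_halfSpace_re_gt 1)
  set s0 : ℂ := (2 : ℝ) + t * I with hs0
  have hs0U : s0 ∈ U := by
    rw [hU, Metric.mem_ball, dist_eq_norm, show s0 - c = ((3 / 2 - t / 2 : ℝ) : ℂ) by
      rw [hs0, hc]; push_cast; ring, Complex.norm_real, Real.norm_eq_abs, abs_lt]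
    constructor <;> linarith
  have hs0V : s0 ∈ V := ⟨hs0U, by simp [hs0]⟩
  have hconst : ∀ s ∈ V, h s - LSeries (logCoeff χ) s = h s0 - LSeries (logCoeff χ) s0 := by
    intro s hs
    have hd : ∀ z ∈ V, HasDerivAt (fun s => h s - LSeries (logCoeff χ) s) 0 z := fun z hz => by
      exact ((hder z hz.1).sub (hasDerivAt_lseries_logCoeff χ hz.2)).congr_deriv (sub_self _)
    exact hVo.is_const_of_deriv_eq_zero hVc.isPreconnected
      (fun z hz => (hd z hz).differentiableAt.differentiableWithinAt)
      (fun z hz => (hd z hz).deriv) hs hs0V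
  set c0 := h s0 - LSeries (logCoeff χ) s0 with hc0
  have hc0re : Real.exp c0.re ≤ Real.exp (K + K) := by
    have h1 : ‖DirichletCharacter.LFunction χ s0‖ ≤ K := by
      rw [DirichletCharacter.LFunction_eq_LSeries χ hs0V.2]
      exact hKb _ (fun n => χ.norm_le_one _) _ (by simp [hs0]; norm_num)
    have h2 := hKb _ (norm_logCoeff_le χ) s0 (by simp [hs0]; norm_num)
    rw [hh s0 hs0U, Complex.norm_exp] at h1
    have h3 : c0.re = (h s0).re - (LSeries (logCoeff χ) s0).re := by rw [hc0, sub_re]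
    have h4 := (abs_le.1 (Complex.abs_re_le_norm (LSeries (logCoeff χ) s0))).1
    have h5 : (h s0).re ≤ K := by linarith [Real.add_one_le_exp (h s0).re]
    exact Real.exp_le_exp.2 (by linarith)
  refine ⟨fun s => h s - c0, fun s hs => ⟨(hder s hs).sub_const c0, ?_⟩, fun s hs hs1 => ?_⟩
  · rw [hh s hs, Complex.norm_exp, sub_re]
    have := Real.exp_le_exp.1 hc0re
    exact Real.exp_le_exp.2 (by linarith)
  · rw [← hconst s ⟨hs, hs1⟩]
    ring

/-- A bound for the second order Taylor remainder of a holomorphic function. -/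
lemma norm_taylor_remainder_le {F D : ℂ → ℂ} {s w : ℂ} {A : ℝ}
    (hF : ∀ u ∈ segment ℝ 0 w, HasDerivAt F (D (s + u)) (s + u))
    (hD : ∀ u ∈ segment ℝ 0 w, ‖D (s + u) - D s‖ ≤ A) :
    ‖F (s + w) - F s - D s * w‖ ≤ A * ‖w‖ := by
  have h := (convex_segment (0 : ℂ) w).norm_image_sub_le_of_norm_hasDerivWithin_le
    (f := fun u => F (s + u) - D s * u) (f' := fun u => D (s + u) - D s) (C := A)
    (fun u hu => by
      have h1 : HasDerivAt (fun u => F (s + u)) (D (s + u)) u := (hF u hu).comp_const_add s u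
      have h2 : HasDerivAt (fun u => D s * u) (D s) u := by
        simpa using (hasDerivAt_id u).const_mul (D s)
      exact (h1.sub h2).hasDerivWithinAt)
    hD (left_mem_segment ℝ _ _) (right_mem_segment ℝ _ _)
  simp only [add_zero, mul_zero, sub_zero] at h
  rwa [show F (s + w) - F s - D s * w = F (s + w) - D s * w - F s by ring]

lemma perron_identity {q : ℕ} [NeZero q] (χ : DirichletCharacter ℂ q) {s : ℂ}
    (hs : 1 / 2 ≤ s.re) {L : ℝ} (hL : 0 < L) (a b : ℂ) {Q : ℝ → ℂ}
    (hQ : ∀ v : ℝ, Q v = LSeries (logCoeff χ) (s + (1 + v * I)) - a - b * (1 + v * I)) :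
    Integrable (fun v : ℝ => Q v * (cexp ((1 + v * I) * L) / (1 + v * I) ^ 5)) ∧
    ∫ v : ℝ, Q v * (cexp ((1 + v * I) * L) / (1 + v * I) ^ 5) =
      2 * π * (L ^ 4 / 24) * (logPoly χ L s - a - 4 * b / L) := by
  have hi1 := integrable_lseries_perron χ hs L
  have hi2 := (integrable_perron one_pos (m := 4) (by norm_num) L).const_mul a
  have hi3 := (integrable_perron one_pos (m := 3) (by norm_num) L).const_mul b
  have e2 := integral_perron one_pos (m := 4) (by norm_num) L
  have e3 := integral_perron one_pos (m := 3) (by norm_num) L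
  simp only [ofReal_one, Nat.reduceAdd] at hi2 hi3 e2 e3
  have heq : (fun v : ℝ => Q v * (cexp ((1 + v * I) * L) / (1 + v * I) ^ 5)) =
      fun v : ℝ => LSeries (logCoeff χ) (s + (1 + v * I)) *
        (cexp ((1 + v * I) * L) / (1 + v * I) ^ 5) -
        a * (cexp ((1 + v * I) * L) / (1 + v * I) ^ 5) -
        b * (cexp ((1 + v * I) * L) / (1 + v * I) ^ 4) := by
    funext v
    have h0 : (1 + v * I : ℂ) ≠ 0 := by
      simpa using ofReal_add_ofReal_mul_I_ne_zero one_pos v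
    rw [hQ]
    field_simp
  rw [heq]
  refine ⟨(hi1.sub hi2).sub hi3, ?_⟩
  have hintg : Integrable fun v : ℝ => LSeries (logCoeff χ) (s + (1 + v * I)) *
        (cexp ((1 + v * I) * L) / (1 + v * I) ^ 5) -
        a * (cexp ((1 + v * I) * L) / (1 + v * I) ^ 5) := hi1.sub hi2
  rw [integral_sub hintg hi3, integral_sub hi1 hi2, integral_const_mul, integral_const_mul,
    integral_lseries_perron χ hs hL, e2, e3, max_eq_left hL.le]
  have hL0 : (L : ℂ) ≠ 0 := by exact_mod_cast hL.ne'
  have h4 : Nat.factorial 4 = 24 := rfl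
  have h3 : Nat.factorial 3 = 6 := rfl
  rw [h4, h3]
  push_cast
  field_simp
  ring

lemma log_le_two_mul_log {T y : ℝ} (hT : 3 ≤ T) (hy : 0 < y) (hyT : y ≤ 3 * T) :
    Real.log y ≤ 2 * Real.log T := by
  rw [← Real.log_rpow (by linarith)]
  refine Real.log_le_log hy ?_
  norm_num
  nlinarith

lemma remainder_le_of_scaled_bound {C K H L ℓ M E : ℝ} (hC : 0 < C) (hK : 0 < K) (hH : 0 ≤ H) (hL : 48 ≤ L)
    (hℓ : L ≤ ℓ)
    (hM : M = 13 / 144 * H * L ^ 2 + 18 * C * L * ℓ)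
    (hE : 2 * π * (L ^ 4 / 24) * E ≤ M * Real.exp 1 * (π * L) + 2 * (C * L * ℓ) +
      (2 * K + 2 * C * L * ℓ) * π) :
    E ≤ 6 * H / L + (14 * C + K) * ℓ / L := by
  have hL0 : 0 < L := by linarith
  have he := Real.exp_one_lt_d9
  have hpi := Real.pi_gt_three
  have hM0 : 0 ≤ M := by
    rw [hM]
    have : 0 < ℓ := by linarith
    positivity
  have hCL : 0 < C * L * ℓ := by
    have : 0 < ℓ := by linarith
    positivity
  have h1 : 2 * π * (L ^ 4 / 24) * E ≤ π * (M * 2.72 * L + 4 * (C * L * ℓ) + 2 * K) := by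
    have h2 : M * Real.exp 1 * (π * L) ≤ M * 2.72 * (π * L) := by
      gcongr
      linarith
    nlinarith
  have h3 : L ^ 4 / 12 * E ≤ M * 2.72 * L + 4 * (C * L * ℓ) + 2 * K := by
    have : π * (L ^ 4 / 12 * E) ≤ π * (M * 2.72 * L + 4 * (C * L * ℓ) + 2 * K) := by linarith
    exact le_of_mul_le_mul_left this (by linarith)
  have hgoal : L ^ 4 / 12 * E ≤ L ^ 4 / 12 * (6 * H / L + (14 * C + K) * ℓ / L) := by
    refine h3.trans ?_
    have e1 : L ^ 4 / 12 * (6 * H / L + (14 * C + K) * ℓ / L) =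
        L ^ 3 * H / 2 + (14 * C + K) * ℓ * L ^ 3 / 12 := by
      field_simp
      ring
    rw [e1, hM]
    have hKl : 2 * K ≤ K * ℓ * L ^ 3 / 12 := by
      have : (48 : ℝ) ^ 3 ≤ L ^ 3 := by gcongr
      have h5 : 48 * (48 : ℝ) ^ 3 ≤ ℓ * L ^ 3 := by
        have h48 : (48 : ℝ) ≤ ℓ := by linarith
        gcongr
      nlinarith
    have hCl : C * L ^ 2 * ℓ * 48 ≤ C * L ^ 3 * ℓ := by
      have : C * L * ℓ * L * 48 ≤ C * L * ℓ * L * L := by gcongr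
      nlinarith
    have hCl2 : C * L * ℓ * 48 ≤ C * L ^ 2 * ℓ := by
      have : C * L * ℓ * 48 ≤ C * L * ℓ * L := by gcongr
      nlinarith
    have hHl : 0 ≤ H * L ^ 3 := by positivity
    nlinarith
  exact le_of_mul_le_mul_left hgoal (by positivity)

lemma mem_segment_zero {w u : ℂ} {Y : ℝ} (h0 : 0 ≤ w.re) (h1 : w.re ≤ 1) (h2 : |w.im| ≤ Y)
    (hu : u ∈ segment ℝ 0 w) : 0 ≤ u.re ∧ u.re ≤ 1 ∧ |u.im| ≤ Y ∧ ‖u‖ ≤ ‖w‖ := by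
  rw [segment_eq_image] at hu
  obtain ⟨θ, ⟨hθ0, hθ1⟩, rfl⟩ := hu
  simp only [smul_zero, zero_add, Complex.smul_re, Complex.smul_im, smul_eq_mul, norm_smul,
    Real.norm_eq_abs, abs_mul, abs_of_nonneg hθ0]
  refine ⟨by positivity, by nlinarith, ?_, ?_⟩
  · exact (mul_le_of_le_one_left (abs_nonneg _) hθ1).trans h2
  · exact mul_le_of_le_one_left (norm_nonneg _) hθ1

/-- The remainder estimate on the left edge of the contour. -/
lemma norm_remainder_left_le {Rw w L H C ℓ : ℝ} (hL : 48 ≤ L) (hH : 0 ≤ H) (hC : 0 < C)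
    (hℓ : 0 < ℓ) (hw : 1 ≤ L * w) (hw0 : 0 ≤ w)
    (h1 : w ≤ 1 / 4 → Rw ≤ (H * (w * (L / 12) * (1 + w * (L / 12))) + C * (2 * ℓ) * w) * w)
    (h2 : Rw ≤ C * L * ℓ * w) :
    Rw ≤ (13 / 144 * H * L ^ 2 + 18 * C * L * ℓ) * w ^ 3 := by
  have hL0 : 0 < L := by linarith
  rcases le_or_gt w (1 / 4) with hw4 | hw4
  · refine (h1 hw4).trans ?_
    have e2 : (1 + w * (L / 12)) ≤ 13 / 12 * (L * w) := by linarith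
    have h5 : 0 ≤ C * (2 * ℓ) * w := by positivity
    calc _ ≤ (H * (w * (L / 12) * (13 / 12 * (L * w))) + C * (2 * ℓ) * w * (L * w)) * w := by
          gcongr ?_ * w
          refine add_le_add (by gcongr) ?_
          nlinarith
      _ = (13 / 144 * H * L ^ 2 + 2 * C * L * ℓ) * w ^ 3 := by ring
      _ ≤ _ := by
          gcongr
          norm_num
  · refine h2.trans ?_
    have h5 : w ≤ 16 * w ^ 3 := by
      have : (1 / 4) ^ 2 ≤ w ^ 2 := by gcongr
      nlinarith
    have h6 : 0 ≤ 13 / 144 * H * L ^ 2 := by positivity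
    calc C * L * ℓ * w ≤ C * L * ℓ * (16 * w ^ 3) := by gcongr
      _ = (0 + 16 * C * L * ℓ) * w ^ 3 := by ring
      _ ≤ _ := by
          gcongr
          norm_num

lemma exists_re_le_logPoly :
    ∃ K : ℝ, 0 < K ∧ ∀ {q : ℕ} [NeZero q] (χ : DirichletCharacter ℂ q) (F D : ℂ → ℂ) (s : ℂ)
      (C H L Y ℓ : ℝ), 1 / 2 ≤ s.re → 0 < C → 0 ≤ H → 48 ≤ L → L ≤ ℓ → 1 ≤ Y →
      Real.exp L ≤ Y ^ 2 →
      (∀ w : ℂ, 0 ≤ w.re → w.re ≤ 1 → |w.im| ≤ Y → HasDerivAt F (D (s + w)) (s + w)) →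
      (∀ v : ℝ, |v| ≤ Y → F (s + (1 + v * I)) = LSeries (logCoeff χ) (s + (1 + v * I))) →
      (∀ w : ℂ, 0 ≤ w.re → w.re ≤ 1 → |w.im| ≤ Y → ‖D (s + w)‖ ≤ C * L * ℓ * (5 / 24)) →
      (∀ w : ℂ, 0 ≤ w.re → ‖w‖ ≤ 1 / 4 → ‖D (s + w) - D s‖ ≤
        H * (‖w‖ * (L / 12) * (1 + ‖w‖ * (L / 12))) + C * (2 * ℓ) * ‖w‖) →
      (F s).re ≤ (logPoly χ L s).re - 4 * (D s).re / L + (6 * H / L + (14 * C + K) * ℓ / L) := by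
  obtain ⟨K, hK, hKb⟩ := exists_norm_lseries_le
  refine ⟨K, hK, ?_⟩
  intro q _ χ F D s C H L Y ℓ hs hC hH hL hℓ hY heL hF hFs hDw hDlip
  have hL0 : 0 < L := by linarith
  have hℓ0 : 0 < ℓ := by linarith
  have hCL : 0 < C * L * ℓ := by positivity
  have hD1 : ‖D s‖ ≤ C * L * ℓ * (5 / 24) := by
    simpa using hDw 0 (by simp) (by simp) (by simp; linarith)
  set R : ℂ → ℂ := fun w => F (s + w) - F s - D s * w with hR
  have hRrect : ∀ w : ℂ, 0 ≤ w.re → w.re ≤ 1 → |w.im| ≤ Y → ‖R w‖ ≤ C * L * ℓ * ‖w‖ := by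
    intro w h0 h1 h2
    refine norm_taylor_remainder_le (fun u hu => ?_) (fun u hu => ?_)
    · obtain ⟨a, b, c, -⟩ := mem_segment_zero h0 h1 h2 hu
      exact hF u a b c
    · obtain ⟨a, b, c, -⟩ := mem_segment_zero h0 h1 h2 hu
      refine (norm_sub_le _ _).trans ?_
      linarith [hDw u a b c]
  have hRleft : ∀ v : ℝ, |v| ≤ Y → ‖R ((1 / L : ℝ) + v * I)‖ ≤
      (13 / 144 * H * L ^ 2 + 18 * C * L * ℓ) * ‖((1 / L : ℝ) + v * I : ℂ)‖ ^ 3 := by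
    intro v hv
    have hκ1 : 1 / L ≤ 1 := by
      rw [div_le_one hL0]
      linarith
    have hκ0 : 0 < 1 / L := by positivity
    have hκw := le_norm_ofReal_add_mul_I (1 / L) v
    set w : ℂ := (1 / L : ℝ) + v * I with hw
    have hwre : w.re = 1 / L := by simp [hw]
    have hwim : w.im = v := by simp [hw]
    have h0 : 0 ≤ w.re := by rw [hwre]; exact hκ0.le
    have h1 : w.re ≤ 1 := by rw [hwre]; exact hκ1
    have h2 : |w.im| ≤ Y := by rw [hwim]; exact hv
    refine norm_remainder_left_le hL hH hC hℓ0 ?_ (norm_nonneg w) (fun hw4 => ?_)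
      (hRrect w h0 h1 h2)
    · rw [div_le_iff₀ hL0] at hκw
      linarith
    · refine norm_taylor_remainder_le (fun u hu => ?_) (fun u hu => ?_)
      · obtain ⟨a, b, c, -⟩ := mem_segment_zero h0 h1 h2 hu
        exact hF u a b c
      · obtain ⟨a, b, c, d⟩ := mem_segment_zero h0 h1 h2 hu
        refine (hDlip u a (d.trans hw4)).trans ?_
        gcongr
  set Q : ℝ → ℂ := fun v =>
    LSeries (logCoeff χ) (s + (1 + v * I)) - F s - D s * (1 + v * I) with hQ
  have hQR : ∀ v : ℝ, |v| ≤ Y → Q v = R (1 + v * I) := by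
    intro v hv
    simp only [hQ, hR]
    rw [hFs v hv]
  have hser : ∀ v : ℝ, ‖LSeries (logCoeff χ) (s + (1 + v * I))‖ ≤ K := fun v =>
    hKb _ (norm_logCoeff_le χ) _ (by simp; linarith)
  have hF1 : ‖F s‖ ≤ K + C * L * ℓ + C * L * ℓ * (5 / 24) := by
    have h1 := hRrect 1 (by simp) (by simp) (by simp; linarith)
    have h2 := hser 0
    have h3 := hFs 0 (by simp; linarith)
    simp only [ofReal_zero, zero_mul, add_zero] at h2 h3
    have h4 : F s = LSeries (logCoeff χ) (s + 1) - R 1 - D s := by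
      simp only [hR]
      rw [h3]
      ring
    rw [norm_one, mul_one] at h1
    rw [h4]
    refine (norm_sub_le _ _).trans ?_
    linarith [norm_sub_le (LSeries (logCoeff χ) (s + 1)) (R 1)]
  have hQtail : ∀ v : ℝ, ‖Q v‖ ≤ (2 * K + 2 * C * L * ℓ) * ‖(1 + v * I : ℂ)‖ := by
    intro v
    have hw1 : 1 ≤ ‖(1 + v * I : ℂ)‖ := by simpa using le_norm_ofReal_add_mul_I 1 v
    have h1 : ‖Q v‖ ≤ K + (K + C * L * ℓ + C * L * ℓ * (5 / 24)) +
        C * L * ℓ * (5 / 24) * ‖(1 + v * I : ℂ)‖ := by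
      refine (norm_sub_le _ _).trans (add_le_add ((norm_sub_le _ _).trans
        (add_le_add (hser v) hF1)) ?_)
      rw [norm_mul]
      gcongr
    nlinarith
  obtain ⟨hintg, hval⟩ := perron_identity χ hs hL0 (F s) (D s) (Q := Q) (fun v => rfl)
  have hshift := norm_integral_perron_shift_le (κ := 1 / L) (L := L) (Y := Y) (R := R) (Q := Q)
    (M := 13 / 144 * H * L ^ 2 + 18 * C * L * ℓ) (B := C * L * ℓ)
    (B' := 2 * K + 2 * C * L * ℓ) (by positivity) (by rw [div_le_one hL0]; linarith) hY
    (by positivity) hCL.le (by positivity) hL0.le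
    (fun w h0 h1 h2 => by
      have hκ0 : 0 < 1 / L := by positivity
      have h3 := (hF w (by linarith) h1 h2).comp_const_add s w
      have h4 : DifferentiableAt ℂ (fun u => F (s + u)) w := h3.differentiableAt
      exact (h4.sub_const (F s)).sub (differentiableAt_id.const_mul (D s)))
    hRleft (fun w h0 h1 h2 => by
      have hκ0 : 0 < 1 / L := by positivity
      exact hRrect w (by linarith) h1 h2) hQR hQtail hintg
  rw [hval] at hshift
  set E := logPoly χ L s - F s - 4 * D s / L with hE
  have hnorm : ‖(2 * π * (L ^ 4 / 24) * E : ℂ)‖ = 2 * π * (L ^ 4 / 24) * ‖E‖ := by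
    rw [norm_mul]
    congr 1
    rw [show (2 * π * (L ^ 4 / 24) : ℂ) = ((2 * π * (L ^ 4 / 24) : ℝ) : ℂ) by push_cast; ring,
      Complex.norm_real, Real.norm_of_nonneg (by have := Real.pi_pos; positivity)]
  rw [hnorm] at hshift
  have hEb := remainder_le_of_scaled_bound hC hK hH hL hℓ rfl (E := ‖E‖) (by
    refine hshift.trans ?_
    have hpi := Real.pi_pos
    have e1 : 1 / L * L = 1 := by field_simp
    have e2 : π / (1 / L) = π * L := by field_simp
    rw [e1, e2]
    have hY4 : Real.exp L ≤ Y ^ 4 := heL.trans (pow_le_pow_right₀ hY (by norm_num))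
    refine add_le_add (add_le_add le_rfl ?_) ?_
    · rw [div_le_iff₀ (by positivity)]
      gcongr
    · rw [div_le_iff₀ (by positivity), mul_right_comm]
      gcongr)
  have hre := (abs_le.1 (Complex.abs_re_le_norm E)).1
  have hDre : (4 * D s / L : ℂ).re = 4 * (D s).re / L := by
    rw [Complex.div_ofReal_re]
    simp
  have hEre : E.re = (logPoly χ L s).re - (F s).re - 4 * (D s).re / L := by
    rw [hE, sub_re, sub_re, hDre]
  linarith

set_option maxHeartbeats 1000000 in
/-- Under GRH, `log |L(1/2+it,χ)|` is bounded above by a short smoothed Dirichlet polynomial. -/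
theorem exists_norm_LFunction_le_exp_logPoly {q : ℕ} [NeZero q] (hGRH : GRHmod q)
    (χ : DirichletCharacter ℂ q) :
    ∃ C : ℝ, 0 < C ∧ ∀ T L : ℝ, 0 < T → 48 ≤ L → 2 * L ≤ Real.log T →
      ∀ t : ℝ, T ≤ t → t ≤ 2 * T →
        ‖DirichletCharacter.LFunction χ (1 / 2 + t * I)‖ ≤
          Real.exp ((logPoly χ L (1 / 2 + t * I + (12 / L : ℝ))).re + C * Real.log T / L) := by
  obtain ⟨C, hC, hbd, hDbd⟩ := exists_logDeriv_bounds hGRH χ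
  obtain ⟨K₁, hK₁, hbranch⟩ := exists_log_branch hGRH χ
  obtain ⟨K, hK, hcore⟩ := exists_re_le_logPoly
  refine ⟨46 * C + K + K₁, by positivity, fun T L hT0 hL hLT t ht1 ht2 => ?_⟩
  set ℓ := Real.log T with hℓ
  have hL0 : 0 < L := by linarith
  have hℓ96 : 96 ≤ ℓ := by linarith
  have hT97 : 97 ≤ T := by
    have := Real.add_one_le_exp ℓ
    rw [hℓ, Real.exp_log hT0] at this
    linarith
  set r : ℝ := 12 / L with hr
  have hr0 : 0 < r := by positivity
  have hr4 : r ≤ 1 / 4 := by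
    rw [hr, div_le_iff₀ hL0]
    linarith
  have hrinv : 1 / r = L / 12 := by
    rw [hr]
    field_simp
  set S := Real.exp (ℓ / 2) with hS
  set Y := Real.exp (ℓ / 4) with hY
  have hS2 : S ^ 2 = T := by
    rw [hS, ← Real.exp_nat_mul, ← Real.exp_log hT0]
    congr 1
    push_cast
    ring
  have hY2 : Y ^ 2 = S := by
    rw [hS, hY, ← Real.exp_nat_mul]
    congr 1
    push_cast
    ring
  have hY4 : Y ^ 4 = T := by
    rw [← hS2, ← hY2]
    ring
  have hY1 : 1 ≤ Y := Real.one_le_exp (by linarith)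
  have hS9 : 49 ≤ S := by
    have := Real.add_one_le_exp (ℓ / 2)
    linarith
  have hℓS : ℓ ≤ 2 * S := by
    have := Real.add_one_le_exp (ℓ / 2)
    linarith
  have hYS : Y ≤ S := by nlinarith
  have heL : Real.exp L ≤ S := Real.exp_le_exp.2 (by linarith)
  have hrℓ : 24 ≤ r * ℓ := by
    rw [hr, div_mul_eq_mul_div, le_div_iff₀ hL0]
    linarith
  obtain ⟨H, hH, hLle, hDre, hDlip⟩ := hbd t r (by linarith) hr0 hr4
  obtain ⟨F, hF, hFser⟩ := hbranch t (by linarith)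
  set D := logDeriv (DirichletCharacter.LFunction χ) with hD
  set s₁ : ℂ := 1 / 2 + t * I + r with hs₁
  set U := Metric.ball ((1 / 2 + t / 2 : ℝ) + t * I : ℂ) (t / 2) with hU
  have hs₁re : s₁.re = 1 / 2 + r := by
    simp [hs₁]
  have hs₁im : s₁.im = t := by
    simp [hs₁]
  have hmem : ∀ w : ℂ, 0 ≤ w.re → w.re ≤ 1 → |w.im| ≤ Y → s₁ + w ∈ U := by
    intro w h0 h1 h2
    rw [hU, Metric.mem_ball, dist_eq_norm]
    have e : s₁ + w - ((1 / 2 + t / 2 : ℝ) + t * I : ℂ) =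
        ((r + w.re - t / 2 : ℝ) : ℂ) + (w.im : ℝ) * I := by
      conv_lhs => rw [← Complex.re_add_im w]
      rw [hs₁]
      push_cast
      ring
    refine lt_of_pow_lt_pow_left₀ 2 (by linarith) ?_
    rw [e, norm_ofReal_add_ofReal_mul_I_sq]
    have h3 : w.im ^ 2 ≤ S := by
      rw [← hY2, ← sq_abs]
      gcongr
    have h4 : S < r * (t - 5 / 4) := by
      have h5 : S * ℓ < r * (t - 5 / 4) * ℓ := by
        have h6 : S * ℓ ≤ S * (2 * S) := by gcongr
        have h7 : 24 * (t - 5 / 4) ≤ r * ℓ * (t - 5 / 4) := by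
          have : 0 ≤ t - 5 / 4 := by linarith
          gcongr
        nlinarith
      exact lt_of_mul_lt_mul_right h5 (by linarith)
    have h8 : r * (t - 5 / 4) ≤ (r + w.re) * (t - (r + w.re)) := by
      have : t - 5 / 4 ≤ t - (r + w.re) := by linarith
      have h9 : 0 ≤ t - 5 / 4 := by linarith
      gcongr
      linarith
    nlinarith
  have hDw : ∀ w : ℂ, 0 ≤ w.re → w.re ≤ 1 → |w.im| ≤ Y → ‖D (s₁ + w)‖ ≤ C * L * ℓ * (5 / 24) := by
    intro w h0 h1 h2
    rw [abs_le] at h2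
    have hre : (s₁ + w).re = 1 / 2 + r + w.re := by rw [add_re, hs₁re]
    have him : (s₁ + w).im = t + w.im := by rw [add_im, hs₁im]
    have hST : S * 2 ≤ T := by nlinarith
    refine (hDbd (s₁ + w) (by rw [hre]; linarith) (by rw [hre]; linarith)
      (by rw [him]; linarith)).2.trans ?_
    have h3 : Real.log (s₁ + w).im ≤ 2 * ℓ :=
      log_le_two_mul_log (by linarith) (by rw [him]; linarith) (by rw [him]; linarith)
    have h4 : 1 / ((s₁ + w).re - 1 / 2) ≤ L / 12 := by
      rw [← hrinv, hre]
      exact one_div_le_one_div_of_le hr0 (by linarith)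
    calc C * Real.log (s₁ + w).im * (1 + 1 / ((s₁ + w).re - 1 / 2))
        ≤ C * (2 * ℓ) * (L / 48 + L / 12) := by
          have : 0 ≤ 1 / ((s₁ + w).re - 1 / 2) :=
            one_div_nonneg.2 (by rw [hre]; linarith)
          gcongr
          linarith
      _ = _ := by ring
  have hCLℓ : 0 < C * L * ℓ := by
    have : 0 < ℓ := by linarith
    positivity
  have hD1 : ‖D s₁‖ ≤ C * L * ℓ * (5 / 24) := by
    simpa using hDw 0 (by simp) (by simp) (by simp; linarith)
  have hlogt : Real.log t ≤ 2 * ℓ := log_le_two_mul_log (by linarith) (by linarith) (by linarith)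
  have hre := hcore χ F D s₁ C H L Y ℓ (by rw [hs₁re]; linarith) hC hH hL (by linarith) hY1
    (by rw [hY2]; exact heL) (fun w a b c => (hF _ (hmem w a b c)).1)
    (fun v hv => by
      refine hFser _ (hmem _ (by simp) (by simp) (by simpa using hv)) ?_
      rw [add_re, hs₁re]
      simp
      linarith)
    hDw (fun w hw hw4 => by
      refine (hDlip w hw hw4).trans ?_
      rw [div_eq_mul_one_div, hrinv]
      gcongr)
  have hL1 := (hF s₁ (by simpa using hmem 0 (by simp) (by simp) (by simp; linarith))).2
  refine hLle.trans ?_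
  refine (mul_le_mul_of_nonneg_right hL1 (Real.exp_pos _).le).trans ?_
  rw [← Real.exp_add]
  refine Real.exp_le_exp.2 ?_
  have e1 : r / 2 * H = 6 * H / L := by
    rw [hr]
    ring
  have e2 : C * r * Real.log t ≤ 24 * (C * ℓ / L) := by
    calc C * r * Real.log t ≤ C * r * (2 * ℓ) := by gcongr
      _ = _ := by
        rw [hr]
        ring
  have e3 : -(4 * (D s₁).re / L) ≤ 8 * (C * ℓ / L) := by
    rw [← neg_div, div_le_iff₀ hL0]
    have : 8 * (C * ℓ / L) * L = 8 * C * ℓ := by field_simp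
    have : C * Real.log t ≤ C * (2 * ℓ) := by gcongr
    linarith
  have e4 : K₁ ≤ K₁ * (ℓ / L) := by
    refine le_mul_of_one_le_right hK₁.le ?_
    rw [one_le_div hL0]
    linarith
  have e5 : (46 * C + K + K₁) * ℓ / L =
      24 * (C * ℓ / L) + 8 * (C * ℓ / L) + (14 * C + K) * ℓ / L + K₁ * (ℓ / L) := by ring
  linarith

lemma exists_norm_logDeriv_add_le {q : ℕ} [NeZero q] (χ : DirichletCharacter ℂ q) :
    ∃ M : ℝ, 0 < M ∧ ∀ δ : ℝ, 0 < δ → δ ≤ 1 →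
      ‖logDeriv (DirichletCharacter.LFunction χ) (1 + δ : ℝ) +
        (if χ = 1 then ((1 / δ : ℝ) : ℂ) else 0)‖ ≤ M := by
  have hcont : ∃ g : ℂ → ℂ, ContinuousOn g {s | 1 ≤ s.re} ∧ ∀ s : ℂ, 1 < s.re →
      g s = -(logDeriv (DirichletCharacter.LFunction χ) s +
        (if χ = 1 then 1 / (s - 1) else 0)) := by
    by_cases hχ : χ = 1
    · subst hχ
      refine ⟨_, (DirichletCharacter.continuousOn_neg_logDeriv_LFunctionTrivChar₁ q).mono ?_, ?_⟩
      · intro s hs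
        rcases eq_or_ne s 1 with rfl | h1
        · exact Or.inl rfl
        · exact Or.inr (DirichletCharacter.LFunction_ne_zero_of_one_le_re _ (Or.inr h1) hs)
      · intro s hs
        have h1 : s ≠ 1 := by
          rintro rfl
          simp at hs
        have h2 : DirichletCharacter.LFunction (1 : DirichletCharacter ℂ q) s ≠ 0 :=
          DirichletCharacter.LFunction_ne_zero_of_one_le_re _ (Or.inr h1) hs.le
        have h3 := sub_ne_zero.2 h1
        simp only [DirichletCharacter.deriv_LFunctionTrivChar₁_apply_of_ne_one _ h1,
          DirichletCharacter.LFunctionTrivChar₁, Function.update_of_ne h1, if_true, logDeriv_apply,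
          DirichletCharacter.LFunctionTrivChar]
        field_simp
    · refine ⟨_, (DirichletCharacter.continuousOn_neg_logDeriv_LFunction_of_nontriv hχ).mono ?_, ?_⟩
      · intro s hs
        exact DirichletCharacter.LFunction_ne_zero_of_one_le_re _ (Or.inl hχ) hs
      · intro s hs
        simp [hχ, logDeriv_apply, neg_div]
  obtain ⟨g, hg, hgeq⟩ := hcont
  have hg1 : ContinuousOn (fun δ : ℝ => g (1 + δ : ℝ)) (Set.Icc 0 1) := by
    refine hg.comp (by fun_prop) fun δ hδ => ?_
    simpa using hδ.1
  obtain ⟨M, hM⟩ := isCompact_Icc.exists_bound_of_continuousOn hg1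
  refine ⟨|M| + 1, by positivity, fun δ h0 h1 => ?_⟩
  have h2 := hM δ ⟨h0.le, h1⟩
  rw [hgeq _ (by simpa using h0), norm_neg] at h2
  have h3 : (((1 + δ : ℝ) : ℂ) - 1) = (δ : ℂ) := by
    push_cast
    ring
  rw [h3] at h2
  push_cast at h2 ⊢
  linarith [le_abs_self M]

lemma exists_norm_lseries_logCoeff_sub_le {q : ℕ} [NeZero q] (χ : DirichletCharacter ℂ q) :
    ∃ M : ℝ, 0 < M ∧ ∀ δ : ℝ, 0 < δ → δ ≤ 1 →
      ‖LSeries (logCoeff χ) (1 + δ : ℝ) +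
        (if χ = 1 then (Real.log δ : ℂ) else 0)‖ ≤ M := by
  obtain ⟨M, hM, hMb⟩ := exists_norm_logDeriv_add_le χ
  set h : ℝ → ℂ := fun δ => LSeries (logCoeff χ) (1 + δ : ℝ) +
        (if χ = 1 then (Real.log δ : ℂ) else 0) with hh
  have hder : ∀ δ : ℝ, 0 < δ → HasDerivAt h (logDeriv (DirichletCharacter.LFunction χ) (1 + δ : ℝ) +
        (if χ = 1 then ((1 / δ : ℝ) : ℂ) else 0)) δ := by
    intro δ hδ
    have e1 := hasDerivAt_lseries_logCoeff χ (s := ((1 + δ : ℝ) : ℂ)) (by simpa using hδ)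
    have e2 : HasDerivAt (fun δ : ℝ => ((1 + δ : ℝ) : ℂ)) ((1 : ℝ) : ℂ) δ :=
      ((hasDerivAt_id δ).const_add 1).ofReal_comp
    have e3 := HasDerivAt.comp (𝕜 := ℝ) (𝕜' := ℂ) δ e1 e2
    rw [ofReal_one, mul_one] at e3
    refine HasDerivAt.add e3 ?_
    split_ifs
    · simpa using (Real.hasDerivAt_log hδ.ne').ofReal_comp
    · exact hasDerivAt_const _ _
  refine ⟨M + ‖h 1‖, by positivity, fun δ h0 h1 => ?_⟩
  have hb := (convex_Ioc (0 : ℝ) 1).norm_image_sub_le_of_norm_hasDerivWithin_le (f := h)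
    (fun x hx => (hder x hx.1).hasDerivWithinAt) (fun x hx => hMb x hx.1 hx.2)
    (Set.right_mem_Ioc.2 one_pos) (⟨h0, h1⟩ : δ ∈ Set.Ioc (0 : ℝ) 1)
  have h3 : ‖δ - 1‖ ≤ 1 := by
    rw [Real.norm_eq_abs, abs_le]
    constructor <;> linarith
  calc ‖h δ‖ = ‖h δ - h 1 + h 1‖ := by rw [sub_add_cancel]
    _ ≤ ‖h δ - h 1‖ + ‖h 1‖ := norm_add_le _ _
    _ ≤ M * 1 + ‖h 1‖ := by
        gcongr
        exact hb.trans (by gcongr)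
    _ = _ := by ring

/-- The value at `n` of the linear combination `∑ a_χ χ` of characters. -/
noncomputable def charSum {q : ℕ} (a : DirichletCharacter ℂ q → ℕ) (n : ℕ) : ℂ :=
  ∑ χ : DirichletCharacter ℂ q, (a χ : ℂ) * χ n

lemma norm_charSum_le {q : ℕ} (a : DirichletCharacter ℂ q → ℕ) (n : ℕ) :
    ‖charSum a n‖ ≤ ∑ χ, a χ := by
  push_cast
  refine norm_sum_le_of_le _ fun χ _ => ?_
  rw [norm_mul, Complex.norm_natCast]
  exact mul_le_of_le_one_right (Nat.cast_nonneg _) (χ.norm_le_one _)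

lemma normSq_charSum {q : ℕ} (a : DirichletCharacter ℂ q → ℕ) (n : ℕ) :
    ((‖charSum a n‖ ^ 2 : ℝ) : ℂ) =
      ∑ χ : DirichletCharacter ℂ q, ∑ ψ : DirichletCharacter ℂ q,
        ((a χ * a ψ : ℕ) : ℂ) * (χ * ψ⁻¹) n := by
  rw [ofReal_pow, ← Complex.mul_conj', charSum, map_sum, Finset.sum_mul_sum]
  refine Finset.sum_congr rfl fun χ _ => Finset.sum_congr rfl fun ψ _ => ?_
  rw [map_mul, Complex.conj_natCast, MulChar.mul_apply, ← MulChar.star_apply', RCLike.star_def]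
  push_cast
  ring

lemma sum_primes_le_tsum {L δ : ℝ} (f : ℕ → ℝ) (hf : ∀ n, 0 ≤ f n) (hδ : 0 ≤ δ) {V : ℝ}
    (hV : HasSum (fun n : ℕ => f n * (n : ℝ) ^ (-(1 + δ))) V) :
    ∑ p ∈ (Ioc 0 ⌊Real.exp L⌋₊).filter Nat.Prime, f p / p ≤ Real.exp (δ * L) * V := by
  have h1 : ∀ n : ℕ, 0 ≤ f n * (n : ℝ) ^ (-(1 + δ)) := fun n =>
    mul_nonneg (hf n) (Real.rpow_nonneg (Nat.cast_nonneg n) _)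
  have h2 := sum_le_hasSum ((Ioc 0 ⌊Real.exp L⌋₊).filter Nat.Prime) (fun n _ => h1 n) hV
  refine le_trans ?_ (mul_le_mul_of_nonneg_left h2 (Real.exp_pos _).le)
  rw [Finset.mul_sum]
  refine Finset.sum_le_sum fun p hp => ?_
  simp only [Finset.mem_filter, Finset.mem_Ioc] at hp
  have hp0 : (0 : ℝ) < p := by exact_mod_cast hp.1.1
  have hpL : Real.log p ≤ L := by
    rw [Real.log_le_iff_le_exp hp0]
    exact (Nat.le_floor_iff (Real.exp_pos _).le).1 hp.1.2
  have h3 : (p : ℝ) ^ (-(1 + δ)) = (p : ℝ)⁻¹ * Real.exp (-(δ * Real.log p)) := by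
    rw [Real.rpow_def_of_pos hp0, ← Real.exp_log (inv_pos.2 hp0), ← Real.exp_add, Real.log_inv]
    congr 1
    ring
  rw [h3, div_eq_mul_inv]
  calc f p * (p : ℝ)⁻¹ = f p * (p : ℝ)⁻¹ * 1 := by ring
    _ ≤ f p * (p : ℝ)⁻¹ * Real.exp (δ * L - δ * Real.log p) := by
        have := hf p
        gcongr
        refine Real.one_le_exp ?_
        rw [← mul_sub]
        exact mul_nonneg hδ (by linarith)
    _ = _ := by
        rw [sub_eq_add_neg, Real.exp_add]
        ring

lemma term_logCoeff_one_add {q : ℕ} (χ : DirichletCharacter ℂ q) (δ : ℝ) (n : ℕ) :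
    LSeries.term (logCoeff χ) (1 + δ : ℝ) n =
      ((Λ n / Real.log n * (n : ℝ) ^ (-(1 + δ)) : ℝ) : ℂ) * χ n := by
  rcases eq_or_ne n 0 with rfl | hn
  · simp
  · rw [LSeries.term_of_ne_zero hn, logCoeff, Real.rpow_neg (Nat.cast_nonneg n), ofReal_mul,
      ofReal_inv, Complex.ofReal_cpow (Nat.cast_nonneg n)]
    push_cast
    ring

lemma sum_normSq_charSum_le {q : ℕ} [NeZero q] (a : DirichletCharacter ℂ q → ℕ) :
    ∃ C : ℝ, 0 < C ∧ ∀ L δ : ℝ, 0 < δ → δ ≤ 1 →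
      ∑ p ∈ (Ioc 0 ⌊Real.exp L⌋₊).filter Nat.Prime, ‖charSum a p‖ ^ 2 / p ≤
        Real.exp (δ * L) * ((∑ χ, a χ ^ 2 : ℕ) * Real.log (1 / δ) + C) := by
  choose M hM hMb using fun χ : DirichletCharacter ℂ q => exists_norm_lseries_logCoeff_sub_le χ
  refine ⟨1 + ∑ χ : DirichletCharacter ℂ q, ∑ ψ : DirichletCharacter ℂ q,
    (a χ * a ψ : ℕ) * M (χ * ψ⁻¹), ?_, fun L δ h0 h1 => ?_⟩
  · have : 0 ≤ ∑ χ : DirichletCharacter ℂ q, ∑ ψ : DirichletCharacter ℂ q,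
      (a χ * a ψ : ℕ) * M (χ * ψ⁻¹) :=
      Finset.sum_nonneg fun χ _ => Finset.sum_nonneg fun ψ _ =>
        mul_nonneg (Nat.cast_nonneg _) (hM _).le
    linarith
  have hsum : HasSum (fun n : ℕ => ((Λ n / Real.log n * ‖charSum a n‖ ^ 2 *
      (n : ℝ) ^ (-(1 + δ)) : ℝ) : ℂ))
      (∑ χ : DirichletCharacter ℂ q, ∑ ψ : DirichletCharacter ℂ q,
        ((a χ * a ψ : ℕ) : ℂ) * LSeries (logCoeff (χ * ψ⁻¹)) (1 + δ : ℝ)) := by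
    have : (fun n : ℕ => ((Λ n / Real.log n * ‖charSum a n‖ ^ 2 *
        (n : ℝ) ^ (-(1 + δ)) : ℝ) : ℂ)) = fun n : ℕ => ∑ χ : DirichletCharacter ℂ q,
        ∑ ψ : DirichletCharacter ℂ q,
        ((a χ * a ψ : ℕ) : ℂ) * LSeries.term (logCoeff (χ * ψ⁻¹)) (1 + δ : ℝ) n := by
      funext n
      rw [mul_right_comm, ofReal_mul, normSq_charSum, Finset.mul_sum]
      refine Finset.sum_congr rfl fun χ _ => ?_
      rw [Finset.mul_sum]
      refine Finset.sum_congr rfl fun ψ _ => ?_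
      rw [term_logCoeff_one_add]
      ring
    rw [this]
    refine hasSum_sum fun χ _ => hasSum_sum fun ψ _ => HasSum.mul_left _ ?_
    exact (lseriesSummable_logCoeff (χ * ψ⁻¹) (by simpa using h0)).hasSum
  have hre := Complex.hasSum_re hsum
  simp only [ofReal_re] at hre
  have h2 := sum_primes_le_tsum (L := L) (fun n => Λ n / Real.log n * ‖charSum a n‖ ^ 2)
    (fun n => mul_nonneg (div_nonneg ArithmeticFunction.vonMangoldt_nonneg
      (Real.log_natCast_nonneg n)) (sq_nonneg _)) h0.le hre
  have h3 : ∑ p ∈ (Ioc 0 ⌊Real.exp L⌋₊).filter Nat.Prime, ‖charSum a p‖ ^ 2 / p =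
      ∑ p ∈ (Ioc 0 ⌊Real.exp L⌋₊).filter Nat.Prime,
        Λ p / Real.log p * ‖charSum a p‖ ^ 2 / p := by
    refine Finset.sum_congr rfl fun p hp => ?_
    have hp1 := (Finset.mem_filter.1 hp).2
    rw [ArithmeticFunction.vonMangoldt_apply_prime hp1, div_self, one_mul]
    exact (Real.log_pos (by exact_mod_cast hp1.one_lt)).ne'
  rw [h3]
  refine h2.trans ?_
  gcongr
  rw [Complex.re_sum]
  have h4 : ∀ χ ψ : DirichletCharacter ℂ q,
      (((a χ * a ψ : ℕ) : ℂ) * LSeries (logCoeff (χ * ψ⁻¹)) (1 + δ : ℝ)).re ≤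
        (if χ = ψ then (a χ ^ 2 : ℕ) * Real.log (1 / δ) else 0) +
          (a χ * a ψ : ℕ) * M (χ * ψ⁻¹) := by
    intro χ ψ
    rw [← ofReal_natCast, Complex.re_ofReal_mul]
    have h5 := (Complex.re_le_norm _).trans (hMb (χ * ψ⁻¹) δ h0 h1)
    have h6 : (LSeries (logCoeff (χ * ψ⁻¹)) (1 + δ : ℝ)).re ≤
        (if χ = ψ then Real.log (1 / δ) else 0) + M (χ * ψ⁻¹) := by
      rw [add_re] at h5
      by_cases h : χ = ψ
      · subst h
        simp only [mul_inv_cancel, if_true, ofReal_re, one_div, Real.log_inv] at h5 ⊢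
        linarith
      · have h' : χ * ψ⁻¹ ≠ 1 := fun h7 => h (mul_inv_eq_one.1 h7)
        simp only [h, h', if_false, zero_re] at h5 ⊢
        linarith
    refine (mul_le_mul_of_nonneg_left h6 (Nat.cast_nonneg _)).trans (le_of_eq ?_)
    split_ifs with h
    · subst h
      push_cast
      ring
    · ring
  calc _ ≤ ∑ χ : DirichletCharacter ℂ q, ∑ ψ : DirichletCharacter ℂ q,
        ((if χ = ψ then (a χ ^ 2 : ℕ) * Real.log (1 / δ) else 0) +
          (a χ * a ψ : ℕ) * M (χ * ψ⁻¹)) := by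
        refine Finset.sum_le_sum fun χ _ => ?_
        rw [Complex.re_sum]
        exact Finset.sum_le_sum fun ψ _ => h4 χ ψ
    _ = (∑ χ, a χ ^ 2 : ℕ) * Real.log (1 / δ) + ∑ χ : DirichletCharacter ℂ q,
          ∑ ψ : DirichletCharacter ℂ q, (a χ * a ψ : ℕ) * M (χ * ψ⁻¹) := by
        simp only [Finset.sum_add_distrib, Finset.sum_ite_eq, Finset.mem_univ, if_true]
        rw [← Finset.sum_mul]
        push_cast
        rfl
    _ ≤ _ := by linarith

/-- The variance bound for the prime sums attached to `∏ L(s,χ)^{a_χ}`. -/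
theorem exists_sum_normSq_charSum_le {q : ℕ} [NeZero q] (a : DirichletCharacter ℂ q → ℕ)
    {ε : ℝ} (hε : 0 < ε) :
    ∃ C : ℝ, 0 < C ∧ ∀ L : ℝ, 1 ≤ L →
      ∑ p ∈ (Ioc 0 ⌊Real.exp L⌋₊).filter Nat.Prime, ‖charSum a p‖ ^ 2 / p ≤
        ((∑ χ, a χ ^ 2 : ℕ) + ε) * Real.log L + C := by
  obtain ⟨C, hC, hb⟩ := sum_normSq_charSum_le a
  set S : ℝ := ((∑ χ, a χ ^ 2 : ℕ) : ℝ) with hS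
  have hS0 : 0 ≤ S := Nat.cast_nonneg _
  set η := min 1 (Real.log (1 + ε / (S + 1))) with hη
  have hη0 : 0 < η := lt_min one_pos (Real.log_pos (by
    have : 0 < ε / (S + 1) := by positivity
    linarith))
  have heη : Real.exp η ≤ 1 + ε / (S + 1) := by
    rw [← Real.le_log_iff_exp_le (by positivity)]
    exact min_le_right _ _
  have heS : Real.exp η * S ≤ S + ε := by
    refine (mul_le_mul_of_nonneg_right heη hS0).trans ?_
    have : ε / (S + 1) * S ≤ ε := by
      rw [div_mul_eq_mul_div, div_le_iff₀ (by positivity)]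
      nlinarith
    linarith
  have hlη : 0 ≤ Real.log (1 / η) := by
    refine Real.log_nonneg ?_
    rw [le_div_iff₀ hη0, one_mul]
    exact min_le_left _ _
  refine ⟨Real.exp η * (S * Real.log (1 / η) + C), by positivity, fun L hL => ?_⟩
  have hL0 : 0 < L := by linarith
  refine (hb L (η / L) (by positivity) ?_).trans ?_
  · rw [div_le_one hL0]
    exact (min_le_left _ _).trans hL
  · rw [div_mul_cancel₀ _ hL0.ne', one_div_div, Real.log_div hL0.ne' hη0.ne']
    have h1 : 0 ≤ Real.log L := Real.log_nonneg hL
    rw [one_div, Real.log_inv]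
    nlinarith

/-- The primes up to `exp L`. -/
noncomputable def expPrimes (L : ℝ) : Finset ℕ := (Ioc 0 ⌊Real.exp L⌋₊).filter Nat.Prime

lemma mem_expPrimes {L : ℝ} {p : ℕ} : p ∈ expPrimes L ↔ p.Prime ∧ (p : ℝ) ≤ Real.exp L := by
  rw [expPrimes, Finset.mem_filter, Finset.mem_Ioc, Nat.le_floor_iff (Real.exp_pos _).le]
  exact ⟨fun h => ⟨h.2, h.1.2⟩, fun h => ⟨⟨h.1.pos, h.2⟩, h.1⟩⟩

lemma exists_sum_log_div_le :
    ∃ C : ℝ, 0 < C ∧ ∀ L : ℝ, 1 ≤ L → ∑ p ∈ expPrimes L, Real.log p / p ≤ C * L := by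
  obtain ⟨M, hM, hMb⟩ := exists_norm_logDeriv_add_le (1 : DirichletCharacter ℂ 1)
  refine ⟨Real.exp 1 * (1 + M), by positivity, fun L hL => ?_⟩
  have hL0 : 0 < L := by linarith
  have hδ0 : 0 < 1 / L := by positivity
  have hs : 1 < (((1 + 1 / L : ℝ) : ℂ)).re := by
    rw [ofReal_re]
    linarith
  have hsum := (ArithmeticFunction.LSeriesSummable_vonMangoldt hs).hasSum
  rw [← LSeries] at hsum
  rw [ArithmeticFunction.LSeries_vonMangoldt_eq_deriv_riemannZeta_div hs,
    ← DirichletCharacter.LFunction_modOne_eq (χ := 1), neg_div, ← logDeriv_apply] at hsum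
  have hterm : LSeries.term (fun n => (Λ n : ℂ)) ((1 + 1 / L : ℝ) : ℂ) =
      fun n : ℕ => ((Λ n * (n : ℝ) ^ (-(1 + 1 / L)) : ℝ) : ℂ) := by
    funext n
    rcases eq_or_ne n 0 with rfl | hn
    · simp
    · rw [LSeries.term_of_ne_zero hn, Real.rpow_neg (Nat.cast_nonneg n), ofReal_mul,
        ofReal_inv, Complex.ofReal_cpow (Nat.cast_nonneg n)]
      push_cast
      ring
  rw [hterm] at hsum
  have hre := Complex.hasSum_re hsum
  simp only [ofReal_re] at hre
  have h2 := sum_primes_le_tsum (L := L) (fun n => Λ n)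
    (fun n => ArithmeticFunction.vonMangoldt_nonneg) hδ0.le hre
  have h3 : ∑ p ∈ expPrimes L, Real.log p / p =
      ∑ p ∈ (Ioc 0 ⌊Real.exp L⌋₊).filter Nat.Prime, Λ p / p := by
    refine Finset.sum_congr rfl fun p hp => ?_
    rw [ArithmeticFunction.vonMangoldt_apply_prime (mem_expPrimes.1 hp).1]
  rw [h3]
  refine h2.trans ?_
  rw [one_div_mul_cancel hL0.ne', mul_assoc]
  gcongr
  have h4 := (Complex.abs_re_le_norm _).trans (hMb (1 / L) hδ0 (by rw [div_le_one hL0]; exact hL))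
  rw [if_pos rfl, add_re, ofReal_re, one_div_one_div] at h4
  rw [neg_re]
  have := (abs_le.1 h4).1
  nlinarith

lemma exists_sum_inv_le :
    ∃ C : ℝ, 0 < C ∧ ∀ L : ℝ, 1 ≤ L → ∑ p ∈ expPrimes L, (1 : ℝ) / p ≤ 2 * Real.log L + C := by
  obtain ⟨C, hC, hb⟩ := exists_sum_normSq_charSum_le
    (fun _ : DirichletCharacter ℂ 1 => 1) one_pos
  refine ⟨C, hC, fun L hL => ?_⟩
  have h1 : ∀ n : ℕ, charSum (fun _ : DirichletCharacter ℂ 1 => 1) n = 1 := by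
    intro n
    rw [charSum, Fintype.sum_unique]
    have : (default : DirichletCharacter ℂ 1) = 1 := Subsingleton.elim _ _
    rw [this]
    have h2 : (n : ZMod 1) = 1 := Subsingleton.elim _ _
    simp [h2]
  have h2 := hb L hL
  have h3 : Fintype.card (DirichletCharacter ℂ 1) = 1 := Fintype.card_unique
  simp only [h1, norm_one, one_pow, Finset.sum_const, Finset.card_univ, smul_eq_mul, mul_one,
    h3, Nat.cast_one] at h2
  norm_num at h2 ⊢
  exact h2

lemma sum_inv_sdiff_le {C : ℝ} (hC : ∀ L : ℝ, 1 ≤ L → ∑ p ∈ expPrimes L, Real.log p / p ≤ C * L)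
    {L L' : ℝ} (hL : 1 ≤ L) (hL' : 0 < L') :
    ∑ p ∈ expPrimes L \ expPrimes L', (1 : ℝ) / p ≤ C * L / L' := by
  rw [le_div_iff₀ hL', Finset.sum_mul]
  refine le_trans ?_ (hC L hL)
  refine (Finset.sum_le_sum fun p hp => ?_).trans (Finset.sum_le_sum_of_subset_of_nonneg
    (f := fun p : ℕ => Real.log p / p) Finset.sdiff_subset fun p _ _ =>
      div_nonneg (Real.log_natCast_nonneg p) (Nat.cast_nonneg p))
  rw [Finset.mem_sdiff, mem_expPrimes, mem_expPrimes] at hp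
  have hp0 : (0 : ℝ) < p := by exact_mod_cast hp.1.1.pos
  have h1 : L' ≤ Real.log p := by
    rw [Real.le_log_iff_exp_le hp0]
    by_contra h
    exact hp.2 ⟨hp.1.1, (not_le.1 h).le⟩
  rw [one_div_mul_eq_div]
  gcongr

/-- The Dirichlet polynomial `∑ b_p p^{-ix}`. -/
noncomputable def dirPoly (S : Finset ℕ) (b : ℕ → ℂ) (x : ℝ) : ℂ :=
  ∑ p ∈ S, b p * cexp (-(x * Real.log p : ℝ) * I)

/-- The absolute values of the coefficients in `logPoly`. -/
noncomputable def smoothWeight (L : ℝ) (n : ℕ) : ℝ :=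
  Λ n / Real.log n * (n : ℝ) ^ (-(1 / 2 + 12 / L)) * (1 - Real.log n / L) ^ 4

lemma smoothWeight_nonneg (L : ℝ) (n : ℕ) : 0 ≤ smoothWeight L n :=
  mul_nonneg (mul_nonneg (div_nonneg ArithmeticFunction.vonMangoldt_nonneg
    (Real.log_natCast_nonneg n)) (Real.rpow_nonneg (Nat.cast_nonneg n) _)) (by positivity)

lemma smoothWeight_le {L : ℝ} (hL : 0 < L) {n : ℕ} (hn : 1 ≤ n) (hnL : (n : ℝ) ≤ Real.exp L) :
    smoothWeight L n ≤ (n : ℝ) ^ (-(1 / 2) : ℝ) := by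
  have hn0 : (0 : ℝ) < n := by exact_mod_cast hn
  have hn1 : (1 : ℝ) ≤ n := by exact_mod_cast hn
  have h1 : Λ n / Real.log n ≤ 1 :=
    div_le_one_of_le₀ ArithmeticFunction.vonMangoldt_le_log (Real.log_natCast_nonneg n)
  have h2 : (n : ℝ) ^ (-(1 / 2 + 12 / L)) ≤ (n : ℝ) ^ (-(1 / 2) : ℝ) := by
    refine Real.rpow_le_rpow_of_exponent_le hn1 ?_
    have : 0 ≤ 12 / L := by positivity
    linarith
  have h3 : (1 - Real.log n / L) ^ 4 ≤ 1 := by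
    have h4 : Real.log n ≤ L := (Real.log_le_iff_le_exp hn0).2 hnL
    have h5 : Real.log n / L ≤ 1 := by rwa [div_le_one hL]
    have h6 : 0 ≤ Real.log n / L := div_nonneg (Real.log_natCast_nonneg n) hL.le
    exact pow_le_one₀ (by linarith) (by linarith)
  have h7 := Real.rpow_nonneg hn0.le (-(1 / 2) : ℝ)
  calc _ ≤ 1 * (n : ℝ) ^ (-(1 / 2) : ℝ) * 1 := by
        rw [smoothWeight]
        gcongr
    _ = _ := by ring

lemma natCast_cpow_inv {n : ℕ} (hn : n ≠ 0) (σ t : ℝ) :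
    1 / (n : ℂ) ^ ((σ : ℂ) + t * I) =
      (((n : ℝ) ^ (-σ) : ℝ) : ℂ) * cexp (-(t * Real.log n : ℝ) * I) := by
  have hn0 : (n : ℂ) ≠ 0 := by exact_mod_cast hn
  rw [one_div, ← Complex.cpow_neg, neg_add, Complex.cpow_add _ _ hn0,
    Complex.ofReal_cpow (Nat.cast_nonneg n), Complex.cpow_def_of_ne_zero hn0 (-(t * I)),
    ← Complex.natCast_log]
  push_cast
  congr 2
  ring

lemma sum_logPoly_eq {q : ℕ} (a : DirichletCharacter ℂ q → ℕ) (L t : ℝ) :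
    ∑ χ, (a χ : ℂ) * logPoly χ L (1 / 2 + t * I + (12 / L : ℝ)) =
      ∑ n ∈ Ioc 0 ⌊Real.exp L⌋₊ with IsPrimePow n,
        charSum a n * smoothWeight L n * cexp (-(t * Real.log n : ℝ) * I) := by
  have hs : (1 / 2 + t * I + (12 / L : ℝ) : ℂ) = ((1 / 2 + 12 / L : ℝ) : ℂ) + t * I := by
    push_cast
    ring
  rw [Finset.sum_filter_of_ne]
  · simp only [logPoly, Finset.mul_sum]
    rw [Finset.sum_comm]
    have : Icc 1 ⌊Real.exp L⌋₊ = Ioc 0 ⌊Real.exp L⌋₊ := by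
      ext n
      simp [Nat.one_le_iff_ne_zero, Nat.pos_iff_ne_zero]
    rw [this]
    refine Finset.sum_congr rfl fun n hn => ?_
    have hn0 : n ≠ 0 := (Finset.mem_Ioc.1 hn).1.ne'
    rw [charSum, Finset.sum_mul, Finset.sum_mul]
    refine Finset.sum_congr rfl fun χ _ => ?_
    rw [hs, div_eq_mul_one_div, natCast_cpow_inv hn0, smoothWeight, logCoeff]
    push_cast
    ring
  · intro n _ h
    by_contra h1
    exact h (by simp [smoothWeight, ArithmeticFunction.vonMangoldt_eq_zero_iff.2 h1])

lemma exists_sum_higher_powers_le : ∃ V : ℝ, 0 < V ∧ ∀ (N : ℕ) (S : ℕ → Finset ℕ),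
    (∀ k, ∀ p ∈ S k, Nat.Prime p) →
      ∑ k ∈ Icc 3 N, ∑ p ∈ S k, ((p ^ k : ℕ) : ℝ) ^ (-(1 / 2) : ℝ) ≤ V := by
  have hr0 : (0 : ℝ) ≤ 2 ^ (-(1 / 2) : ℝ) := by positivity
  have hr1 : (2 : ℝ) ^ (-(1 / 2) : ℝ) < 1 :=
    Real.rpow_lt_one_of_one_lt_of_neg (by norm_num) (by norm_num)
  have hu := summable_geometric_of_lt_one hr0 hr1
  have hv : Summable fun n : ℕ => ((n : ℝ) ^ (-(1 / 2) : ℝ)) ^ 3 := by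
    refine (Real.summable_nat_rpow.2 (show (-(3 / 2) : ℝ) < -1 by norm_num)).congr fun n => ?_
    rw [← Real.rpow_natCast, ← Real.rpow_mul (Nat.cast_nonneg n)]
    norm_num
  set U := ∑' j : ℕ, ((2 : ℝ) ^ (-(1 / 2) : ℝ)) ^ j with hU
  set V := ∑' n : ℕ, ((n : ℝ) ^ (-(1 / 2) : ℝ)) ^ 3 with hV
  have hU0 : 0 ≤ U := tsum_nonneg fun j => by positivity
  have hV0 : 0 ≤ V := tsum_nonneg fun j => by positivity
  refine ⟨U * V + 1, by positivity, fun N S hS => ?_⟩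
  have h1 : ∀ k ∈ Icc 3 N, ∑ p ∈ S k, ((p ^ k : ℕ) : ℝ) ^ (-(1 / 2) : ℝ) ≤
      ((2 : ℝ) ^ (-(1 / 2) : ℝ)) ^ (k - 3) * V := by
    intro k hk
    refine le_trans ?_ (mul_le_mul_of_nonneg_left
      (hv.sum_le_tsum (S k) fun n _ => by positivity) (by positivity))
    rw [Finset.mul_sum]
    refine Finset.sum_le_sum fun p hp => ?_
    have hp2 : (2 : ℝ) ≤ p := by exact_mod_cast (hS k p hp).two_le
    have hk3 : k = (k - 3) + 3 := by
      have := (Finset.mem_Icc.1 hk).1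
      omega
    push_cast
    rw [← Real.rpow_pow_comm (Nat.cast_nonneg p)]
    conv_lhs => rw [hk3, pow_add]
    gcongr ?_ ^ (k - 3) * _
    exact Real.rpow_le_rpow_of_nonpos (by norm_num) hp2 (by norm_num)
  refine (Finset.sum_le_sum h1).trans ?_
  rw [← Finset.sum_mul]
  have h2 : ∑ k ∈ Icc 3 N, ((2 : ℝ) ^ (-(1 / 2) : ℝ)) ^ (k - 3) ≤ U := by
    rw [← Finset.sum_image (f := fun j => ((2 : ℝ) ^ (-(1 / 2) : ℝ)) ^ j)
      (g := fun k => k - 3) (s := Icc 3 N)]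
    · exact hu.sum_le_tsum _ fun n _ => by positivity
    · intro i hi j hj h
      simp only [Finset.coe_Icc, Set.mem_Icc] at hi hj h
      omega
  nlinarith

/-- The sum of `logPoly` splits into sums over primes and squares of primes up to `O(1)`. -/
theorem exists_re_sum_logPoly_le {q : ℕ} (a : DirichletCharacter ℂ q → ℕ) :
    ∃ C : ℝ, 0 < C ∧ ∀ L : ℝ, 0 < L → ∃ c d : ℕ → ℂ,
      (∀ p ∈ expPrimes L, ‖c p‖ ^ 2 ≤ ‖charSum a p‖ ^ 2 / p) ∧
      (∀ p ∈ expPrimes L, ‖d p‖ ≤ (∑ χ, a χ : ℕ) / p) ∧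
      ∀ t : ℝ, (∑ χ, (a χ : ℂ) * logPoly χ L (1 / 2 + t * I + (12 / L : ℝ))).re ≤
        (dirPoly (expPrimes L) c t).re + (dirPoly (expPrimes L) d (2 * t)).re + C := by
  obtain ⟨V, hV, hVb⟩ := exists_sum_higher_powers_le
  set m : ℝ := ((∑ χ, a χ : ℕ) : ℝ) with hm
  have hm0 : 0 ≤ m := Nat.cast_nonneg _
  refine ⟨m * V + 1, by positivity, fun L hL => ?_⟩
  set x := Real.exp L with hx
  have hx0 : 0 < x := Real.exp_pos L
  have hx1 : 1 ≤ x := Real.one_le_exp hL.le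
  set S : ℕ → Finset ℕ := fun k => (Ioc 0 ⌊x ^ ((1 : ℝ) / k)⌋₊).filter Nat.Prime with hS
  have hSmem : ∀ k : ℕ, 1 ≤ k → ∀ p ∈ S k, p.Prime ∧ ((p ^ k : ℕ) : ℝ) ≤ x := by
    intro k hk p hp
    simp only [hS, Finset.mem_filter, Finset.mem_Ioc] at hp
    refine ⟨hp.2, ?_⟩
    have h1 := (Nat.le_floor_iff (by positivity)).1 hp.1.2
    have h2 : ((p : ℝ)) ^ k ≤ (x ^ ((1 : ℝ) / k)) ^ k := by gcongr
    rw [← Real.rpow_natCast (x ^ _), ← Real.rpow_mul hx0.le, one_div_mul_cancel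
      (by positivity), Real.rpow_one] at h2
    exact_mod_cast h2
  have hS1 : S 1 = expPrimes L := by
    simp [hS, expPrimes, ← hx]
  have hS2 : S 2 ⊆ expPrimes L := by
    intro p hp
    obtain ⟨h1, h2⟩ := hSmem 2 (by norm_num) p hp
    refine mem_expPrimes.2 ⟨h1, le_trans ?_ h2⟩
    exact_mod_cast Nat.le_self_pow (by norm_num) p
  have hκ : ∀ k : ℕ, 1 ≤ k → ∀ p ∈ S k,
      smoothWeight L (p ^ k) ≤ ((p ^ k : ℕ) : ℝ) ^ (-(1 / 2) : ℝ) := by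
    intro k hk p hp
    obtain ⟨h1, h2⟩ := hSmem k hk p hp
    exact smoothWeight_le hL (Nat.one_le_pow _ _ h1.pos) h2
  refine ⟨fun p => charSum a p * smoothWeight L p,
    fun p => if p ∈ S 2 then charSum a (p ^ 2) * smoothWeight L (p ^ 2) else 0, ?_, ?_, ?_⟩
  · intro p hp
    have h1 := hκ 1 le_rfl p (by rwa [hS1])
    rw [pow_one] at h1
    rw [norm_mul, Complex.norm_real, Real.norm_of_nonneg (smoothWeight_nonneg _ _), mul_pow,
      div_eq_mul_inv]
    gcongr
    calc smoothWeight L p ^ 2 ≤ ((p : ℝ) ^ (-(1 / 2) : ℝ)) ^ 2 := by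
          gcongr
          exact smoothWeight_nonneg _ _
      _ = _ := by
          rw [← Real.rpow_natCast, ← Real.rpow_mul (Nat.cast_nonneg p)]
          norm_num [Real.rpow_neg_one]
  · intro p hp
    dsimp only
    split_ifs with h
    · have h1 := hκ 2 (by norm_num) p h
      rw [norm_mul, Complex.norm_real, Real.norm_of_nonneg (smoothWeight_nonneg _ _),
        div_eq_mul_inv]
      refine mul_le_mul (norm_charSum_le a _) (h1.trans (le_of_eq ?_)) (smoothWeight_nonneg _ _) hm0
      push_cast
      rw [← Real.rpow_natCast, ← Real.rpow_mul (Nat.cast_nonneg p)]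
      norm_num [Real.rpow_neg_one]
    · rw [norm_zero]
      positivity
  · intro t
    set g : ℕ → ℂ := fun n =>
      charSum a n * smoothWeight L n * cexp (-(t * Real.log n : ℝ) * I) with hg
    set N := max 2 ⌊Real.log x / Real.log 2⌋₊ with hN
    have hgn : ∀ k : ℕ, 1 ≤ k → ∀ p ∈ S k, ‖g (p ^ k)‖ ≤ m * ((p ^ k : ℕ) : ℝ) ^ (-(1 / 2) : ℝ) := by
      intro k hk p hp
      have h1 : ‖cexp (-(t * Real.log (p ^ k : ℕ) : ℝ) * I)‖ = 1 := by
        rw [← ofReal_neg, Complex.norm_exp_ofReal_mul_I]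
      rw [hg]
      simp only
      rw [norm_mul, norm_mul, h1, mul_one, Complex.norm_real,
        Real.norm_of_nonneg (smoothWeight_nonneg _ _)]
      exact mul_le_mul (norm_charSum_le a _) (hκ k hk p hp) (smoothWeight_nonneg _ _) hm0
    have h1 : ∑ χ, (a χ : ℂ) * logPoly χ L (1 / 2 + t * I + (12 / L : ℝ)) =
        dirPoly (expPrimes L) (fun p => charSum a p * smoothWeight L p) t +
        dirPoly (expPrimes L) (fun p => if p ∈ S 2 then
          charSum a (p ^ 2) * smoothWeight L (p ^ 2) else 0) (2 * t) +
        ∑ k ∈ Icc 3 N, ∑ p ∈ S k, g (p ^ k) := by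
      rw [sum_logPoly_eq, Chebyshev.sum_PrimePow_eq_sum_sum' (N := N) g hx0.le (le_max_right _ _)]
      have e1 : Icc 1 N = insert 1 (insert 2 (Icc 3 N)) := by
        have := le_max_left 2 ⌊Real.log x / Real.log 2⌋₊
        ext k
        simp only [Finset.mem_Icc, Finset.mem_insert]
        omega
      rw [e1, Finset.sum_insert (by simp), Finset.sum_insert (by simp), ← add_assoc]
      congr 2
      · change ∑ p ∈ S 1, g (p ^ 1) = _
        rw [hS1]
        simp only [pow_one]
        rfl
      · change ∑ p ∈ S 2, g (p ^ 2) = _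
        rw [dirPoly]
        simp only [ite_mul, zero_mul]
        rw [← Finset.sum_filter, Finset.filter_mem_eq_inter, Finset.inter_eq_right.2 hS2]
        refine Finset.sum_congr rfl fun p _ => ?_
        rw [hg]
        simp only
        congr 4
        push_cast
        rw [Real.log_pow]
        push_cast
        ring
    rw [h1, add_re, add_re]
    have h2 : ‖∑ k ∈ Icc 3 N, ∑ p ∈ S k, g (p ^ k)‖ ≤ m * V := by
      calc _ ≤ ∑ k ∈ Icc 3 N, ∑ p ∈ S k, m * ((p ^ k : ℕ) : ℝ) ^ (-(1 / 2) : ℝ) := by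
            refine norm_sum_le_of_le _ fun k hk => norm_sum_le_of_le _ fun p hp => ?_
            exact hgn k (by linarith [(Finset.mem_Icc.1 hk).1]) p hp
        _ = m * ∑ k ∈ Icc 3 N, ∑ p ∈ S k, ((p ^ k : ℕ) : ℝ) ^ (-(1 / 2) : ℝ) := by
            simp only [Finset.mul_sum]
        _ ≤ m * V := by
            gcongr
            exact hVb N S fun k p hp => (Finset.mem_filter.1 hp).2
    linarith [Complex.re_le_norm (∑ k ∈ Icc 3 N, ∑ p ∈ S k, g (p ^ k))]

lemma continuous_dirPoly (S : Finset ℕ) (b : ℕ → ℂ) : Continuous (dirPoly S b) := by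
  unfold dirPoly
  fun_prop

lemma one_div_le_abs_log_sub_log {m n : ℕ} {Y : ℝ} (hm : 1 ≤ m) (hn : 1 ≤ n) (hmn : m ≠ n)
    (hmY : (m : ℝ) ≤ Y) (hnY : (n : ℝ) ≤ Y) : 1 / Y ≤ |Real.log m - Real.log n| := by
  have key : ∀ a b : ℕ, 1 ≤ a → a < b → (b : ℝ) ≤ Y → 1 / Y ≤ Real.log b - Real.log a := by
    intro a b ha hab hb
    have ha0 : (0 : ℝ) < a := by exact_mod_cast ha
    have hb0 : (0 : ℝ) < b := by exact_mod_cast (by omega : 0 < b)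
    have h1 := Real.one_sub_inv_le_log_of_pos (div_pos hb0 ha0)
    rw [Real.log_div hb0.ne' ha0.ne', inv_div] at h1
    refine le_trans ?_ h1
    have h2 : (a : ℝ) + 1 ≤ b := by exact_mod_cast hab
    calc 1 / Y ≤ 1 / b := one_div_le_one_div_of_le hb0 hb
      _ ≤ (b - a) / b := by
          gcongr
          linarith
      _ = _ := by field_simp
  rcases lt_or_gt_of_ne hmn with h | h
  · rw [abs_sub_comm]
    exact (key m n hm h hnY).trans (le_abs_self _)
  · exact (key n m hn h hmY).trans (le_abs_self _)

lemma norm_integral_exp_le {θ a b : ℝ} (hθ : θ ≠ 0) :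
    ‖∫ t in a..b, cexp ((θ * I : ℂ) * t)‖ ≤ 2 / |θ| := by
  have h0 : (θ * I : ℂ) ≠ 0 := mul_ne_zero (by exact_mod_cast hθ) I_ne_zero
  rw [integral_exp_mul_complex h0, norm_div]
  have h1 : ‖(θ * I : ℂ)‖ = |θ| := by simp
  rw [h1]
  gcongr
  refine (norm_sub_le _ _).trans ?_
  have h2 : ∀ x : ℝ, ‖cexp ((θ * I : ℂ) * x)‖ = 1 := fun x => by
    rw [mul_right_comm, ← ofReal_mul, Complex.norm_exp_ofReal_mul_I]
  rw [h2, h2]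
  norm_num

lemma normSq_dirPoly (s : Finset ℕ) (B : ℕ → ℂ) (u t : ℝ) :
    ((‖dirPoly s B (u * t)‖ ^ 2 : ℝ) : ℂ) =
      ∑ m ∈ s, ∑ n ∈ s, B m * starRingEnd ℂ (B n) *
        cexp (((u * (Real.log n - Real.log m) : ℝ) * I : ℂ) * t) := by
  rw [ofReal_pow, ← Complex.mul_conj', dirPoly, map_sum, Finset.sum_mul_sum]
  refine Finset.sum_congr rfl fun m _ => Finset.sum_congr rfl fun n _ => ?_
  rw [map_mul, ← Complex.exp_conj, mul_mul_mul_comm, ← Complex.exp_add]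
  congr 2
  simp only [map_mul, map_neg, Complex.conj_ofReal, Complex.conj_I]
  push_cast
  ring

/-- Mean value theorem for Dirichlet polynomials. -/
theorem integral_normSq_dirPoly_le (s : Finset ℕ) (B : ℕ → ℂ) {Y T u : ℝ} (hT : 0 ≤ T)
    (hu : 1 ≤ u) (hY : 1 ≤ Y) (hs : ∀ n ∈ s, 1 ≤ n ∧ (n : ℝ) ≤ Y) :
    ∫ t in T..(2 * T), ‖dirPoly s B (u * t)‖ ^ 2 ≤ (T + 2 * Y ^ 2) * ∑ n ∈ s, ‖B n‖ ^ 2 := by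
  have hY0 : 0 < Y := by linarith
  have hI : ((∫ t in T..(2 * T), ‖dirPoly s B (u * t)‖ ^ 2 : ℝ) : ℂ) =
      ∑ m ∈ s, ∑ n ∈ s, B m * starRingEnd ℂ (B n) *
        ∫ t in T..(2 * T), cexp (((u * (Real.log n - Real.log m) : ℝ) * I : ℂ) * t) := by
    rw [← intervalIntegral.integral_ofReal]
    simp only [normSq_dirPoly]
    rw [intervalIntegral.integral_finsetSum]
    · refine Finset.sum_congr rfl fun m _ => ?_
      rw [intervalIntegral.integral_finsetSum]
      · refine Finset.sum_congr rfl fun n _ => ?_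
        rw [intervalIntegral.integral_const_mul]
      · intro n _
        exact Continuous.intervalIntegrable (by fun_prop) _ _
    · intro m _
      exact Continuous.intervalIntegrable (by fun_prop) _ _
  have hterm : ∀ m ∈ s, ∀ n ∈ s, ‖B m * starRingEnd ℂ (B n) *
      ∫ t in T..(2 * T), cexp (((u * (Real.log n - Real.log m) : ℝ) * I : ℂ) * t)‖ ≤
        (if m = n then ‖B m‖ ^ 2 * T else 0) + ‖B m‖ * ‖B n‖ * (2 * Y) := by
    intro m hm n hn
    rw [norm_mul, norm_mul, RCLike.norm_conj]
    split_ifs with h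
    · subst h
      have h1 : ‖∫ t in T..(2 * T), cexp (((u * (Real.log m - Real.log m) : ℝ) * I : ℂ) * t)‖ =
          T := by
        simp only [sub_self, mul_zero, ofReal_zero, zero_mul, Complex.exp_zero,
          intervalIntegral.integral_const]
        rw [two_mul, add_sub_cancel_right, norm_smul, norm_one, mul_one, Real.norm_of_nonneg hT]
      rw [h1, ← sq]
      have : 0 ≤ ‖B m‖ ^ 2 * (2 * Y) := by positivity
      linarith
    · rw [zero_add]
      gcongr
      have h1 := one_div_le_abs_log_sub_log (hs n hn).1 (hs m hm).1 (Ne.symm h) (hs n hn).2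
        (hs m hm).2
      have hθ : 1 / Y ≤ |u * (Real.log n - Real.log m)| := by
        rw [abs_mul, abs_of_nonneg (by linarith)]
        exact h1.trans (le_mul_of_one_le_left (abs_nonneg _) hu)
      have hθ0 : 0 < |u * (Real.log n - Real.log m)| := lt_of_lt_of_le (by positivity) hθ
      refine (norm_integral_exp_le (abs_pos.1 hθ0)).trans ?_
      rw [div_le_iff₀ hθ0]
      rw [div_le_iff₀ hY0] at hθ
      linarith
  have hcard : (s.card : ℝ) ≤ Y := by
    have h1 : s ⊆ Ioc 0 ⌊Y⌋₊ := by
      intro n hn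
      obtain ⟨h1, h2⟩ := hs n hn
      exact Finset.mem_Ioc.2 ⟨h1, Nat.le_floor h2⟩
    have h2 := Finset.card_le_card h1
    rw [Nat.card_Ioc, Nat.sub_zero] at h2
    exact (Nat.cast_le.2 h2).trans (Nat.floor_le hY0.le)
  have hnn : 0 ≤ ∫ t in T..(2 * T), ‖dirPoly s B (u * t)‖ ^ 2 :=
    intervalIntegral.integral_nonneg (by linarith) fun _ _ => by positivity
  rw [← Real.norm_of_nonneg hnn, ← Complex.norm_real, hI]
  refine (norm_sum_le_of_le _ fun m hm => norm_sum_le_of_le _ fun n hn => hterm m hm n hn).trans ?_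
  have h3 : ∑ m ∈ s, ∑ n ∈ s, ((if m = n then ‖B m‖ ^ 2 * T else 0) + ‖B m‖ * ‖B n‖ * (2 * Y)) =
      T * ∑ n ∈ s, ‖B n‖ ^ 2 + 2 * Y * (∑ n ∈ s, ‖B n‖) ^ 2 := by
    simp only [Finset.sum_add_distrib, Finset.sum_ite_eq]
    congr 1
    · rw [Finset.mul_sum]
      refine Finset.sum_congr rfl fun m hm => ?_
      rw [if_pos hm, mul_comm]
    · rw [sq, Finset.sum_mul_sum, Finset.mul_sum]
      refine Finset.sum_congr rfl fun m _ => ?_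
      rw [Finset.mul_sum]
      exact Finset.sum_congr rfl fun n _ => by ring
  rw [h3]
  have h4 : (∑ n ∈ s, ‖B n‖) ^ 2 ≤ Y * ∑ n ∈ s, ‖B n‖ ^ 2 := by
    refine sq_sum_le_card_mul_sum_sq.trans ?_
    gcongr
  calc _ ≤ T * ∑ n ∈ s, ‖B n‖ ^ 2 + 2 * Y * (Y * ∑ n ∈ s, ‖B n‖ ^ 2) := by gcongr
    _ = _ := by ring

lemma card_prod_fiber_le {N : ℕ} (s : Finset (Fin N → ℕ)) (hs : ∀ f ∈ s, ∀ i, (f i).Prime)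
    (n : ℕ) : (s.filter fun f => ∏ i, f i = n).card ≤ N.factorial := by
  rcases (s.filter fun f => ∏ i, f i = n).eq_empty_or_nonempty with h | ⟨f₀, hf₀⟩
  · rw [h]
    simp
  · rw [Finset.mem_filter] at hf₀
    have h1 : ∀ f ∈ s.filter fun f => ∏ i, f i = n,
        List.ofFn f ∈ ((List.ofFn f₀).permutations.toFinset : Finset (List ℕ)) := by
      intro f hf
      rw [Finset.mem_filter] at hf
      rw [List.mem_toFinset, List.mem_permutations]
      have h2 : ∀ g ∈ s, ∏ i, g i = n → (List.ofFn g).Perm n.primeFactorsList := by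
        intro g hg hgn
        refine Nat.primeFactorsList_unique (by rw [List.prod_ofFn, hgn]) ?_
        intro p hp
        obtain ⟨i, rfl⟩ := List.mem_ofFn.1 hp
        exact hs g hg i
      exact (h2 f hf.1 hf.2).trans (h2 f₀ hf₀.1 hf₀.2).symm
    refine (Finset.card_le_card_of_injOn _ h1 fun f _ g _ h => List.ofFn_injective h).trans ?_
    refine (List.toFinset_card_le _).trans ?_
    rw [List.length_permutations, List.length_ofFn]

/-- Even moments of a Dirichlet polynomial supported on primes. -/
theorem integral_dirPoly_pow_le (S : Finset ℕ) (b : ℕ → ℂ) (N : ℕ) {X T u : ℝ}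
    (hX : 1 ≤ X) (hu : 1 ≤ u) (hS : ∀ p ∈ S, p.Prime ∧ (p : ℝ) ≤ X) (hXT : X ^ (2 * N) ≤ T) :
    ∫ t in T..(2 * T), ‖dirPoly S b (u * t)‖ ^ (2 * N) ≤
      3 * T * N.factorial * (∑ p ∈ S, ‖b p‖ ^ 2) ^ N := by
  have hT0 : 0 ≤ T := (by positivity : (0 : ℝ) ≤ X ^ (2 * N)).trans hXT
  set P : Finset (Fin N → ℕ) := Fintype.piFinset fun _ => S with hP
  have hPmem : ∀ f ∈ P, ∀ i, f i ∈ S := fun f hf => Fintype.mem_piFinset.1 hf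
  set s : Finset ℕ := P.image fun f => ∏ i, f i with hs
  set B : ℕ → ℂ := fun n => ∑ f ∈ P with ∏ i, f i = n, ∏ i, b (f i) with hB
  have hpow : ∀ x : ℝ, dirPoly S b x ^ N = dirPoly s B x := by
    intro x
    have h1 : dirPoly S b x ^ N = ∏ _i : Fin N, dirPoly S b x := by simp
    rw [h1]
    simp only [dirPoly]
    rw [Finset.prod_univ_sum, ← hP, ← Finset.sum_fiberwise_of_maps_to
      (g := fun f : Fin N → ℕ => ∏ i, f i) (t := s) fun f hf => Finset.mem_image_of_mem _ hf]
    refine Finset.sum_congr rfl fun n _ => ?_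
    rw [hB, Finset.sum_mul]
    refine Finset.sum_congr rfl fun f hf => ?_
    obtain ⟨hf1, hf2⟩ := Finset.mem_filter.1 hf
    rw [Finset.prod_mul_distrib, ← Complex.exp_sum, ← hf2]
    have h2 : Real.log ((∏ i, f i : ℕ) : ℝ) = ∑ i, Real.log (f i) := by
      rw [Nat.cast_prod, Real.log_prod]
      intro i _
      exact_mod_cast (hS _ (hPmem f hf1 i)).1.ne_zero
    rw [h2, Finset.mul_sum, ofReal_sum, ← Finset.sum_neg_distrib, Finset.sum_mul]
  have hsY : ∀ n ∈ s, 1 ≤ n ∧ (n : ℝ) ≤ X ^ N := by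
    intro n hn
    obtain ⟨f, hf, rfl⟩ := Finset.mem_image.1 hn
    refine ⟨Finset.one_le_prod' fun i _ => (hS _ (hPmem f hf i)).1.one_le, ?_⟩
    push_cast
    calc ∏ i, (f i : ℝ) ≤ ∏ _i : Fin N, X := by
          refine Finset.prod_le_prod (fun i _ => by positivity) fun i _ => ?_
          exact (hS _ (hPmem f hf i)).2
      _ = X ^ N := by simp
  have hmean := integral_normSq_dirPoly_le s B hT0 hu (one_le_pow₀ hX : 1 ≤ X ^ N) hsY
  have hBsum : ∑ n ∈ s, ‖B n‖ ^ 2 ≤ N.factorial * (∑ p ∈ S, ‖b p‖ ^ 2) ^ N := by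
    have h1 : (∑ p ∈ S, ‖b p‖ ^ 2) ^ N = ∑ f ∈ P, ∏ i, ‖b (f i)‖ ^ 2 := by
      have h1 : (∑ p ∈ S, ‖b p‖ ^ 2) ^ N = ∏ _i : Fin N, ∑ p ∈ S, ‖b p‖ ^ 2 := by simp
      rw [h1, Finset.prod_univ_sum]
    rw [h1, ← Finset.sum_fiberwise_of_maps_to
      (g := fun f : Fin N → ℕ => ∏ i, f i) (t := s) fun f hf => Finset.mem_image_of_mem _ hf,
      Finset.mul_sum]
    refine Finset.sum_le_sum fun n _ => ?_
    have h2 : ‖B n‖ ≤ ∑ f ∈ P with ∏ i, f i = n, ∏ i, ‖b (f i)‖ :=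
      norm_sum_le_of_le _ fun f _ => (norm_prod _ _).le
    calc ‖B n‖ ^ 2 ≤ (∑ f ∈ P with ∏ i, f i = n, ∏ i, ‖b (f i)‖) ^ 2 := by gcongr
      _ ≤ (P.filter fun f => ∏ i, f i = n).card *
          ∑ f ∈ P with ∏ i, f i = n, (∏ i, ‖b (f i)‖) ^ 2 := sq_sum_le_card_mul_sum_sq
      _ ≤ N.factorial * ∑ f ∈ P with ∏ i, f i = n, ∏ i, ‖b (f i)‖ ^ 2 := by
          simp only [Finset.prod_pow]
          gcongr
          exact card_prod_fiber_le P (fun f hf i => (hS _ (hPmem f hf i)).1) n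
  calc ∫ t in T..(2 * T), ‖dirPoly S b (u * t)‖ ^ (2 * N)
      = ∫ t in T..(2 * T), ‖dirPoly s B (u * t)‖ ^ 2 := by
        simp only [← hpow, norm_pow, ← pow_mul, mul_comm 2 N]
    _ ≤ (T + 2 * (X ^ N) ^ 2) * ∑ n ∈ s, ‖B n‖ ^ 2 := hmean
    _ ≤ (T + 2 * T) * (N.factorial * (∑ p ∈ S, ‖b p‖ ^ 2) ^ N) := by
        rw [← pow_mul, mul_comm N 2]
        gcongr
    _ = _ := by ring

/-- The product `∏ |L(1/2+it,χ)|^{a_χ}`. -/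
noncomputable def absProd {q : ℕ} [NeZero q] (a : DirichletCharacter ℂ q → ℕ) (t : ℝ) : ℝ :=
  ∏ χ : DirichletCharacter ℂ q, ‖DirichletCharacter.LFunction χ (1 / 2 + t * I)‖ ^ a χ

lemma absProd_nonneg {q : ℕ} [NeZero q] (a : DirichletCharacter ℂ q → ℕ) (t : ℝ) :
    0 ≤ absProd a t :=
  Finset.prod_nonneg fun _ _ => by positivity

lemma continuousOn_absProd {q : ℕ} [NeZero q] (a : DirichletCharacter ℂ q → ℕ) :
    ContinuousOn (absProd a) (Set.Ioi 0) := by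
  unfold absProd
  refine continuousOn_finsetProd _ fun χ _ => ContinuousOn.pow (ContinuousOn.norm ?_) _
  intro t ht
  have h1 : (1 / 2 + t * I : ℂ) ≠ 1 := by
    intro h
    have := congrArg Complex.im h
    simp at this
    exact (Set.mem_Ioi.1 ht).ne' this
  have h2 := (DirichletCharacter.differentiableAt_LFunction χ _ (Or.inl h1)).continuousAt
  have h3 : ContinuousAt (fun t : ℝ => (1 / 2 + t * I : ℂ)) t := by fun_prop
  exact (ContinuousAt.comp (f := fun t : ℝ => (1 / 2 + t * I : ℂ)) h2 h3).continuousWithinAt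

lemma intervalIntegrable_absProd {q : ℕ} [NeZero q] (a : DirichletCharacter ℂ q → ℕ) {T : ℝ}
    (hT : 0 < T) : IntervalIntegrable (absProd a) volume T (2 * T) := by
  refine ((continuousOn_absProd a).mono fun t ht => ?_).intervalIntegrable
  rw [Set.uIcc_of_le (by linarith)] at ht
  exact lt_of_lt_of_le hT ht.1

lemma absProd_two_mul {q : ℕ} [NeZero q] (a : DirichletCharacter ℂ q → ℕ) (t : ℝ) :
    absProd (fun χ => 2 * a χ) t = absProd a t ^ 2 := by
  simp only [absProd, ← Finset.prod_pow, ← pow_mul, mul_comm 2]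

theorem exists_absProd_le_exp {q : ℕ} [NeZero q] (hGRH : GRHmod q)
    (a : DirichletCharacter ℂ q → ℕ) :
    ∃ C : ℝ, 0 < C ∧ ∀ T L : ℝ, 0 < T → 48 ≤ L → 2 * L ≤ Real.log T → ∃ c d : ℕ → ℂ,
      (∀ p ∈ expPrimes L, ‖c p‖ ^ 2 ≤ ‖charSum a p‖ ^ 2 / p) ∧
      (∀ p ∈ expPrimes L, ‖d p‖ ≤ (∑ χ, a χ : ℕ) / p) ∧
      ∀ t : ℝ, T ≤ t → t ≤ 2 * T → absProd a t ≤
        Real.exp (‖dirPoly (expPrimes L) c t‖ + ‖dirPoly (expPrimes L) d (2 * t)‖ +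
          C * Real.log T / L) := by
  choose M hM hMb using fun χ : DirichletCharacter ℂ q => exists_norm_LFunction_le_exp_logPoly hGRH χ
  obtain ⟨C, hC, hCb⟩ := exists_re_sum_logPoly_le a
  refine ⟨∑ χ, a χ * M χ + C, ?_, fun T L hT hL hLT => ?_⟩
  · have : 0 ≤ ∑ χ, a χ * M χ :=
      Finset.sum_nonneg fun χ _ => mul_nonneg (Nat.cast_nonneg _) (hM χ).le
    linarith
  have hL0 : 0 < L := by linarith
  obtain ⟨c, d, hc, hd, hcd⟩ := hCb L hL0
  refine ⟨c, d, hc, hd, fun t ht1 ht2 => ?_⟩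
  have h1 : absProd a t ≤ ∏ χ : DirichletCharacter ℂ q,
      Real.exp ((logPoly χ L (1 / 2 + t * I + (12 / L : ℝ))).re + M χ * Real.log T / L) ^ a χ := by
    refine Finset.prod_le_prod (fun χ _ => by positivity) fun χ _ => ?_
    gcongr
    exact hMb χ T L hT hL hLT t ht1 ht2
  refine h1.trans ?_
  simp only [← Real.exp_nat_mul]
  rw [← Real.exp_sum]
  refine Real.exp_le_exp.2 ?_
  have h2 : ∑ χ : DirichletCharacter ℂ q, (a χ : ℝ) *
      ((logPoly χ L (1 / 2 + t * I + (12 / L : ℝ))).re + M χ * Real.log T / L) =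
      (∑ χ, (a χ : ℂ) * logPoly χ L (1 / 2 + t * I + (12 / L : ℝ))).re +
        (∑ χ, a χ * M χ) * (Real.log T / L) := by
    rw [Complex.re_sum, Finset.sum_mul, ← Finset.sum_add_distrib]
    refine Finset.sum_congr rfl fun χ _ => ?_
    rw [← ofReal_natCast, Complex.re_ofReal_mul]
    ring
  rw [h2]
  have h3 : C ≤ C * (Real.log T / L) := by
    refine le_mul_of_one_le_right hC.le ?_
    rw [one_le_div hL0]
    linarith
  have h4 := hcd t
  have h5 := Complex.re_le_norm (dirPoly (expPrimes L) c t)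
  have h6 := Complex.re_le_norm (dirPoly (expPrimes L) d (2 * t))
  rw [mul_div_assoc, add_mul]
  linarith

lemma exists_absProd_le_exp_log {q : ℕ} [NeZero q] (a : DirichletCharacter ℂ q → ℕ) :
    ∃ C : ℝ, 0 < C ∧ ∀ T : ℝ, Real.exp 1 ≤ T → ∀ t : ℝ, T ≤ t → t ≤ 2 * T →
      absProd a t ≤ Real.exp (C * Real.log T) := by
  choose M hM hMb using fun χ : DirichletCharacter ℂ q => exists_norm_LFunction_le χ
  refine ⟨∑ χ, a χ * (2 * M χ + 1) + 1, ?_, fun T hT t ht1 ht2 => ?_⟩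
  · have : 0 ≤ ∑ χ, a χ * (2 * M χ + 1) :=
      Finset.sum_nonneg fun χ _ => mul_nonneg (Nat.cast_nonneg _) (by linarith [hM χ])
    linarith
  have hT1 : 1 ≤ T := (Real.one_le_exp zero_le_one).trans hT
  have hT0 : 0 < T := by linarith
  have hlog : 1 ≤ Real.log T := (Real.le_log_iff_exp_le hT0).2 hT
  have h1 : absProd a t ≤ ∏ χ : DirichletCharacter ℂ q,
      Real.exp ((2 * M χ + 1) * Real.log T) ^ a χ := by
    refine Finset.prod_le_prod (fun χ _ => by positivity) fun χ _ => ?_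
    gcongr
    have h2 := hMb χ (1 / 2 + t * I) (by norm_num) (by norm_num) (by simp; linarith)
    have h3 : (1 / 2 + t * I : ℂ).im = t := by simp
    rw [h3] at h2
    refine h2.trans ?_
    have hMχ := hM χ
    have h4 : 2 * M χ ≤ Real.exp (2 * M χ * Real.log T) := by
      have := Real.add_one_le_exp (2 * M χ * Real.log T)
      nlinarith
    calc M χ * t ≤ M χ * (2 * T) := by gcongr
      _ = 2 * M χ * Real.exp (Real.log T) := by
          rw [Real.exp_log hT0]
          ring
      _ ≤ Real.exp (2 * M χ * Real.log T) * Real.exp (Real.log T) := by gcongr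
      _ = _ := by
          rw [← Real.exp_add]
          congr 1
          ring
  refine h1.trans ?_
  simp only [← Real.exp_nat_mul]
  rw [← Real.exp_sum]
  refine Real.exp_le_exp.2 ?_
  rw [add_mul, Finset.sum_mul]
  refine le_trans (le_of_eq ?_) (le_add_of_nonneg_right (by linarith))
  exact Finset.sum_congr rfl fun χ _ => by ring

lemma norm_dirPoly_le (S : Finset ℕ) (b : ℕ → ℂ) (x : ℝ) : ‖dirPoly S b x‖ ≤ ∑ p ∈ S, ‖b p‖ := by
  refine norm_sum_le_of_le _ fun p _ => ?_
  rw [norm_mul, ← ofReal_neg, Complex.norm_exp_ofReal_mul_I, mul_one]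

lemma integral_dirPoly_div_pow_le (S : Finset ℕ) (b : ℕ → ℂ) (N : ℕ) {L T u y s r : ℝ}
    (hL : 0 ≤ L) (hu : 1 ≤ u) (hS : ∀ p ∈ S, p.Prime ∧ (p : ℝ) ≤ Real.exp L) (hT : 0 < T)
    (hLT : 2 * N * L ≤ Real.log T) (hy : 0 < y) (hs : ∑ p ∈ S, ‖b p‖ ^ 2 ≤ s)
    (hr : N * s ≤ y ^ 2 * r) :
    ∫ t in T..(2 * T), (‖dirPoly S b (u * t)‖ / y) ^ (2 * N) ≤ 3 * T * r ^ N := by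
  have hs0 : 0 ≤ s := (Finset.sum_nonneg fun p _ => by positivity).trans hs
  have hX : Real.exp L ^ (2 * N) ≤ T := by
    rw [← Real.exp_nat_mul, ← Real.le_log_iff_exp_le hT]
    push_cast
    exact hLT
  have h := integral_dirPoly_pow_le S b N (Real.one_le_exp hL) hu hS hX
  simp only [div_pow]
  rw [intervalIntegral.integral_div, div_le_iff₀ (by positivity)]
  refine h.trans ?_
  have h1 : (N.factorial : ℝ) ≤ (N : ℝ) ^ N := by exact_mod_cast Nat.factorial_le_pow N
  calc 3 * T * N.factorial * (∑ p ∈ S, ‖b p‖ ^ 2) ^ N ≤ 3 * T * (N : ℝ) ^ N * s ^ N := by gcongr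
    _ = 3 * T * (N * s) ^ N := by rw [mul_pow]; ring
    _ ≤ 3 * T * (y ^ 2 * r) ^ N := by gcongr
    _ = 3 * T * r ^ N * y ^ (2 * N) := by rw [mul_pow, pow_mul]; ring

lemma sum_norm_sq_le_of_le {S : Finset ℕ} {c : ℕ → ℂ} {q : ℕ} [NeZero q]
    {a : DirichletCharacter ℂ q → ℕ} (hc : ∀ p ∈ S, ‖c p‖ ^ 2 ≤ ‖charSum a p‖ ^ 2 / p) :
    ∑ p ∈ S, ‖c p‖ ^ 2 ≤ ((∑ χ, a χ : ℕ) : ℝ) ^ 2 * ∑ p ∈ S, (1 : ℝ) / p := by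
  rw [Finset.mul_sum]
  refine Finset.sum_le_sum fun p hp => (hc p hp).trans ?_
  rw [mul_one_div]
  gcongr
  exact norm_charSum_le a p

lemma exists_majorant {q : ℕ} [NeZero q] (hGRH : GRHmod q) (a : DirichletCharacter ℂ q → ℕ) :
    ∃ A B D : ℝ, 0 < A ∧ 0 < D ∧ ∀ T : ℝ, Real.exp (Real.exp 1) ≤ T →
      (∀ t, T ≤ t → t ≤ 2 * T → absProd a t ≤ Real.exp (B * Real.log T)) ∧
      ∀ j : ℕ, A * Real.log (Real.log T) ≤ j → j ≤ B * Real.log T → ∃ g : ℝ → ℝ,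
        Continuous g ∧ (∀ t, 0 ≤ g t) ∧ ∫ t in T..(2 * T), g t ≤ D * T * Real.exp (-j) ∧
        ∀ t, T ≤ t → t ≤ 2 * T → Real.exp j ≤ absProd a t → Real.exp (j + 1) ≤ g t := by
  obtain ⟨C, hC, hCb⟩ := exists_absProd_le_exp hGRH a
  obtain ⟨B, hB, hBb⟩ := exists_absProd_le_exp_log a
  obtain ⟨V, hV, hVb⟩ := exists_sum_inv_le
  set m : ℝ := ((∑ χ, a χ : ℕ) : ℝ) with hm
  have hm0 : 0 ≤ m := Nat.cast_nonneg _
  set K : ℝ := 48 * B + 4 * C with hK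
  have hK0 : 0 < K := by positivity
  set A : ℝ := 2 * K + 4 * (m * (2 + V)) + Real.exp (4 * K) * (2 * m ^ 2 * (2 + V)) / K with hA
  have hA3 : 0 ≤ Real.exp (4 * K) * (2 * m ^ 2 * (2 + V)) / K := by positivity
  have hA2 : 0 ≤ m * (2 + V) := by positivity
  refine ⟨A, B, 3 * Real.exp (4 * K + 1), by linarith, by positivity, fun T hT => ⟨hBb T ?_, ?_⟩⟩
  · refine le_trans (Real.exp_le_exp.2 ?_) hT
    exact Real.one_le_exp zero_le_one
  intro j hj1 hj2
  have hT0 : 0 < T := (Real.exp_pos _).trans_le hT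
  have hlT : Real.exp 1 ≤ Real.log T := (Real.le_log_iff_exp_le hT0).2 hT
  have hlT0 : 0 < Real.log T := (Real.exp_pos _).trans_le hlT
  set lam : ℝ := Real.log (Real.log T) with hlam
  have hlam1 : 1 ≤ lam := (Real.le_log_iff_exp_le hlT0).2 hlT
  have hAle : A ≤ A * lam := le_mul_of_one_le_right (by linarith) hlam1
  have hj0 : (0 : ℝ) < j := by linarith
  set L : ℝ := K * Real.log T / j with hL
  have hLj : L * j = K * Real.log T := by rw [hL]; field_simp
  have hL48 : 48 ≤ L := by
    rw [hL, le_div_iff₀ hj0]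
    nlinarith
  have hL2 : 2 * L ≤ Real.log T := by
    have : 2 * K * L ≤ L * j := by nlinarith
    rw [hLj] at this
    nlinarith
  have hL0 : 0 < L := by linarith
  have hlogL : Real.log L ≤ lam := Real.log_le_log hL0 (by linarith)
  have hV1 : ∑ p ∈ expPrimes L, (1 : ℝ) / p ≤ (2 + V) * lam := by
    refine (hVb L (by linarith)).trans ?_
    nlinarith
  obtain ⟨c, d, hc, hd, hE⟩ := hCb T L hT0 hL48 hL2
  set N : ℕ := ⌊(j : ℝ) / (2 * K)⌋₊ with hN
  have hN1 : (N : ℝ) ≤ j / (2 * K) := Nat.floor_le (by positivity)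
  have hN2 : (j : ℝ) / (2 * K) - 1 ≤ N := (Nat.sub_one_lt_floor _).le
  rw [le_div_iff₀ (by positivity)] at hN1
  rw [sub_le_iff_le_add, div_le_iff₀ (by positivity)] at hN2
  have hcsum : ∑ p ∈ expPrimes L, ‖c p‖ ^ 2 ≤ m ^ 2 * ((2 + V) * lam) :=
    (sum_norm_sq_le_of_le hc).trans (by gcongr)
  have hintg := integral_dirPoly_div_pow_le (expPrimes L) c N (L := L) (T := T) (u := 1)
    (y := j / 2) (s := m ^ 2 * ((2 + V) * lam)) (r := Real.exp (-(4 * K))) hL0.le le_rfl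
    (fun p hp => mem_expPrimes.1 hp) hT0 (by
      have : 2 * N * L * K ≤ Real.log T * K := by nlinarith
      exact le_of_mul_le_mul_right this hK0) (by positivity) hcsum (by
      rw [Real.exp_neg, ← div_eq_mul_inv, le_div_iff₀ (Real.exp_pos _)]
      have h1 : Real.exp (4 * K) * (2 * m ^ 2 * (2 + V)) / K * lam ≤ j := by
        refine le_trans ?_ hj1
        gcongr
        linarith
      have h2 : Real.exp (4 * K) * (2 * m ^ 2 * (2 + V)) * lam ≤ j * K := by
        have := mul_le_mul_of_nonneg_right h1 hK0.le
        calc _ = Real.exp (4 * K) * (2 * m ^ 2 * (2 + V)) / K * lam * K := by field_simp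
          _ ≤ _ := this
      have h3 : 0 ≤ Real.exp (4 * K) * (2 * m ^ 2 * (2 + V)) * lam := by positivity
      have h4 : (N * (2 * K)) * (Real.exp (4 * K) * (2 * m ^ 2 * (2 + V)) * lam) ≤
          j * (j * K) := mul_le_mul hN1 h2 h3 hj0.le
      have h5 : (↑N * (m ^ 2 * ((2 + V) * lam)) * Real.exp (4 * K)) * (4 * K) ≤
          ((j : ℝ) / 2) ^ 2 * (4 * K) := by linarith
      exact le_of_mul_le_mul_right h5 (by positivity))
  refine ⟨fun t => Real.exp (j + 1) * (‖dirPoly (expPrimes L) c (1 * t)‖ / (j / 2)) ^ (2 * N),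
    ?_, fun t => by positivity, ?_, ?_⟩
  · have := continuous_dirPoly (expPrimes L) c
    fun_prop
  · rw [intervalIntegral.integral_const_mul]
    calc _ ≤ Real.exp (j + 1) * (3 * T * Real.exp (-(4 * K)) ^ N) := by gcongr
      _ = 3 * T * Real.exp (j + 1 + N * (-(4 * K))) := by
        rw [← Real.exp_nat_mul, Real.exp_add (j + 1 : ℝ)]; ring
      _ ≤ 3 * T * Real.exp (4 * K + 1 + -j) := by
        refine mul_le_mul_of_nonneg_left (Real.exp_le_exp.2 ?_) (by positivity)
        linarith
      _ = _ := by rw [Real.exp_add (4 * K + 1)]; ring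
  · intro t ht1 ht2 hjt
    have h1 := Real.exp_le_exp.1 (hjt.trans (hE t ht1 ht2))
    have h2 : C * Real.log T / L ≤ j / 4 := by
      rw [div_le_iff₀ hL0]
      have : (j : ℝ) / 4 * L = K * Real.log T / 4 := by rw [← hLj]; ring
      rw [this]
      nlinarith
    have h3 : ‖dirPoly (expPrimes L) d (2 * t)‖ ≤ j / 4 := by
      refine (norm_dirPoly_le _ _ _).trans ?_
      calc ∑ p ∈ expPrimes L, ‖d p‖ ≤ ∑ p ∈ expPrimes L, m * ((1 : ℝ) / p) :=
            Finset.sum_le_sum fun p hp => (hd p hp).trans (by rw [mul_one_div])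
        _ ≤ m * ((2 + V) * lam) := by rw [← Finset.mul_sum]; gcongr
        _ ≤ j / 4 := by
          have : 4 * (m * (2 + V)) * lam ≤ A * lam := by gcongr; linarith
          linarith
    have h4 : 1 ≤ ‖dirPoly (expPrimes L) c (1 * t)‖ / (j / 2) := by
      rw [one_mul, le_div_iff₀ (by positivity)]
      linarith
    exact le_mul_of_one_le_right (Real.exp_pos _).le (one_le_pow₀ h4)

lemma sum_exp_neg_le_two (n : ℕ) : ∑ j ∈ Finset.range n, Real.exp (-(j : ℝ)) ≤ 2 := by
  have h : ∀ j : ℕ, Real.exp (-(j : ℝ)) ≤ (1 / 2 : ℝ) ^ j := fun j => by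
    rw [show -(j : ℝ) = j * (-1) by ring, Real.exp_nat_mul]
    gcongr
    rw [Real.exp_neg, one_div]
    gcongr
    linarith [Real.add_one_le_exp (1 : ℝ)]
  exact (Finset.sum_le_sum fun j _ => h j).trans (sum_geometric_two_le n)

/-- On GRH, moments of the product grow at most like a power of `log T`. -/
theorem exists_integral_absProd_le_pow {q : ℕ} [NeZero q] (hGRH : GRHmod q)
    (a : DirichletCharacter ℂ q → ℕ) :
    ∃ A C : ℝ, 0 < A ∧ 0 < C ∧ ∀ T : ℝ, Real.exp (Real.exp 1) ≤ T →
      ∫ t in T..(2 * T), absProd a t ≤ C * T * Real.log T ^ A := by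
  obtain ⟨A, B, D, hA, hD, h⟩ := exists_majorant hGRH a
  refine ⟨A, Real.exp 1 + 2 * D, hA, by positivity, fun T hT => ?_⟩
  obtain ⟨hB, hg⟩ := h T hT
  have hT0 : 0 < T := (Real.exp_pos _).trans_le hT
  have hlT : Real.exp 1 ≤ Real.log T := (Real.le_log_iff_exp_le hT0).2 hT
  have hlT1 : 1 ≤ Real.log T := (Real.one_le_exp zero_le_one).trans hlT
  set lam : ℝ := Real.log (Real.log T) with hlam
  have hg' : ∀ j : ℕ, ∃ g : ℝ → ℝ, Continuous g ∧ (∀ t, 0 ≤ g t) ∧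
      ∫ t in T..(2 * T), g t ≤ D * T * Real.exp (-j) ∧
      (A * lam ≤ j → j ≤ B * Real.log T → ∀ t, T ≤ t → t ≤ 2 * T →
        Real.exp j ≤ absProd a t → Real.exp (j + 1) ≤ g t) := by
    intro j
    by_cases hj : A * lam ≤ j ∧ j ≤ B * Real.log T
    · obtain ⟨g, h1, h2, h3, h4⟩ := hg j hj.1 hj.2
      exact ⟨g, h1, h2, h3, fun _ _ => h4⟩
    · refine ⟨fun _ => 0, continuous_const, fun _ => le_rfl, ?_, fun h1 h2 => absurd ⟨h1, h2⟩ hj⟩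
      rw [intervalIntegral.integral_zero]
      positivity
  choose g hg1 hg2 hg3 hg4 using hg'
  set n : ℕ := ⌊B * Real.log T⌋₊ + 1 with hn
  have hpt : ∀ t ∈ Set.Icc T (2 * T), absProd a t ≤
      Real.exp (A * lam + 1) + ∑ j ∈ Finset.range n, g j t := by
    intro t ht
    have hs0 : 0 ≤ ∑ j ∈ Finset.range n, g j t := Finset.sum_nonneg fun j _ => hg2 j t
    rcases le_or_gt (absProd a t) (Real.exp (A * lam + 1)) with h1 | h1
    · linarith
    have hE0 : 0 < absProd a t := (Real.exp_pos _).trans h1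
    set x := Real.log (absProd a t) with hx
    have hxE : Real.exp x = absProd a t := Real.exp_log hE0
    have hx1 : A * lam + 1 < x := by rwa [← hxE, Real.exp_lt_exp] at h1
    have hlam0 : 0 ≤ lam := Real.log_nonneg hlT1
    have hx0 : 0 ≤ x := by nlinarith
    have hx2 : x ≤ B * Real.log T := by
      rw [← Real.exp_le_exp, hxE]
      exact hB t ht.1 ht.2
    have hf1 : (⌊x⌋₊ : ℝ) ≤ x := Nat.floor_le hx0
    have hf2 : x < ⌊x⌋₊ + 1 := Nat.lt_floor_add_one x
    have h2 := hg4 ⌊x⌋₊ (by linarith) (by linarith) t ht.1 ht.2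
      (by rw [← hxE, Real.exp_le_exp]; exact hf1)
    have h3 : g ⌊x⌋₊ t ≤ ∑ j ∈ Finset.range n, g j t :=
      Finset.single_le_sum (f := fun j => g j t) (fun j _ => hg2 j t)
        (Finset.mem_range.2 (Nat.lt_succ_of_le (Nat.floor_le_floor hx2)))
    have h4 : absProd a t ≤ Real.exp (⌊x⌋₊ + 1) := by
      rw [← hxE, Real.exp_le_exp]
      exact hf2.le
    linarith [Real.exp_pos (A * lam + 1)]
  have hT2 : T ≤ 2 * T := by linarith
  have hgi : ∀ j ∈ Finset.range n, IntervalIntegrable (g j) volume T (2 * T) :=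
    fun j _ => (hg1 j).intervalIntegrable _ _
  have hci : IntervalIntegrable (fun _ : ℝ => Real.exp (A * lam + 1)) volume T (2 * T) :=
    intervalIntegrable_const
  have hsi : IntervalIntegrable (fun t => ∑ j ∈ Finset.range n, g j t) volume T (2 * T) :=
    (continuous_finsetSum _ fun j _ => hg1 j).intervalIntegrable _ _
  have hpow : Real.log T ^ A = Real.exp (A * lam) := by
    rw [Real.rpow_def_of_pos (by linarith), mul_comm]
  have hpow1 : 1 ≤ Real.log T ^ A := Real.one_le_rpow hlT1 hA.le
  calc ∫ t in T..(2 * T), absProd a t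
      ≤ ∫ t in T..(2 * T), (Real.exp (A * lam + 1) + ∑ j ∈ Finset.range n, g j t) :=
        intervalIntegral.integral_mono_on hT2 (intervalIntegrable_absProd a hT0) (hci.add hsi) hpt
    _ = T * Real.exp (A * lam + 1) + ∑ j ∈ Finset.range n, ∫ t in T..(2 * T), g j t := by
        rw [intervalIntegral.integral_add hci hsi, intervalIntegral.integral_const,
          intervalIntegral.integral_finsetSum hgi, smul_eq_mul]
        ring
    _ ≤ T * Real.exp (A * lam + 1) + ∑ j ∈ Finset.range n, D * T * Real.exp (-j) := by
        gcongr with j hj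
        exact hg3 j
    _ ≤ T * (Real.exp 1 * Real.log T ^ A) + D * T * 2 := by
        rw [← Finset.mul_sum, Real.exp_add, ← hpow, mul_comm (Real.exp 1)]
        gcongr
        exact sum_exp_neg_le_two n
    _ ≤ (Real.exp 1 + 2 * D) * T * Real.log T ^ A := by
        have : D * T * 2 * 1 ≤ D * T * 2 * Real.log T ^ A := by gcongr
        linarith

lemma exp_le_four_mul_sum {x : ℝ} {J : ℕ} (hx : 0 ≤ x) (hxJ : x ≤ J) :
    Real.exp x ≤ 4 * ∑ j ∈ Finset.range (J + 1), x ^ (2 * j) / (2 * j).factorial := by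
  have hs := Real.hasSum_cosh x
  have h1 := hs.summable.sum_add_tsum_nat_add (J + 1)
  rw [hs.tsum_eq] at h1
  have hterm : ∀ i : ℕ, x ^ (2 * (i + (J + 1))) / (2 * (i + (J + 1))).factorial ≤
      x ^ (2 * J) / (2 * J).factorial * ((1 / 4 : ℝ) ^ i * (1 / 4)) := by
    intro i
    have hf : (((2 * J).factorial : ℝ)) * (2 * J + 1 : ℝ) ^ (2 * i + 2) ≤
        (2 * (i + (J + 1))).factorial := by
      have := Nat.factorial_mul_pow_le_factorial (m := 2 * J) (n := 2 * i + 2)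
      rw [show 2 * (i + (J + 1)) = 2 * J + (2 * i + 2) by ring]
      exact_mod_cast this
    have hp : x ^ (2 * i + 2) ≤ (2 * J + 1 : ℝ) ^ (2 * i + 2) * ((1 / 4 : ℝ) ^ i * (1 / 4)) := by
      have h4 : ((1 / 4 : ℝ) ^ i * (1 / 4)) = (1 / 2 : ℝ) ^ (2 * i + 2) := by
        rw [pow_add, pow_mul]
        norm_num
      rw [h4, ← mul_pow]
      gcongr
      linarith
    rw [div_mul_eq_mul_div, div_le_div_iff₀ (by positivity) (by positivity)]
    calc x ^ (2 * (i + (J + 1))) * (2 * J).factorial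
        = x ^ (2 * J) * (2 * J).factorial * x ^ (2 * i + 2) := by
          rw [show 2 * (i + (J + 1)) = 2 * J + (2 * i + 2) by ring, pow_add]; ring
      _ ≤ x ^ (2 * J) * (2 * J).factorial *
          ((2 * J + 1 : ℝ) ^ (2 * i + 2) * ((1 / 4 : ℝ) ^ i * (1 / 4))) := by gcongr
      _ = x ^ (2 * J) * ((1 / 4 : ℝ) ^ i * (1 / 4)) *
          ((2 * J).factorial * (2 * J + 1 : ℝ) ^ (2 * i + 2)) := by ring
      _ ≤ _ := by gcongr
  have hgs : HasSum (fun i : ℕ => x ^ (2 * J) / (2 * J).factorial * ((1 / 4 : ℝ) ^ i * (1 / 4)))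
      (x ^ (2 * J) / (2 * J).factorial * ((1 - 1 / 4)⁻¹ * (1 / 4))) :=
    ((hasSum_geometric_of_lt_one (by norm_num) (by norm_num)).mul_right _).mul_left _
  have htail := (((summable_nat_add_iff (J + 1)).2 hs.summable).tsum_le_tsum hterm hgs.summable)
  rw [hgs.tsum_eq] at htail
  have hJ : x ^ (2 * J) / (2 * J).factorial ≤
      ∑ j ∈ Finset.range (J + 1), x ^ (2 * j) / (2 * j).factorial :=
    Finset.single_le_sum (f := fun j => x ^ (2 * j) / ((2 * j).factorial : ℝ))
      (fun j _ => by positivity) (Finset.mem_range.2 J.lt_succ_self)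
  have h0 : 0 ≤ x ^ (2 * J) / ((2 * J).factorial : ℝ) := by positivity
  have hc : Real.exp x ≤ 2 * Real.cosh x := by
    rw [Real.cosh_eq]
    linarith [Real.exp_pos (-x)]
  have : (1 - 1 / 4 : ℝ)⁻¹ * (1 / 4) = 1 / 3 := by norm_num
  rw [this] at htail
  linarith

lemma factorial_div_factorial_le (j : ℕ) :
    (j.factorial : ℝ) / (2 * j).factorial ≤ (2 * j + 1) * ((1 / 4) ^ j / j.factorial) := by
  have h1 : (4 : ℝ) ^ j ≤ (2 * j + 1) * j.centralBinom := by
    exact_mod_cast Nat.four_pow_le_two_mul_add_one_mul_central_binom j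
  have h2 : ((2 * j).factorial : ℝ) = j.centralBinom * (j.factorial * j.factorial) := by
    have := Nat.choose_mul_factorial_mul_factorial (n := 2 * j) (k := j) (by omega)
    rw [show 2 * j - j = j by omega] at this
    rw [Nat.centralBinom, ← this]
    push_cast
    ring
  have h3 : (0 : ℝ) < j.centralBinom := by exact_mod_cast j.centralBinom_pos
  have h4 : (0 : ℝ) < j.factorial := by positivity
  rw [h2, one_div, inv_pow, div_le_iff₀ (by positivity)]
  calc (j.factorial : ℝ) = (4 : ℝ) ^ j * ((4 ^ j)⁻¹ * j.factorial) := by field_simp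
    _ ≤ ((2 * j + 1) * j.centralBinom) * ((4 ^ j)⁻¹ * j.factorial) := by gcongr
    _ = _ := by field_simp

lemma integral_sum_dirPoly_pow_le (S : Finset ℕ) (b : ℕ → ℂ) (J : ℕ) {L T s : ℝ}
    (hL : 0 ≤ L) (hS : ∀ p ∈ S, p.Prime ∧ (p : ℝ) ≤ Real.exp L) (hT : 0 < T)
    (hLT : 2 * J * L ≤ Real.log T) (hs : ∑ p ∈ S, ‖b p‖ ^ 2 ≤ s) :
    ∫ t in T..(2 * T), ∑ j ∈ Finset.range (J + 1),
        ‖dirPoly S b (1 * t)‖ ^ (2 * j) / (2 * j).factorial ≤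
      3 * T * (2 * J + 1) * Real.exp (s / 4) := by
  have hs0 : 0 ≤ ∑ p ∈ S, ‖b p‖ ^ 2 := Finset.sum_nonneg fun p _ => by positivity
  have hcont := continuous_dirPoly S b
  rw [intervalIntegral.integral_finsetSum fun j _ =>
    Continuous.intervalIntegrable (by fun_prop) _ _]
  have hj : ∀ j ∈ Finset.range (J + 1),
      ∫ t in T..(2 * T), ‖dirPoly S b (1 * t)‖ ^ (2 * j) / (2 * j).factorial ≤
        3 * T * (2 * J + 1) * ((s / 4) ^ j / j.factorial) := by
    intro j hj
    have hjJ : (j : ℝ) ≤ J := by exact_mod_cast Nat.lt_succ_iff.1 (Finset.mem_range.1 hj)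
    have hX : Real.exp L ^ (2 * j) ≤ T := by
      rw [← Real.exp_nat_mul, ← Real.le_log_iff_exp_le hT]
      push_cast
      refine le_trans ?_ hLT
      gcongr
    have h := integral_dirPoly_pow_le S b j (Real.one_le_exp hL) le_rfl hS hX
    rw [intervalIntegral.integral_div]
    calc _ ≤ 3 * T * j.factorial * (∑ p ∈ S, ‖b p‖ ^ 2) ^ j / (2 * j).factorial := by gcongr
      _ = 3 * T * (∑ p ∈ S, ‖b p‖ ^ 2) ^ j * ((j.factorial : ℝ) / (2 * j).factorial) := by ring
      _ ≤ 3 * T * s ^ j * ((2 * j + 1) * ((1 / 4) ^ j / j.factorial)) := by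
        have := hs0.trans hs
        exact mul_le_mul (by gcongr) (factorial_div_factorial_le j) (by positivity)
          (by positivity)
      _ ≤ 3 * T * s ^ j * ((2 * J + 1) * ((1 / 4) ^ j / j.factorial)) := by
        have := hs0.trans hs
        gcongr
      _ = _ := by rw [div_pow, div_pow, one_pow]; ring
  refine (Finset.sum_le_sum hj).trans ?_
  rw [← Finset.mul_sum]
  gcongr
  exact Real.sum_le_exp_of_nonneg (by linarith) _

lemma eventually_mul_le_exp (K : ℝ) {c : ℝ} (hc : 0 < c) :
    ∀ᶠ x : ℝ in atTop, K * x ≤ Real.exp (c * x) := by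
  have h := (isLittleO_pow_exp_pos_mul_atTop 1 hc).def (c := (|K| + 1)⁻¹) (by positivity)
  filter_upwards [h, eventually_ge_atTop 0] with x hx hx0
  rw [pow_one, Real.norm_of_nonneg hx0, Real.norm_of_nonneg (Real.exp_pos _).le,
    inv_mul_eq_div, le_div_iff₀ (by positivity)] at hx
  nlinarith [le_abs_self K]

lemma norm_dirPoly_le_inter_add_sdiff (S S' : Finset ℕ) (b : ℕ → ℂ) (x : ℝ) :
    ‖dirPoly S b x‖ ≤ ‖dirPoly (S ∩ S') b x‖ + ‖dirPoly (S \ S') b x‖ := by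
  have : dirPoly S b x = dirPoly (S ∩ S') b x + dirPoly (S \ S') b x :=
    (Finset.sum_inter_add_sum_sdiff S S' _).symm
  rw [this]
  exact norm_add_le _ _

lemma two_mul_log_add_le {y V : ℝ} (hV : 0 < V) (hy : 2 * (6 + V) ≤ y) :
    2 * Real.log y + V ≤ y := by
  have h1 := Real.log_le_sub_one_of_pos (show 0 < y / 4 by linarith)
  have h2 := Real.log_le_sub_one_of_pos (show (0 : ℝ) < 4 by norm_num)
  rw [Real.log_div (by linarith) (by norm_num)] at h1
  linarith

set_option maxHeartbeats 2000000 in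
/-- On GRH, away from a set where the majorant `g` is at least `1`, the product is bounded by
`(log T)^{(m+2)ε}` times a function `H` whose mean value is controlled by the variance of the
prime sum; the mean value of `g` is smaller than any prescribed power of `log T`. -/
theorem exists_good_bad_majorant {q : ℕ} [NeZero q] (hGRH : GRHmod q)
    (a : DirichletCharacter ℂ q → ℕ) {ε A : ℝ} (hε : 0 < ε) (hA : 0 < A) :
    ∃ D : ℝ, ∀ᶠ T : ℝ in atTop, ∃ H g : ℝ → ℝ,
      Continuous H ∧ Continuous g ∧ (∀ t, 0 ≤ H t) ∧ (∀ t, 0 ≤ g t) ∧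
      ∫ t in T..(2 * T), H t ≤ D * T *
        Real.log T ^ (((∑ χ, a χ ^ 2 : ℕ) : ℝ) / 4 + (((∑ χ, a χ : ℕ) : ℝ) + 4) * ε) ∧
      ∫ t in T..(2 * T), g t ≤ D * T * Real.exp (-(A * Real.log (Real.log T))) ∧
      ∀ t, T ≤ t → t ≤ 2 * T → g t < 1 → absProd a t ≤ H t := by
  obtain ⟨C, hC, hCb⟩ := exists_absProd_le_exp hGRH a
  obtain ⟨C₁, hC₁, hC₁b⟩ := exists_sum_normSq_charSum_le a hε
  obtain ⟨C₂, hC₂, hC₂b⟩ := exists_sum_log_div_le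
  obtain ⟨V, hV, hVb⟩ := exists_sum_inv_le
  set m : ℝ := ((∑ χ, a χ : ℕ) : ℝ) with hm
  set s₂ : ℝ := ((∑ χ, a χ ^ 2 : ℕ) : ℝ) with hs₂
  have hm0 : 0 ≤ m := Nat.cast_nonneg _
  have hs₂0 : 0 ≤ s₂ := Nat.cast_nonneg _
  set W : ℝ := s₂ + ε + C₁ with hW
  have hW0 : 0 < W := by positivity
  set B : ℝ := A + Real.exp 1 * W with hB
  have hB0 : 0 < B := by positivity
  set V₂ : ℝ := m ^ 2 * (C₂ * (C * (2 * (B + 1)) / ε)) with hV₂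
  have hV₂0 : 0 ≤ V₂ := by positivity
  set R : ℝ := 2 * C * A / ε with hR
  have hR0 : 0 < R := by positivity
  set N₃ : ℕ := ⌈2 * A / ε⌉₊ with hN₃
  have hN₃le : 2 * A / ε ≤ N₃ := Nat.le_ceil _
  rw [div_le_iff₀ hε] at hN₃le
  refine ⟨12 * (2 * B + 3) / ε * Real.exp (1 + C₁ / 4) + (3 + 3 * Real.exp R + 3), ?_⟩
  have hlim : Tendsto (fun T : ℝ => Real.log (Real.log T)) atTop atTop :=
    Real.tendsto_log_atTop.comp Real.tendsto_log_atTop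
  filter_upwards [eventually_ge_atTop (Real.exp (Real.exp 1)),
    hlim.eventually (eventually_ge_atTop (2 * C / ε)),
    hlim.eventually (eventually_ge_atTop (2 * N₃ * C / ε)),
    hlim.eventually (eventually_ge_atTop (V₂ * Real.exp R / (2 * C * ε))),
    hlim.eventually (eventually_ge_atTop (2 * (6 + V) / ε)),
    hlim.eventually (eventually_mul_le_exp (48 * ε / C) one_pos),
    hlim.eventually (eventually_mul_le_exp (N₃ * (m ^ 2 * (2 + V))) (half_pos hε))]
    with T hT hl1 hl2 hl3 hl4 hl5 hl6
  have hT0 : 0 < T := (Real.exp_pos _).trans_le hT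
  have hlT : Real.exp 1 ≤ Real.log T := (Real.le_log_iff_exp_le hT0).2 hT
  have hlT0 : 0 < Real.log T := (Real.exp_pos _).trans_le hlT
  set lam : ℝ := Real.log (Real.log T) with hlam
  have hlam1 : 1 ≤ lam := (Real.le_log_iff_exp_le hlT0).2 hlT
  have hlam0 : 0 < lam := by linarith
  have hexplam : Real.exp lam = Real.log T := Real.exp_log hlT0
  rw [div_le_iff₀ hε] at hl1 hl2 hl4
  rw [div_le_iff₀ (by positivity)] at hl3
  rw [one_mul, hexplam, div_mul_eq_mul_div, div_le_iff₀ hC] at hl5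
  have hεl : 0 < ε * lam := by positivity
  have hεl1 : 1 ≤ ε * lam := by linarith
  set L : ℝ := C * Real.log T / (ε * lam) with hL
  have hL48 : 48 ≤ L := by rw [hL, le_div_iff₀ hεl]; linarith
  have hL0 : 0 < L := by linarith
  have hLl : L * (ε * lam) = C * Real.log T := by rw [hL]; field_simp
  have hL2 : 2 * L ≤ Real.log T := by
    rw [hL, mul_div_assoc', div_le_iff₀ hεl]
    have := mul_le_mul_of_nonneg_right hl1 hlT0.le
    linarith
  have hlogL : Real.log L ≤ lam := Real.log_le_log hL0 (by linarith)
  obtain ⟨c, d, hc, hd, hE⟩ := hCb T L hT0 hL48 hL2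
  set Ly : ℝ := Real.log T / (2 * (B + 1) * lam) with hLy
  have hLy0 : 0 < Ly := by positivity
  set J : ℕ := ⌈B * lam⌉₊ with hJ
  have hJ1 : B * lam ≤ J := Nat.le_ceil _
  have hJ2 : (J : ℝ) ≤ (B + 1) * lam := by
    have := (Nat.ceil_lt_add_one (show 0 ≤ B * lam by positivity)).le
    linarith
  have hJ0 : (0 : ℝ) < J := lt_of_lt_of_le (by positivity) hJ1
  have hJL : 2 * J * Ly ≤ Real.log T := by
    rw [hLy, mul_div_assoc', div_le_iff₀ (by positivity)]
    have := mul_le_mul_of_nonneg_right hJ2 hlT0.le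
    linarith
  set S₁ := expPrimes L ∩ expPrimes Ly with hS₁
  set S₂ := expPrimes L \ expPrimes Ly with hS₂
  set U₁ := expPrimes L ∩ expPrimes (ε * lam) with hU₁
  set U₂ := expPrimes L \ expPrimes (ε * lam) with hU₂
  have hS₁L : ∀ p ∈ S₁, p ∈ expPrimes L := fun p hp => (Finset.mem_inter.1 hp).1
  have hS₂L : ∀ p ∈ S₂, p ∈ expPrimes L := fun p hp => (Finset.mem_sdiff.1 hp).1
  have hU₂L : ∀ p ∈ U₂, p ∈ expPrimes L := fun p hp => (Finset.mem_sdiff.1 hp).1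
  have hU₁L : ∀ p ∈ U₁, p ∈ expPrimes L := fun p hp => (Finset.mem_inter.1 hp).1
  have hS₁p : ∀ p ∈ S₁, p.Prime ∧ (p : ℝ) ≤ Real.exp Ly := fun p hp =>
    mem_expPrimes.1 (Finset.mem_inter.1 hp).2
  have hv₁ : ∑ p ∈ S₁, ‖c p‖ ^ 2 ≤ (s₂ + ε) * lam + C₁ := by
    calc ∑ p ∈ S₁, ‖c p‖ ^ 2 ≤ ∑ p ∈ expPrimes L, ‖c p‖ ^ 2 :=
          Finset.sum_le_sum_of_subset_of_nonneg hS₁L fun p _ _ => by positivity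
      _ ≤ (s₂ + ε) * Real.log L + C₁ := (Finset.sum_le_sum hc).trans (hC₁b L (by linarith))
      _ ≤ _ := by gcongr
  have hv₁' : ∑ p ∈ S₁, ‖c p‖ ^ 2 ≤ W * lam := by
    refine hv₁.trans ?_
    rw [hW]
    have := mul_le_mul_of_nonneg_left hlam1 hC₁.le
    linarith
  have hv₂ : ∑ p ∈ S₂, ‖c p‖ ^ 2 ≤ V₂ := by
    refine (sum_norm_sq_le_of_le fun p hp => hc p (hS₂L p hp)).trans ?_
    rw [hV₂]
    gcongr
    refine (sum_inv_sdiff_le hC₂b (by linarith) hLy0).trans (le_of_eq ?_)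
    rw [hL, hLy]
    field_simp
  have hv₃ : ∑ p ∈ U₂, ‖d p‖ ^ 2 ≤ m ^ 2 * (2 + V) * lam * Real.exp (-(ε * lam)) := by
    have h1 : ∀ p ∈ U₂, ‖d p‖ ^ 2 ≤ m ^ 2 * Real.exp (-(ε * lam)) * ((1 : ℝ) / p) := by
      intro p hp
      have hpp := (mem_expPrimes.1 (hU₂L p hp)).1
      have hp0 : (0 : ℝ) < p := by exact_mod_cast hpp.pos
      have hpz : Real.exp (ε * lam) ≤ p := by
        by_contra hcon
        exact (Finset.mem_sdiff.1 hp).2 (mem_expPrimes.2 ⟨hpp, (not_le.1 hcon).le⟩)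
      have hd1 : ‖d p‖ ^ 2 ≤ (m / p) ^ 2 := by
        have := hd p (hU₂L p hp)
        gcongr
      have hinv : (1 : ℝ) / p ≤ Real.exp (-(ε * lam)) := by
        rw [Real.exp_neg, one_div]
        gcongr
      calc ‖d p‖ ^ 2 ≤ m ^ 2 * ((1 : ℝ) / p) * ((1 : ℝ) / p) := hd1.trans (le_of_eq (by ring))
        _ ≤ _ := by gcongr
    calc _ ≤ m ^ 2 * Real.exp (-(ε * lam)) * ∑ p ∈ U₂, (1 : ℝ) / p := by
          rw [Finset.mul_sum]; exact Finset.sum_le_sum h1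
      _ ≤ m ^ 2 * Real.exp (-(ε * lam)) * ∑ p ∈ expPrimes L, (1 : ℝ) / p := by
          gcongr
          exact Finset.sdiff_subset
      _ ≤ m ^ 2 * Real.exp (-(ε * lam)) * ((2 + V) * lam) := by
          gcongr
          refine (hVb L (by linarith)).trans ?_
          have := mul_le_mul_of_nonneg_left hlam1 hV.le
          linarith
      _ = _ := by ring
  have hsmall : ∀ x, ‖dirPoly U₁ d x‖ ≤ m * (ε * lam) := by
    intro x
    refine (norm_dirPoly_le _ _ _).trans ?_
    calc ∑ p ∈ U₁, ‖d p‖ ≤ ∑ p ∈ U₁, m * ((1 : ℝ) / p) :=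
          Finset.sum_le_sum fun p hp => (hd p (hU₁L p hp)).trans (by rw [mul_one_div])
      _ ≤ m * ∑ p ∈ expPrimes (ε * lam), (1 : ℝ) / p := by
          rw [← Finset.mul_sum]
          gcongr
          exact Finset.inter_subset_right
      _ ≤ m * (ε * lam) := by
          gcongr
          exact (hVb _ hεl1).trans (two_mul_log_add_le hV (by linarith))
  set N₂ : ℕ := ⌊ε * lam / (2 * C)⌋₊ with hN₂
  have hN₂a : (N₂ : ℝ) ≤ ε * lam / (2 * C) := Nat.floor_le (by positivity)
  have hN₂b : ε * lam / (2 * C) ≤ N₂ + 1 := (Nat.lt_floor_add_one _).le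
  have hN₂c := hN₂a
  rw [le_div_iff₀ (by positivity)] at hN₂c
  have hg₁ := integral_dirPoly_div_pow_le S₁ c J (L := Ly) (T := T) (u := 1) (y := J)
    (s := W * lam) (r := Real.exp (-1)) hLy0.le le_rfl hS₁p hT0 hJL hJ0 hv₁' (by
      rw [sq, mul_assoc]
      refine mul_le_mul_of_nonneg_left ?_ hJ0.le
      rw [Real.exp_neg, ← div_eq_mul_inv, le_div_iff₀ (Real.exp_pos _)]
      refine le_trans ?_ hJ1
      rw [hB]
      linarith [mul_pos hA hlam0])
  have hg₂ := integral_dirPoly_div_pow_le S₂ c N₂ (L := L) (T := T) (u := 1) (y := ε * lam)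
    (s := V₂) (r := Real.exp (-R)) hL0.le le_rfl (fun p hp => mem_expPrimes.1 (hS₂L p hp)) hT0
    (by
      have h1 := mul_le_mul_of_nonneg_right hN₂c hL0.le
      have : 2 * N₂ * L * C ≤ Real.log T * C := by linarith
      exact le_of_mul_le_mul_right this hC) hεl hv₂ (by
      rw [Real.exp_neg, ← div_eq_mul_inv, le_div_iff₀ (Real.exp_pos _)]
      have h1 : N₂ * (2 * C) * (V₂ * Real.exp R) ≤ ε * lam * (lam * (2 * C * ε)) :=
        mul_le_mul hN₂c hl3 (by positivity) hεl.le
      have h2 : N₂ * V₂ * Real.exp R * (2 * C) ≤ (ε * lam) ^ 2 * (2 * C) := by linarith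
      exact le_of_mul_le_mul_right h2 (by positivity))
  have hg₃ := integral_dirPoly_div_pow_le U₂ d N₃ (L := L) (T := T) (u := 2) (y := 1)
    (s := m ^ 2 * (2 + V) * lam * Real.exp (-(ε * lam))) (r := Real.exp (-(ε / 2 * lam)))
    hL0.le one_le_two (fun p hp => mem_expPrimes.1 (hU₂L p hp)) hT0
    (by
      have h1 := mul_le_mul_of_nonneg_right hl2 hL0.le
      have : 2 * N₃ * L * C ≤ Real.log T * C := by linarith
      exact le_of_mul_le_mul_right this hC) one_pos hv₃ (by
      calc (N₃ : ℝ) * (m ^ 2 * (2 + V) * lam * Real.exp (-(ε * lam)))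
          = N₃ * (m ^ 2 * (2 + V)) * lam * Real.exp (-(ε * lam)) := by ring
        _ ≤ Real.exp (ε / 2 * lam) * Real.exp (-(ε * lam)) := by gcongr
        _ = _ := by rw [← Real.exp_add, one_pow, one_mul]; ring_nf)
  have hH := integral_sum_dirPoly_pow_le S₁ c J hLy0.le hS₁p hT0 hJL hv₁
  have hc₁ := continuous_dirPoly S₁ c
  have hc₂ := continuous_dirPoly S₂ c
  have hc₃ := continuous_dirPoly U₂ d
  refine ⟨fun t => Real.exp (1 + (m + 2) * (ε * lam)) * (4 * ∑ j ∈ Finset.range (J + 1),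
      ‖dirPoly S₁ c (1 * t)‖ ^ (2 * j) / (2 * j).factorial),
    fun t => (‖dirPoly S₁ c (1 * t)‖ / J) ^ (2 * J) +
      (‖dirPoly S₂ c (1 * t)‖ / (ε * lam)) ^ (2 * N₂) + (‖dirPoly U₂ d (2 * t)‖ / 1) ^ (2 * N₃),
    by fun_prop, by fun_prop, fun t => by positivity, fun t => by positivity, ?_, ?_, ?_⟩
  · rw [intervalIntegral.integral_const_mul, intervalIntegral.integral_const_mul]
    have h2J : (2 * J + 1 : ℝ) ≤ (2 * B + 3) / ε * Real.exp (ε * lam) := by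
      have h1 : ε * lam ≤ Real.exp (ε * lam) := by linarith [Real.add_one_le_exp (ε * lam)]
      calc (2 * J + 1 : ℝ) ≤ (2 * B + 3) * lam := by linarith
        _ = (2 * B + 3) / ε * (ε * lam) := by field_simp
        _ ≤ _ := by gcongr
    have hpow : Real.log T ^ (s₂ / 4 + (m + 4) * ε) = Real.exp ((s₂ / 4 + (m + 4) * ε) * lam) := by
      rw [Real.rpow_def_of_pos hlT0, mul_comm]
    rw [hpow]
    calc _ ≤ Real.exp (1 + (m + 2) * (ε * lam)) * (4 * (3 * T *
            ((2 * B + 3) / ε * Real.exp (ε * lam)) *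
              Real.exp (((s₂ + ε) * lam + C₁) / 4))) := by
          refine mul_le_mul_of_nonneg_left (mul_le_mul_of_nonneg_left (hH.trans ?_) (by norm_num))
            (Real.exp_pos _).le
          gcongr
      _ = 12 * (2 * B + 3) / ε * T * (Real.exp (1 + (m + 2) * (ε * lam)) * Real.exp (ε * lam) *
            Real.exp (((s₂ + ε) * lam + C₁) / 4)) := by ring
      _ = 12 * (2 * B + 3) / ε * T * Real.exp (1 + C₁ / 4 + (s₂ / 4 + (m + 3 + 1 / 4) * ε) * lam) := by
          rw [← Real.exp_add, ← Real.exp_add]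
          congr 2
          ring
      _ ≤ 12 * (2 * B + 3) / ε * T * Real.exp (1 + C₁ / 4 + (s₂ / 4 + (m + 4) * ε) * lam) := by
          refine mul_le_mul_of_nonneg_left (Real.exp_le_exp.2 ?_) (by positivity)
          linarith
      _ = 12 * (2 * B + 3) / ε * Real.exp (1 + C₁ / 4) * T *
            Real.exp ((s₂ / 4 + (m + 4) * ε) * lam) := by
          rw [Real.exp_add (1 + C₁ / 4)]; ring
      _ ≤ _ := by
          gcongr
          have := Real.exp_pos R
          linarith
  · have hi₁ : IntervalIntegrable (fun t => (‖dirPoly S₁ c (1 * t)‖ / J) ^ (2 * J))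
        volume T (2 * T) := Continuous.intervalIntegrable (by fun_prop) _ _
    have hi₂ : IntervalIntegrable (fun t => (‖dirPoly S₂ c (1 * t)‖ / (ε * lam)) ^ (2 * N₂))
        volume T (2 * T) := Continuous.intervalIntegrable (by fun_prop) _ _
    have hi₃ : IntervalIntegrable (fun t => (‖dirPoly U₂ d (2 * t)‖ / 1) ^ (2 * N₃))
        volume T (2 * T) := Continuous.intervalIntegrable (by fun_prop) _ _
    rw [intervalIntegral.integral_add (hi₁.add hi₂) hi₃, intervalIntegral.integral_add hi₁ hi₂]
    have e₁ : Real.exp (-1) ^ J ≤ Real.exp (-(A * lam)) := by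
      rw [← Real.exp_nat_mul, Real.exp_le_exp]
      have : A * lam ≤ B * lam := by
        gcongr
        rw [hB]
        have : 0 < Real.exp 1 * W := by positivity
        linarith
      linarith
    have e₂ : Real.exp (-R) ^ N₂ ≤ Real.exp R * Real.exp (-(A * lam)) := by
      rw [← Real.exp_nat_mul, ← Real.exp_add, Real.exp_le_exp]
      have h1 : R * (ε * lam / (2 * C)) = A * lam := by rw [hR]; field_simp
      have h2 := mul_le_mul_of_nonneg_left hN₂b hR0.le
      rw [h1] at h2
      linarith
    have e₃ : Real.exp (-(ε / 2 * lam)) ^ N₃ ≤ Real.exp (-(A * lam)) := by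
      rw [← Real.exp_nat_mul, Real.exp_le_exp]
      have := mul_le_mul_of_nonneg_right hN₃le hlam0.le
      linarith
    have hpos : 0 ≤ 12 * (2 * B + 3) / ε * Real.exp (1 + C₁ / 4) := by positivity
    calc _ ≤ 3 * T * Real.exp (-(A * lam)) + 3 * T * (Real.exp R * Real.exp (-(A * lam))) +
          3 * T * Real.exp (-(A * lam)) := by
          refine add_le_add (add_le_add (hg₁.trans ?_) (hg₂.trans ?_)) (hg₃.trans ?_) <;> gcongr
      _ = (0 + (3 + 3 * Real.exp R + 3)) * T * Real.exp (-(A * lam)) := by ring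
      _ ≤ _ := by gcongr
  · intro t ht1 ht2 hgt
    have one_of_le {x : ℝ} {n : ℕ} (hx : 1 ≤ x) : 1 ≤ x ^ n := one_le_pow₀ hx
    have p₁ : 0 ≤ (‖dirPoly S₁ c (1 * t)‖ / J) ^ (2 * J) := by positivity
    have p₂ : 0 ≤ (‖dirPoly S₂ c (1 * t)‖ / (ε * lam)) ^ (2 * N₂) := by positivity
    have p₃ : 0 ≤ (‖dirPoly U₂ d (2 * t)‖ / 1) ^ (2 * N₃) := by positivity
    have b₁ : ‖dirPoly S₁ c (1 * t)‖ ≤ J := by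
      by_contra! hcon
      have := one_of_le (n := 2 * J) ((one_le_div hJ0).2 hcon.le)
      linarith
    have b₂ : ‖dirPoly S₂ c (1 * t)‖ ≤ ε * lam := by
      by_contra! hcon
      have := one_of_le (n := 2 * N₂) ((one_le_div hεl).2 hcon.le)
      linarith
    have b₃ : ‖dirPoly U₂ d (2 * t)‖ ≤ 1 := by
      by_contra! hcon
      have := one_of_le (n := 2 * N₃) ((one_le_div one_pos).2 hcon.le)
      linarith
    have hCL : C * Real.log T / L = ε * lam := by
      rw [← hLl]; field_simp
    have hP := norm_dirPoly_le_inter_add_sdiff (expPrimes L) (expPrimes Ly) c t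
    have hQ := norm_dirPoly_le_inter_add_sdiff (expPrimes L) (expPrimes (ε * lam)) d (2 * t)
    have hs := hsmall (2 * t)
    refine (hE t ht1 ht2).trans ?_
    calc _ ≤ Real.exp (1 + (m + 2) * (ε * lam) + ‖dirPoly S₁ c (1 * t)‖) := by
          rw [Real.exp_le_exp, hCL]
          rw [one_mul] at b₂ ⊢
          linarith
      _ ≤ _ := by
          rw [Real.exp_add (1 + (m + 2) * (ε * lam))]
          exact mul_le_mul_of_nonneg_left (exp_le_four_mul_sum (norm_nonneg _) b₁)
            (Real.exp_pos _).le

/-- On GRH, the `T`-mean of `∏ |L(1/2+it,χ)|^{a_χ}` is at most `(log T)^{∑ a_χ²/4 + ε}`. -/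
theorem exists_integral_absProd_le {q : ℕ} [NeZero q] (hGRH : GRHmod q)
    (a : DirichletCharacter ℂ q → ℕ) {ε : ℝ} (hε : 0 < ε) :
    ∃ D : ℝ, 0 < D ∧ ∀ᶠ T : ℝ in atTop, ∫ t in T..(2 * T), absProd a t ≤
      D * T * Real.log T ^ (((∑ χ, a χ ^ 2 : ℕ) : ℝ) / 4 + (((∑ χ, a χ : ℕ) : ℝ) + 4) * ε) := by
  obtain ⟨A, C, hA, hC, hcrude⟩ := exists_integral_absProd_le_pow hGRH fun χ => 2 * a χ
  obtain ⟨D, hD⟩ := exists_good_bad_majorant hGRH a hε hA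
  refine ⟨|D| + C + |D|, by positivity, ?_⟩
  filter_upwards [hD, eventually_ge_atTop (Real.exp (Real.exp 1))] with T hDT hT
  obtain ⟨H, g, hHc, hgc, hH0, hg0, hHi, hgi, hgood⟩ := hDT
  have hT0 : 0 < T := (Real.exp_pos _).trans_le hT
  have hlT : Real.exp 1 ≤ Real.log T := (Real.le_log_iff_exp_le hT0).2 hT
  have hlT1 : 1 ≤ Real.log T := (Real.one_le_exp zero_le_one).trans hlT
  have hc := hcrude T hT
  simp only [absProd_two_mul] at hc
  set θ : ℝ := ((∑ χ, a χ ^ 2 : ℕ) : ℝ) / 4 + (((∑ χ, a χ : ℕ) : ℝ) + 4) * ε with hθ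
  have hθ0 : 0 ≤ θ := by positivity
  set X : ℝ := Real.log T ^ A with hX
  have hX0 : 0 < X := Real.rpow_pos_of_pos (by linarith) _
  have hηX : Real.exp (-(A * Real.log (Real.log T))) = X⁻¹ := by
    rw [Real.exp_neg, hX, Real.rpow_def_of_pos (by linarith), mul_comm]
  rw [hηX] at hgi
  have hpt : ∀ t ∈ Set.Icc T (2 * T),
      absProd a t ≤ H t + (X⁻¹ * absProd a t ^ 2 + X * g t) := by
    intro t ht
    have hE0 := absProd_nonneg a t
    rcases lt_or_ge (g t) 1 with h | h
    · have h1 : 0 ≤ X⁻¹ * absProd a t ^ 2 := by positivity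
      have h2 : 0 ≤ X * g t := mul_nonneg hX0.le (hg0 t)
      linarith [hgood t ht.1 ht.2 h]
    · have h1 : X ≤ X * g t := le_mul_of_one_le_right hX0.le h
      have h2 : X⁻¹ * (absProd a t - X) ^ 2 = X⁻¹ * absProd a t ^ 2 - 2 * absProd a t + X := by
        field_simp
        ring
      have h3 : 0 ≤ X⁻¹ * (absProd a t - X) ^ 2 := by positivity
      linarith [hH0 t]
  have hT2 : T ≤ 2 * T := by linarith
  have hEi := intervalIntegrable_absProd a hT0
  have hE2i : IntervalIntegrable (fun t => X⁻¹ * absProd a t ^ 2) volume T (2 * T) := by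
    have := intervalIntegrable_absProd (fun χ => 2 * a χ) hT0
    simp only [funext (absProd_two_mul a)] at this
    exact this.const_mul _
  have hXg : IntervalIntegrable (fun t => X * g t) volume T (2 * T) :=
    (hgc.const_mul X).intervalIntegrable _ _
  have hHii : IntervalIntegrable H volume T (2 * T) := hHc.intervalIntegrable _ _
  have hpow1 : 1 ≤ Real.log T ^ θ := Real.one_le_rpow hlT1 hθ0
  have hDabs := le_abs_self D
  calc ∫ t in T..(2 * T), absProd a t
      ≤ ∫ t in T..(2 * T), (H t + (X⁻¹ * absProd a t ^ 2 + X * g t)) :=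
        intervalIntegral.integral_mono_on hT2 hEi (hHii.add (hE2i.add hXg)) hpt
    _ = (∫ t in T..(2 * T), H t) + (X⁻¹ * (∫ t in T..(2 * T), absProd a t ^ 2) +
          X * ∫ t in T..(2 * T), g t) := by
        rw [intervalIntegral.integral_add hHii (hE2i.add hXg),
          intervalIntegral.integral_add hE2i hXg, intervalIntegral.integral_const_mul,
          intervalIntegral.integral_const_mul]
    _ ≤ |D| * T * Real.log T ^ θ + (X⁻¹ * (C * T * X) + X * (|D| * T * X⁻¹)) := by
        gcongr
        · exact hHi.trans (by gcongr)
        · exact hgi.trans (by gcongr)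
    _ = |D| * T * Real.log T ^ θ + (C * T + |D| * T) * 1 := by
        field_simp
    _ ≤ |D| * T * Real.log T ^ θ + (C * T + |D| * T) * Real.log T ^ θ := by gcongr
    _ = _ := by ring

lemma sum_sq_add_two_le {ι : Type*} [Fintype ι] {f g : ι → ℕ} {k : ℕ} (hf : ∑ i, f i = k)
    (hg : ∑ i, g i = k) (hne : f ≠ g) : ∑ i, (f i + g i) ^ 2 + 2 ≤ (2 * k) ^ 2 := by
  have hconc : ∀ {f : ι → ℕ}, ∑ i, f i = k → ∀ j, f j = k → ∀ i, i ≠ j → f i = 0 := by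
    intro f hf j hj i hij
    have h := Finset.add_sum_erase Finset.univ f (Finset.mem_univ j)
    rw [hf, hj, Nat.add_eq_left, Finset.sum_eq_zero_iff] at h
    exact h i (Finset.mem_erase.2 ⟨hij, Finset.mem_univ i⟩)
  have hk : k ≠ 0 := by
    rintro rfl
    rw [Finset.sum_eq_zero_iff] at hf hg
    exact hne (funext fun i => by rw [hf i (Finset.mem_univ i), hg i (Finset.mem_univ i)])
  have hlt : ∀ j, f j + g j + 1 ≤ 2 * k := by
    intro j
    have h1 : f j ≤ k := hf ▸ Finset.single_le_sum (fun _ _ => Nat.zero_le _) (Finset.mem_univ j)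
    have h2 : g j ≤ k := hg ▸ Finset.single_le_sum (fun _ _ => Nat.zero_le _) (Finset.mem_univ j)
    by_contra! hcon
    have h3 : f j = k := by omega
    have h4 : g j = k := by omega
    refine hne (funext fun i => ?_)
    rcases eq_or_ne i j with rfl | hij
    · rw [h3, h4]
    · rw [hconc hf j h3 i hij, hconc hg j h4 i hij]
  have hsum : ∑ i, (f i + g i) = 2 * k := by rw [Finset.sum_add_distrib, hf, hg, two_mul]
  have h : ∑ i, (f i + g i) * (f i + g i + 1) ≤ ∑ i, (f i + g i) * (2 * k) :=
    Finset.sum_le_sum fun i _ => Nat.mul_le_mul_left _ (hlt i)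
  rw [← Finset.sum_mul, hsum] at h
  have h' : ∑ i, (f i + g i) * (f i + g i + 1) = ∑ i, (f i + g i) ^ 2 + 2 * k := by
    rw [← hsum, ← Finset.sum_add_distrib]
    exact Finset.sum_congr rfl fun i _ => by ring
  rw [sq]
  omega

lemma norm_Ll_mul_conj_Ll {q : ℕ} [NeZero q] (ℓ₁ ℓ₂ : DirichletCharacter ℂ q → ℕ) (t : ℝ) :
    ‖Ll ℓ₁ (1 / 2 + t * I) * starRingEnd ℂ (Ll ℓ₂ (1 / 2 + t * I))‖ =
      absProd (fun χ => ℓ₁ χ + ℓ₂ χ) t := by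
  rw [norm_mul, RCLike.norm_conj, Ll, Ll, norm_prod, norm_prod, ← Finset.prod_mul_distrib, absProd]
  exact Finset.prod_congr rfl fun χ _ => by rw [norm_pow, norm_pow, pow_add]

end DirichletMoment

/-- On GRH mod `q`: if `|ℓ⁽¹⁾| = |ℓ⁽²⁾| = k`, `ℓ⁽¹⁾ ≠ ℓ⁽²⁾`, and at least one
of them is not of the form `k·δ^χ`, then
`|∫_T^{2T} 𝓛^{ℓ⁽¹⁾}(1/2+it) conj(𝓛^{ℓ⁽²⁾}(1/2+it)) dt| ≪_{q,k,ε} T (log T)^{k²−1/2+ε}`. -/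
theorem minor_offdiagonal_bound_GRH (q k : ℕ) [NeZero q] (hGRH : GRHmod q)
    (ℓ₁ ℓ₂ : DirichletCharacter ℂ q → ℕ)
    (h1 : ∑ χ : DirichletCharacter ℂ q, ℓ₁ χ = k)
    (h2 : ∑ χ : DirichletCharacter ℂ q, ℓ₂ χ = k)
    (hne : ℓ₁ ≠ ℓ₂)
    (hminor : (∀ χ : DirichletCharacter ℂ q, ℓ₁ ≠ fun ν => if ν = χ then k else 0) ∨
              (∀ χ : DirichletCharacter ℂ q, ℓ₂ ≠ fun ν => if ν = χ then k else 0))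
    (ε : ℝ) (hε : 0 < ε) :
    ∃ C T₀ : ℝ, ∀ T : ℝ, T₀ ≤ T →
      ‖∫ t in T..(2*T),
          Ll ℓ₁ (1/2 + t * Complex.I) * starRingEnd ℂ (Ll ℓ₂ (1/2 + t * Complex.I))‖
        ≤ C * T * Real.log T ^ ((k : ℝ) ^ 2 - 1/2 + ε) := by
  set δ : ℝ := ε / (2 * k + 4) with hδ
  have hδ0 : 0 < δ := by positivity
  obtain ⟨D, hD0, hD⟩ :=
    DirichletMoment.exists_integral_absProd_le hGRH (fun χ => ℓ₁ χ + ℓ₂ χ) hδ0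
  obtain ⟨T₀, hT₀⟩ := eventually_atTop.1 hD
  refine ⟨D, max T₀ (Real.exp 1), fun T hT => ?_⟩
  have hT1 : Real.exp 1 ≤ T := (le_max_right _ _).trans hT
  have hT0 : 0 < T := (Real.exp_pos 1).trans_le hT1
  have hlog : 1 ≤ Real.log T := (Real.le_log_iff_exp_le hT0).2 hT1
  refine (intervalIntegral.norm_integral_le_integral_norm (by linarith)).trans ?_
  simp only [DirichletMoment.norm_Ll_mul_conj_Ll]
  refine (hT₀ T ((le_max_left _ _).trans hT)).trans ?_
  have hsq : ((∑ χ, (ℓ₁ χ + ℓ₂ χ) ^ 2 : ℕ) : ℝ) + 2 ≤ (2 * k) ^ 2 := by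
    exact_mod_cast DirichletMoment.sum_sq_add_two_le h1 h2 hne
  have hsum : ((∑ χ, (ℓ₁ χ + ℓ₂ χ) : ℕ) : ℝ) = 2 * k := by
    rw [Finset.sum_add_distrib, h1, h2]
    push_cast
    ring
  have hδε : (2 * k + 4) * δ = ε := by
    rw [hδ]
    field_simp
  rw [hsum, hδε]
  gcongr
  linarith
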